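/- There exists an absolute constant β₀ such that for β > β₀ and 0 < λ ≤ 1: if λ ∈ I_h = [e^{−4βh−2β}, e^{−4βh−β}], then for every finite simply-connected V ⊂ ℤ², every boundary signing η, every x ∈ V and every integer r ≥ 1, μ_{η,h,V}(|φ_x − h| ≥ r) ≤ e^{−4(β−5)r}. -/

import Mathlib

open scoped BigOperators
open Filter

noncomputable section

attribute [local instance] Classical.propDecidable

/-! ### Basic geometry of the square lattice -/

/-- Sites of the square lattice `ℤ²`. -/
abbrev Site := ℤ × ℤ

/-- The four unit directions. -/
def dirs : Finset Site := {(1, 0), (-1, 0), (0, 1), (0, -1)}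

/-- The box `Λ_n = ⟦-n/2, n/2⟧² ∩ ℤ²`. -/
def box (n : ℕ) : Finset Site :=
  Finset.Icc (-((n : ℤ) / 2)) ((n : ℤ) / 2) ×ˢ Finset.Icc (-((n : ℤ) / 2)) ((n : ℤ) / 2)

/-- SOS gradient energy of a height function on a domain `V`: each nearest-neighbour
edge with at least one endpoint in `V` contributes the absolute height gradient
(the directed sum below counts internal edges twice, whence the factor `1/2`). -/
def sosEnergy (V : Finset Site) (ψ : Site → ℤ) : ℝ :=
  ∑ v ∈ V, ∑ d ∈ dirs,
    (if v + d ∈ V then (1 : ℝ) / 2 else 1) * |(ψ v : ℝ) - (ψ (v + d) : ℝ)|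

/-- The bulk field term `Σ_{v ∈ V} ψ_v`. -/
def sosField (V : Finset Site) (ψ : Site → ℤ) : ℝ := ∑ v ∈ V, (ψ v : ℝ)

/-- The SOS weight `exp(-β Σ|∇ψ| - λ Σ ψ)`. -/
def sosWt (β lam : ℝ) (V : Finset Site) (ψ : Site → ℤ) : ℝ :=
  Real.exp (-(β * sosEnergy V ψ + lam * sosField V ψ))

/-- The inner boundary `∂_i V`. -/
def innerBdry (V : Finset Site) : Finset Site :=
  V.filter fun v => ∃ d ∈ dirs, v + d ∉ V

/-- The interior `V̊ = V ∖ ∂_i V`. -/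
def interiorSites (V : Finset Site) : Finset Site := V \ innerBdry V

/-- The number of edges `|∂_e V|` between `V` and its complement. -/
def edgeBdryCard (V : Finset Site) : ℕ :=
  ∑ v ∈ V, (dirs.filter fun d => v + d ∉ V).card

/-- Nearest-neighbour adjacency. -/
def adjS (u v : Site) : Prop := v - u ∈ dirs

/-- A set of sites is connected (as a subgraph of `ℤ²`). -/
def connectedIn (S : Set Site) : Prop :=
  ∀ x ∈ S, ∀ y ∈ S,
    Relation.ReflTransGen (fun a b => adjS a b ∧ a ∈ S ∧ b ∈ S) x y

/-- A finite set of sites is simply connected: it is connected and its complement is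
connected. -/
def SimplyConn (V : Finset Site) : Prop :=
  connectedIn (↑V : Set Site) ∧ connectedIn ((↑V : Set Site)ᶜ)

/-! ### SOS measures with a boundary signing -/

/-- A boundary signing value: `+`, `-`, `∅` or free. -/
inductive BSign | plus | minus | zero | free

/-- The constraint imposed at an inner-boundary site by a signing, for boundary height
`h`: `+` forces `≥ h`, `-` forces `≤ h`, `∅` forces `= h`, and `f` forces nothing. -/
def BSign.ok : BSign → ℤ → ℤ → Prop
  | .plus, h, t => h ≤ t
  | .minus, h, t => t ≤ h
  | .zero, h, t => t = h
  | .free, _, _ => True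

/-- Height functions with boundary condition identically `h` outside `V`, floor `0`
on `V` (and no ceiling), compatible with the boundary signing `η` along `∂_i V`. -/
def signedConfigs (V : Finset Site) (η : Site → BSign) (h : ℤ) : Set (Site → ℤ) :=
  {ψ | (∀ x, x ∉ V → ψ x = h) ∧ (∀ v ∈ V, 0 ≤ ψ v) ∧
       ∀ v ∈ innerBdry V, BSign.ok (η v) h (ψ v)}

/-- The partition function `Z_{η,h,V}`. -/
def Zsos (β lam : ℝ) (η : Site → BSign) (h : ℤ) (V : Finset Site) : ℝ :=
  ∑' ψ : Site → ℤ, Set.indicator (signedConfigs V η h) (sosWt β lam V) ψ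

/-- Probability of an event under the SOS measure `μ_{η,h,V}`. -/
def Psos (β lam : ℝ) (η : Site → BSign) (h : ℤ) (V : Finset Site)
    (E : Set (Site → ℤ)) : ℝ :=
  (∑' ψ : Site → ℤ, Set.indicator (signedConfigs V η h ∩ E) (sosWt β lam V) ψ) /
    Zsos β lam η h V

/-! ### Contours -/

/-- A (signed geometric) contour, encoded by the finite set of sites it encloses and its
sign (up/down); the contour itself is the dual circuit `(∂_e Int)^*`. -/
structure Contour where
  int : Finset Site
  up : Bool

/-- The length `|γ|` of a contour: the number of boundary edges of its interior. -/
def Contour.len (γ : Contour) : ℕ := edgeBdryCard γ.int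

/-- A valid contour encloses a nonempty simply-connected set of sites. -/
def Contour.valid (γ : Contour) : Prop :=
  γ.int.Nonempty ∧ connectedIn (↑γ.int : Set Site) ∧ connectedIn ((↑γ.int : Set Site)ᶜ)

/-- The constant boundary signing. -/
def constSign (s : BSign) : Site → BSign := fun _ => s

/-- The `h`-renormalized weight `W^rn_h(γ)`. -/
def Wrn (β lam : ℝ) (h : ℤ) (γ : Contour) : ℝ :=
  if γ.up then
    Real.exp (-β * (γ.len : ℝ)) *
      (Zsos β lam (constSign .plus) (h + 1) γ.int / Zsos β lam (constSign .plus) h γ.int)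
  else
    Real.exp (-β * (γ.len : ℝ)) *
      (Zsos β lam (constSign .minus) (h - 1) γ.int / Zsos β lam (constSign .minus) h γ.int)

/-- The `h`-truncated weight `W^tr_h(γ) = min{W^rn_h(γ), e^{-(β-5)|γ|}}`. -/
def Wtr (β lam : ℝ) (h : ℤ) (γ : Contour) : ℝ :=
  min (Wrn β lam h γ) (Real.exp (-(β - 5) * (γ.len : ℝ)))

/-- The elementary diameter bound `min{λ⁻¹, e^{3β(h+1)}}`. -/
def elemBound (β lam : ℝ) (h : ℤ) : ℝ := min (1 / lam) (Real.exp (3 * β * ((h : ℝ) + 1)))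

/-- A set of sites is `h`-elementary small: the enclosing contour (whose ℓ∞-diameter is
one more than that of the enclosed set) has diameter at most `min{λ⁻¹, e^{3β(h+1)}}`. -/
def elemSet (β lam : ℝ) (h : ℤ) (S : Set Site) : Prop :=
  ∀ x ∈ S, ∀ y ∈ S,
    ((max |x.1 - y.1| |x.2 - y.2| : ℤ) : ℝ) + 1 ≤ elemBound β lam h

/-- A contour is `h`-elementary if `diam(γ) ≤ min{λ⁻¹, e^{3β(h+1)}}`. -/
def IsElem (β lam : ℝ) (h : ℤ) (γ : Contour) : Prop := elemSet β lam h (↑γ.int : Set Site)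

/-- Two finite sets of sites share a (primal, equivalently dual) boundary edge. -/
def shareEdge (A B : Finset Site) : Prop :=
  ∃ v, ∃ d ∈ dirs, (v ∈ A ∧ v + d ∉ A) ∧ ((v ∈ B ∧ v + d ∉ B) ∨ (v + d ∈ B ∧ v ∉ B))

/-- Compatibility of a pair of signed contours: they may not cross, and if they overlap
on an edge their signs agree when nested and differ when mutually external. -/
def compatPair (γ γ' : Contour) : Prop :=
  (γ.int ⊆ γ'.int ∨ γ'.int ⊆ γ.int ∨ Disjoint γ.int γ'.int) ∧
  (shareEdge γ.int γ'.int →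
    ((γ.int ⊆ γ'.int ∨ γ'.int ⊆ γ.int) → γ.up = γ'.up) ∧
    (Disjoint γ.int γ'.int → γ.up ≠ γ'.up))

/-- Admissible renormalized families of signed contours in `U`, compatible with the
boundary signing `η` at reference height `h` (no floor constraint except that no
down-contours are allowed when `h = 0`). -/
def famOK (η : Site → BSign) (h : ℤ) (U : Finset Site) (Γ : Multiset Contour) : Prop :=
  (∀ γ ∈ Γ, Contour.valid γ ∧ γ.int ⊆ U) ∧
  (∀ γ ∈ Γ, ∀ γ' ∈ Γ, compatPair γ γ') ∧
  (∀ v ∈ innerBdry U, ∀ γ ∈ Γ, v ∈ γ.int →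
    (γ.up = true → η v ≠ BSign.minus ∧ η v ≠ BSign.zero) ∧
    (γ.up = false → η v ≠ BSign.plus ∧ η v ≠ BSign.zero)) ∧
  (h = 0 → ∀ γ ∈ Γ, γ.up = true)

/-- The product of weights of a family of contours. -/
def prodW (w : Contour → ℝ) (Γ : Multiset Contour) : ℝ := (Γ.map w).prod

/-- The truncated partition function `Z^tr_{η,h,U}`. -/
def Ztr (β lam : ℝ) (η : Site → BSign) (h : ℤ) (U : Finset Site) : ℝ :=
  Real.exp (-lam * (h : ℝ) * (U.card : ℝ)) *
    ∑' Γ : Multiset Contour, Set.indicator {Γ | famOK η h U Γ} (prodW (Wtr β lam h)) Γ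

/-- The renormalized partition function `Z^rn_{η,h,U}`. -/
def Zrn (β lam : ℝ) (η : Site → BSign) (h : ℤ) (U : Finset Site) : ℝ :=
  Real.exp (-lam * (h : ℝ) * (U.card : ℝ)) *
    ∑' Γ : Multiset Contour, Set.indicator {Γ | famOK η h U Γ} (prodW (Wrn β lam h)) Γ

/-- The renormalized elementary partition function `Z^{rn.el}_{η,h,U}`. -/
def Zrnel (β lam : ℝ) (η : Site → BSign) (h : ℤ) (U : Finset Site) : ℝ :=
  Real.exp (-lam * (h : ℝ) * (U.card : ℝ)) *
    ∑' Γ : Multiset Contour,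
      Set.indicator {Γ | famOK η h U Γ ∧ ∀ γ ∈ Γ, IsElem β lam h γ}
        (prodW (Wrn β lam h)) Γ

/-! ### Elementary restriction of the SOS measure -/

/-- `*`-adjacency (adjacency allowing diagonal steps). -/
def starAdj (u v : Site) : Prop := u ≠ v ∧ |u.1 - v.1| ≤ 1 ∧ |u.2 - v.2| ≤ 1

/-- The `*`-connected component of `x` within `S`. -/
def compStar (S : Set Site) (x : Site) : Set Site :=
  {y | Relation.ReflTransGen (fun a b => starAdj a b ∧ a ∈ S ∧ b ∈ S) x y}

/-- The fill of a set of sites: the set together with all sites whose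
complement-component is finite. -/
def fill (C : Set Site) : Set Site :=
  C ∪ {x | {y | Relation.ReflTransGen (fun a b => adjS a b ∧ a ∉ C ∧ b ∉ C) x y}.Finite}

/-- All outermost contours of the configuration `ψ` (with boundary height `h` on `V`)
are `h`-elementary: every filled deviation component is elementary-small. -/
def allOuterElem (β lam : ℝ) (h : ℤ) (V : Finset Site) (ψ : Site → ℤ) : Prop :=
  ∀ v ∈ V, ψ v ≠ h → elemSet β lam h (fill (compStar {u : Site | u ∈ V ∧ ψ u ≠ h} v))

/-- The elementary partition function `Z^el_{η,h,V}`: the contribution to `Z_{η,h,V}`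
of configurations all of whose outermost contours are `h`-elementary. -/
def Zel (β lam : ℝ) (η : Site → BSign) (h : ℤ) (V : Finset Site) : ℝ :=
  ∑' ψ : Site → ℤ,
    Set.indicator (signedConfigs V η h ∩ {ψ | allOuterElem β lam h V ψ})
      (sosWt β lam V) ψ

/-! ### Truncated free energies and the critical sequence -/

/-- `ftr h` is the truncated free energy `f^tr_h(λ)`: the infinite-volume limit of
`|Λ_n|⁻¹ log Z^tr_{η,h,Λ_n}`, for every boundary signing. -/
def FTRlimit (β : ℝ) (ftr : ℕ → ℝ → ℝ) : Prop :=
  ∀ h : ℕ, ∀ lam : ℝ, 0 < lam → lam ≤ 1 → ∀ η : Site → BSign,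
    Tendsto (fun n => Real.log (Ztr β lam η (h : ℤ) (box n)) / ((box n).card : ℝ))
      atTop (nhds (ftr h lam))

/-- `lamc` is the strictly decreasing sequence `(λ_c^{(k)})_{k≥0}` of critical points,
tending to `0`, at which the truncated free energies `ftr` exchange maximizer. -/
def CritSeq (ftr : ℕ → ℝ → ℝ) (lamc : ℕ → ℝ) : Prop :=
  StrictAnti lamc ∧ (∀ i, 0 < lamc i) ∧ Tendsto lamc atTop (nhds 0) ∧
  (∀ i : ℕ, ∀ lam : ℝ, 0 < lam → lam ≤ 1 → lamc i < lam →
    (i = 0 ∨ lam < lamc (i - 1)) → ∀ j : ℕ, j ≠ i → ftr j lam < ftr i lam) ∧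
  (∀ i : ℕ, ftr (i + 1) (lamc i) = ftr i (lamc i) ∧
    ∀ j : ℕ, j ≠ i → j ≠ i + 1 → ftr j (lamc i) < ftr i (lamc i))

/-- `d(x) = min_k |λ_c^{(k)} - x|`. -/
def dmin (lamc : ℕ → ℝ) (x : ℝ) : ℝ := ⨅ k : ℕ, |lamc k - x|

/-- `d⁺(x) = min{λ_c^{(k)} - x : λ_c^{(k)} > x}`. -/
def dplus (lamc : ℕ → ℝ) (x : ℝ) : ℝ := sInf {y : ℝ | ∃ k, x < lamc k ∧ y = lamc k - x}

/-! ### SOS measures with general boundary conditions (floor 0, no ceiling) -/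

/-- Height functions equal to the boundary condition `φ` off `V` and nonnegative on `V`. -/
def bcConfigs (V : Finset Site) (φ : Site → ℤ) : Set (Site → ℤ) :=
  {ψ | (∀ x, x ∉ V → ψ x = φ x) ∧ ∀ v ∈ V, 0 ≤ ψ v}

/-- The partition function with boundary condition `φ`. -/
def Zbc (β lam : ℝ) (V : Finset Site) (φ : Site → ℤ) : ℝ :=
  ∑' ψ : Site → ℤ, Set.indicator (bcConfigs V φ) (sosWt β lam V) ψ

/-- Probability of an event under the SOS measure `μ_{φ,V}` (floor 0, no ceiling). -/
def Pbc (β lam : ℝ) (V : Finset Site) (φ : Site → ℤ) (E : Set (Site → ℤ)) : ℝ :=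
  (∑' ψ : Site → ℤ, Set.indicator (bcConfigs V φ ∩ E) (sosWt β lam V) ψ) /
    Zbc β lam V φ

/-! ### Glauber dynamics on the box with a ceiling -/

/-- A configuration on `Λ_n` with floor `0` and ceiling `ℓ`. -/
abbrev Cfg (n ℓ : ℕ) := {x : Site // x ∈ box n} → Fin (ℓ + 1)

/-- Extension of a configuration by the zero boundary condition. -/
def cExt {n ℓ : ℕ} (ψ : Cfg n ℓ) : Site → ℤ :=
  fun x => if h : x ∈ box n then ((ψ ⟨x, h⟩ : ℕ) : ℤ) else 0

/-- The weight of a configuration (zero boundary conditions). -/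
def cWt (n ℓ : ℕ) (β lam : ℝ) (ψ : Cfg n ℓ) : ℝ := sosWt β lam (box n) (cExt ψ)

/-- The partition function on `Λ_n` with ceiling `ℓ` and zero boundary conditions. -/
def cZ (n ℓ : ℕ) (β lam : ℝ) : ℝ := ∑ ψ : Cfg n ℓ, cWt n ℓ β lam ψ

/-- The SOS probability measure `μ_{n,λ}` (ceiling `ℓ`, zero boundary conditions). -/
def cPi (n ℓ : ℕ) (β lam : ℝ) (ψ : Cfg n ℓ) : ℝ := cWt n ℓ β lam ψ / cZ n ℓ β lam

/-- Probability of an event under `μ_{n,λ}`. -/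
def cProb (n ℓ : ℕ) (β lam : ℝ) (E : Set (Cfg n ℓ)) : ℝ :=
  (∑ ψ : Cfg n ℓ, if ψ ∈ E then cWt n ℓ β lam ψ else 0) / cZ n ℓ β lam

/-- The Glauber (heat-bath) jump rate from `ψ` to `ψ' ≠ ψ`: nonzero only if they differ
at a single site `v` by exactly one, in which case `v`'s height is resampled among
`{ψ_v - 1, ψ_v, ψ_v + 1}` (truncated at the floor and the ceiling) according to the
conditional probabilities given the other heights. -/
def glRate (n ℓ : ℕ) (β lam : ℝ) (ψ ψ' : Cfg n ℓ) : ℝ :=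
  if ψ = ψ' then 0
  else
    ∑ v : {x : Site // x ∈ box n},
      if (∀ u, u ≠ v → ψ u = ψ' u) ∧ (((ψ' v : ℕ) : ℤ) - ((ψ v : ℕ) : ℤ)) ^ 2 = 1 then
        cWt n ℓ β lam ψ' /
          ∑ t : Fin (ℓ + 1),
            (if (((t : ℕ) : ℤ) - ((ψ v : ℕ) : ℤ)) ^ 2 ≤ 1 then
              cWt n ℓ β lam (Function.update ψ v t) else 0)
      else 0

/-- Mean of an observable under `μ_{n,λ}`. -/
def cMean (n ℓ : ℕ) (β lam : ℝ) (f : Cfg n ℓ → ℝ) : ℝ :=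
  ∑ ψ : Cfg n ℓ, cPi n ℓ β lam ψ * f ψ

/-- Variance of an observable under `μ_{n,λ}`. -/
def cVar (n ℓ : ℕ) (β lam : ℝ) (f : Cfg n ℓ → ℝ) : ℝ :=
  ∑ ψ : Cfg n ℓ, cPi n ℓ β lam ψ * (f ψ - cMean n ℓ β lam f) ^ 2

/-- The Dirichlet form of the Glauber dynamics. -/
def cDirichlet (n ℓ : ℕ) (β lam : ℝ) (f : Cfg n ℓ → ℝ) : ℝ :=
  (1 / 2) * ∑ ψ : Cfg n ℓ, ∑ ψ' : Cfg n ℓ,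
    cPi n ℓ β lam ψ * glRate n ℓ β lam ψ ψ' * (f ψ' - f ψ) ^ 2

/-- The spectral gap `gap_{n,λ}` of the generator of the Glauber dynamics (ceiling `ℓ`):
by reversibility, the smallest nonzero eigenvalue of minus the generator equals the
infimum of the Rayleigh quotients `E(f,f)/Var(f)`. -/
def specGap (n ℓ : ℕ) (β lam : ℝ) : ℝ :=
  sInf {r : ℝ | ∃ f : Cfg n ℓ → ℝ,
    cVar n ℓ β lam f ≠ 0 ∧ r = cDirichlet n ℓ β lam f / cVar n ℓ β lam f}

end


set_option linter.unusedVariables false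
set_option linter.unusedSectionVars false
namespace SOS
noncomputable section
open scoped Classical
open Finset

/-! ### Lattice basics -/

/-- the two positive unit vectors -/
def sh (i : Bool) : Site := if i then (1, 0) else (0, 1)

@[simp] lemma sh_true : sh true = (1, 0) := rfl
@[simp] lemma sh_false : sh false = (0, 1) := rfl

lemma adjS_iff (u v : Site) : adjS u v ↔ ∃ i, v = u + sh i ∨ u = v + sh i := by
  obtain ⟨a, b⟩ := u
  obtain ⟨c, d⟩ := v
  simp only [adjS, dirs, Finset.mem_insert, Finset.mem_singleton, Bool.exists_bool, sh_true,
    sh_false, Prod.mk_sub_mk, Prod.mk_add_mk, Prod.mk.injEq]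
  omega

lemma adjS_symm {u v : Site} (h : adjS u v) : adjS v u := by
  rw [adjS_iff] at *
  obtain ⟨i, h | h⟩ := h
  · exact ⟨i, Or.inr h⟩
  · exact ⟨i, Or.inl h⟩

lemma adjS_sh (u : Site) (i : Bool) : adjS u (u + sh i) := (adjS_iff _ _).2 ⟨i, Or.inl rfl⟩

lemma adjS_sub (u : Site) (i : Bool) : adjS u (u - sh i) :=
  (adjS_iff _ _).2 ⟨i, Or.inr (by simp)⟩

/-- reachability inside a set -/
def Reach (S : Set Site) (x y : Site) : Prop :=
  Relation.ReflTransGen (fun a b => adjS a b ∧ a ∈ S ∧ b ∈ S) x y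

lemma Reach.symm {S : Set Site} {x y : Site} (h : Reach S x y) : Reach S y x := by
  induction h with
  | refl => exact Relation.ReflTransGen.refl
  | tail _ h ih =>
    exact Relation.ReflTransGen.head ⟨adjS_symm h.1, h.2.2, h.2.1⟩ ih

lemma Reach.trans {S : Set Site} {x y z : Site} (h : Reach S x y) (h' : Reach S y z) :
    Reach S x z := Relation.ReflTransGen.trans h h'

lemma Reach.mem {S : Set Site} {x y : Site} (h : Reach S x y) (hx : x ∈ S) : y ∈ S := by
  cases h with
  | refl => exact hx
  | tail _ h => exact h.2.2

lemma Reach.step {S : Set Site} {x y : Site} (h : adjS x y) (hx : x ∈ S) (hy : y ∈ S) :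
    Reach S x y := Relation.ReflTransGen.single ⟨h, hx, hy⟩

lemma Reach.mono {S T : Set Site} (hST : S ⊆ T) {x y : Site} (h : Reach S x y) : Reach T x y := by
  induction h with
  | refl => exact Relation.ReflTransGen.refl
  | tail _ h ih => exact Relation.ReflTransGen.tail ih ⟨h.1, hST h.2.1, hST h.2.2⟩

lemma connectedIn_of_root {S : Set Site} (x0 : Site) (h : ∀ x ∈ S, Reach S x x0) :
    connectedIn S := fun x hx y hy => (h x hx).trans (h y hy).symm

/-- a function constant along inside-edges of a connected set is constant -/
lemma connectedIn.const {S : Set Site} (hS : connectedIn S) {α : Type*} (g : Site → α)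
    (hg : ∀ u v, adjS u v → u ∈ S → v ∈ S → g u = g v) {x y : Site} (hx : x ∈ S) (hy : y ∈ S) :
    g x = g y := by
  have := hS x hx y hy
  induction this with
  | refl => rfl
  | tail h1 h ih => exact (ih h.2.1).trans (hg _ _ h.1 h.2.1 h.2.2)

/-- right bound for finite sets -/
lemma exists_right (U : Finset Site) : ∃ X : ℤ, ∀ v ∈ U, v.1 < X := by
  obtain ⟨M, hM⟩ := (U.image Prod.fst).bddAbove
  exact ⟨M + 1, fun v hv => by
    have := hM (Finset.mem_coe.2 (Finset.mem_image_of_mem Prod.fst hv)); omega⟩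

/-! ### Outer contours -/

/-- the exterior: sites reachable from the complement of `U` inside `Q` -/
def Ext (U : Finset Site) (Q : Set Site) : Set Site := {y | ∃ x, x ∉ U ∧ Reach Q x y}

/-- component in the complement of the exterior -/
def comp (U : Finset Site) (Q : Set Site) (v : Site) : Finset Site :=
  U.filter (fun y => Reach (Ext U Q)ᶜ v y)

/-- the family of outer contours -/
def Gam (U : Finset Site) (Q : Set Site) : Finset (Finset Site) :=
  (U.filter (fun v => v ∉ Ext U Q)).image (comp U Q)

/-- contour class -/
def Cls (U : Finset Site) : Finset (Finset Site) :=
  U.powerset.filter (fun γ => γ.Nonempty ∧ connectedIn (↑γ : Set Site) ∧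
    connectedIn ((↑γ : Set Site)ᶜ))

lemma mem_Cls {U γ : Finset Site} : γ ∈ Cls U ↔ γ ⊆ U ∧ γ.Nonempty ∧
    connectedIn (↑γ : Set Site) ∧ connectedIn ((↑γ : Set Site)ᶜ) := by
  simp [Cls]

section
variable {U : Finset Site} {Q : Set Site}

lemma not_mem_Ext {v : Site} (hv : v ∉ Ext U Q) : v ∈ U := by
  by_contra h
  exact hv ⟨v, h, Relation.ReflTransGen.refl⟩

lemma Ext_sub (hQ : ∀ v, v ∉ U → v ∈ Q) {v : Site} (hv : v ∈ Ext U Q) : v ∈ Q := by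
  obtain ⟨x, hx, h⟩ := hv
  exact h.mem (hQ x hx)

lemma Ext_step (hQ : ∀ v, v ∉ U → v ∈ Q) {v w : Site} (hv : v ∈ Ext U Q) (hw : w ∈ Q)
    (h : adjS v w) : w ∈ Ext U Q := by
  obtain ⟨x, hx, hr⟩ := hv
  exact ⟨x, hx, hr.trans (Reach.step h (hr.mem (hQ x hx)) hw)⟩

lemma mem_comp {v y : Site} (hv : v ∉ Ext U Q) : y ∈ comp U Q v ↔ Reach (Ext U Q)ᶜ v y := by
  simp only [comp, Finset.mem_filter]
  exact ⟨fun h => h.2, fun h => ⟨not_mem_Ext (h.mem hv), h⟩⟩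

lemma mem_Gam {γ : Finset Site} : γ ∈ Gam U Q ↔ ∃ v, v ∉ Ext U Q ∧ comp U Q v = γ := by
  simp only [Gam, Finset.mem_image, Finset.mem_filter]
  exact ⟨fun ⟨v, h1, h2⟩ => ⟨v, h1.2, h2⟩, fun ⟨v, h1, h2⟩ => ⟨v, ⟨not_mem_Ext h1, h1⟩, h2⟩⟩

lemma Gam_not_Ext {γ : Finset Site} (hγ : γ ∈ Gam U Q) {v : Site} (hv : v ∈ γ) :
    v ∉ Ext U Q := by
  obtain ⟨x, hx, rfl⟩ := mem_Gam.1 hγ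
  exact ((mem_comp hx).1 hv).mem hx

lemma Gam_step {γ : Finset Site} (hγ : γ ∈ Gam U Q) {v w : Site} (hv : v ∈ γ) (h : adjS v w)
    (hw : w ∉ Ext U Q) : w ∈ γ := by
  have hv' := Gam_not_Ext hγ hv
  obtain ⟨x, hx, rfl⟩ := mem_Gam.1 hγ
  rw [mem_comp hx] at *
  exact hv.trans (Reach.step h hv' hw)

lemma Gam_disj {γ γ' : Finset Site} (hγ : γ ∈ Gam U Q) (hγ' : γ' ∈ Gam U Q) {v : Site}
    (hv : v ∈ γ) (hv' : v ∈ γ') : γ = γ' := by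
  obtain ⟨x, hx, rfl⟩ := mem_Gam.1 hγ
  obtain ⟨y, hy, rfl⟩ := mem_Gam.1 hγ'
  rw [mem_comp hx] at hv
  rw [mem_comp hy] at hv'
  ext z
  rw [mem_comp hx, mem_comp hy]
  exact ⟨fun h => hv'.trans (hv.symm.trans h), fun h => hv.trans (hv'.symm.trans h)⟩

lemma Gam_cover {v : Site} (hv : v ∉ Ext U Q) : ∃ γ ∈ Gam U Q, v ∈ γ :=
  ⟨comp U Q v, mem_Gam.2 ⟨v, hv, rfl⟩, (mem_comp hv).2 Relation.ReflTransGen.refl⟩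

lemma Gam_cover' (hQ : ∀ v, v ∉ U → v ∈ Q) {v : Site} (hv : v ∉ Q) : ∃ γ ∈ Gam U Q, v ∈ γ :=
  Gam_cover (fun h => hv (Ext_sub hQ h))

lemma Gam_bdry (hQ : ∀ v, v ∉ U → v ∈ Q) {γ : Finset Site} (hγ : γ ∈ Gam U Q) {u w : Site}
    (hu : u ∈ γ) (hw : w ∉ γ) (h : adjS u w) :
    u ∉ Q ∧ w ∈ Q ∧ ∀ γ' ∈ Gam U Q, w ∉ γ' := by
  have h1 : w ∈ Ext U Q := by
    by_contra h1
    exact hw (Gam_step hγ hu h h1)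
  refine ⟨fun h2 => Gam_not_Ext hγ hu (Ext_step hQ h1 h2 (adjS_symm h)), Ext_sub hQ h1,
    fun γ' hγ' h3 => Gam_not_Ext hγ' h3 h1⟩

lemma Gam_innerBdry (hQ : ∀ v, v ∉ U → v ∈ Q) {v : Site} (hv : v ∈ innerBdry U) (hvQ : v ∈ Q)
    {γ : Finset Site} (hγ : γ ∈ Gam U Q) : v ∉ γ := by
  intro h
  simp only [innerBdry, Finset.mem_filter] at hv
  obtain ⟨_, d, hd, hn⟩ := hv
  refine Gam_not_Ext hγ h (Ext_step hQ (v := v + d) ⟨v + d, hn, Relation.ReflTransGen.refl⟩ hvQ ?_)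
  apply adjS_symm
  simpa [adjS] using hd

lemma Gam_sub_Cls (hQ : ∀ v, v ∉ U → v ∈ Q) (hU : connectedIn ((↑U : Set Site)ᶜ)) :
    Gam U Q ⊆ Cls U := by
  intro γ hγ
  have hsub : γ ⊆ U := fun v hv => not_mem_Ext (Gam_not_Ext hγ hv)
  rw [mem_Cls]
  refine ⟨hsub, ?_, ?_, ?_⟩
  · obtain ⟨x, hx, rfl⟩ := mem_Gam.1 hγ
    exact ⟨x, (mem_comp hx).2 Relation.ReflTransGen.refl⟩
  · obtain ⟨x, hx, rfl⟩ := mem_Gam.1 hγ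
    have key : ∀ y, Reach (Ext U Q)ᶜ x y → Reach (↑(comp U Q x) : Set Site) x y := by
      intro y hy
      induction hy with
      | refl => exact Relation.ReflTransGen.refl
      | tail h1 h2 ih =>
        refine Relation.ReflTransGen.tail ih ⟨h2.1, ?_, ?_⟩
        · exact Finset.mem_coe.2 ((mem_comp hx).2 h1)
        · exact Finset.mem_coe.2 ((mem_comp hx).2 (Relation.ReflTransGen.tail h1 h2))
    exact connectedIn_of_root x (fun y hy => (key y ((mem_comp hx).1 (Finset.mem_coe.1 hy))).symm)
  · obtain ⟨X, hX⟩ := exists_right U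
    have hx0 : ((X, 0) : Site) ∉ U := fun h => by simpa using hX _ h
    have hUc : ((↑U : Set Site)ᶜ) ⊆ ((↑γ : Set Site)ᶜ) := fun v hv h => hv (hsub h)
    have hout : ∀ w, w ∉ U → Reach ((↑γ : Set Site)ᶜ) w (X, 0) := fun w hw =>
      Reach.mono hUc (hU w (by simpa using hw) (X, 0) (by simpa using hx0))
    have hext : ∀ w, w ∈ Ext U Q → Reach ((↑γ : Set Site)ᶜ) w (X, 0) := by
      rintro w ⟨x, hx, hr⟩
      have : Reach ((↑γ : Set Site)ᶜ) x w := by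
        induction hr with
        | refl => exact Relation.ReflTransGen.refl
        | tail h1 h2 ih =>
          refine Relation.ReflTransGen.tail ih ⟨h2.1, ?_, ?_⟩
          · exact fun h => Gam_not_Ext hγ h ⟨x, hx, h1⟩
          · exact fun h => Gam_not_Ext hγ h ⟨x, hx, Relation.ReflTransGen.tail h1 h2⟩
      exact this.symm.trans (hout x hx)
    have main : ∀ n : ℕ, ∀ w : Site, X - w.1 ≤ n → w ∉ γ → Reach ((↑γ : Set Site)ᶜ) w (X, 0) := by
      intro n
      induction n with
      | zero =>
        intro w hw _
        exact hout w (fun h => by have := hX w h; push_cast at hw; omega)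
      | succ n ih =>
        intro w hw hwγ
        by_cases hE : w ∈ Ext U Q
        · exact hext w hE
        · have hn : w + sh true ∉ γ := fun h =>
            hwγ (Gam_step hγ h (adjS_symm (adjS_sh _ _)) hE)
          refine Reach.trans (Reach.step (adjS_sh w true) (by simpa using hwγ)
            (by simpa using hn)) (ih _ ?_ hn)
          simp at hw ⊢
          omega
    refine connectedIn_of_root (X, 0) (fun w hw => ?_)
    exact main (X - w.1).toNat w (Int.self_le_toNat _) (by simpa using hw)

end
end
end SOS


set_option linter.unusedVariables false
set_option linter.unusedSectionVars false
namespace SOS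
noncomputable section
open scoped Classical
open Finset

/-! ### Boundary edges and counting -/

/-- edges, encoded by base site and direction -/
abbrev Edge := Site × Bool

/-- the edge set `E` contains all edges touching `U` -/
def Good (E : Finset Edge) (U : Finset Site) : Prop :=
  ∀ v ∈ U, ∀ i, (v, i) ∈ E ∧ (v - sh i, i) ∈ E

lemma Good.mono {E : Finset Edge} {U V : Finset Site} (h : Good E U) (hV : V ⊆ U) : Good E V :=
  fun v hv => h v (hV hv)

/-- boundary edges of `γ` -/
def bd (E : Finset Edge) (γ : Finset Site) : Finset Edge :=
  E.filter (fun e => ¬ (e.1 ∈ γ ↔ e.1 + sh e.2 ∈ γ))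

/-- perimeter -/
def per (E : Finset Edge) (γ : Finset Site) : ℕ := (bd E γ).card

lemma mem_bd {E : Finset Edge} {γ : Finset Site} (h : Good E γ) (e : Edge) :
    e ∈ bd E γ ↔ ¬ (e.1 ∈ γ ↔ e.1 + sh e.2 ∈ γ) := by
  simp only [bd, Finset.mem_filter, and_iff_right_iff_imp]
  intro h1
  by_cases h2 : e.1 ∈ γ
  · exact (h _ h2 e.2).1
  · have h3 : e.1 + sh e.2 ∈ γ := by tauto
    have := (h _ h3 e.2).2
    simpa using this

/-- nearby edges -/
def near (e e' : Edge) : Prop := |e.1.1 - e'.1.1| ≤ 1 ∧ |e.1.2 - e'.1.2| ≤ 1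

/-- connectedness of an edge set -/
def ConnE (T : Finset Edge) : Prop :=
  ∀ W ⊆ T, W.Nonempty → (∀ e ∈ W, ∀ e' ∈ T, near e e' → e' ∈ W) → W = T

lemma poincare (f : Edge → ℤ) (X : ℤ) (hX : ∀ e : Edge, X ≤ e.1.1 → f e = 0)
    (hp : ∀ v : Site, f (v, true) + f (v + sh true, false) = f (v, false) + f (v + sh false, true)) :
    ∃ g : Site → ℤ, (∀ v : Site, X ≤ v.1 → g v = 0) ∧ ∀ v i, g v - g (v + sh i) = f (v, i) := by
  let g : Site → ℤ := fun v => ∑ n ∈ Finset.Ico v.1 X, f ((n, v.2), true)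
  have h0 : ∀ v : Site, X ≤ v.1 → g v = 0 := by
    intro v hv
    simp only [g]
    rw [Finset.Ico_eq_empty (by omega)]
    simp
  have h1 : ∀ v, g v - g (v + sh true) = f (v, true) := by
    rintro ⟨x, y⟩
    by_cases hx : X ≤ x
    · rw [h0 _ hx, h0 _ (by simp; omega), hX _ hx]; simp
    · have : Finset.Ico x X = insert x (Finset.Ico (x+1) X) := by
        ext n; simp; omega
      simp only [g, sh_true, Prod.mk_add_mk, add_zero]
      rw [this, Finset.sum_insert (by simp)]
      ring
  have h2 : ∀ n : ℕ, ∀ v : Site, X - v.1 ≤ n → g v - g (v + sh false) = f (v, false) := by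
    intro n
    induction n with
    | zero =>
      intro v hv
      have hv' : X ≤ v.1 := by push_cast at hv; omega
      rw [h0 _ hv', h0 _ (by simpa using hv'), hX _ hv']; simp
    | succ n ih =>
      intro v hv
      have a1 := h1 v
      have a2 := h1 (v + sh false)
      have a3 := ih (v + sh true) (by simp at hv ⊢; omega)
      have a4 := hp v
      rw [show v + sh false + sh true = v + sh true + sh false by abel] at a2
      linarith
  refine ⟨g, h0, fun v i => ?_⟩
  cases i with
  | true => exact h1 v
  | false => exact h2 (X - v.1).toNat v (Int.self_le_toNat _)

lemma bd_conn {E : Finset Edge} {γ : Finset Site} (hE : Good E γ)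
    (hc : connectedIn (↑γ : Set Site)) (hc' : connectedIn ((↑γ : Set Site)ᶜ)) :
    ConnE (bd E γ) := by
  intro W hW hne hcl
  let χ : Site → ℤ := fun v => if v ∈ γ then 1 else 0
  let f : Edge → ℤ := fun e => if e ∈ W then χ e.1 - χ (e.1 + sh e.2) else 0
  obtain ⟨X, hX⟩ := exists_right γ
  have hχT : ∀ e : Edge, χ e.1 - χ (e.1 + sh e.2) ≠ 0 ↔ e ∈ bd E γ := by
    intro e
    rw [mem_bd hE]
    simp only [χ]
    split_ifs <;> simp_all
  have hf0 : ∀ e, f e ≠ 0 ↔ e ∈ W := by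
    intro e
    simp only [f]
    constructor
    · intro h; by_contra h'; simp [h'] at h
    · intro h; rw [if_pos h]; exact (hχT e).2 (hW h)
  have hfW : ∀ e e' : Edge, e ∈ W → near e e' → f e' = χ e'.1 - χ (e'.1 + sh e'.2) := by
    intro e e' he hn
    by_cases h : e' ∈ bd E γ
    · simp only [f]; rw [if_pos (hcl e he e' h hn)]
    · have h1 : f e' = 0 := by
        by_contra h1; exact h (hW ((hf0 e').1 h1))
      have h2 : χ e'.1 - χ (e'.1 + sh e'.2) = 0 := by
        by_contra h2; exact h ((hχT e').1 h2)
      rw [h1, h2]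
  have hfX : ∀ e : Edge, X ≤ e.1.1 → f e = 0 := by
    intro e he
    by_contra h
    have h1 := (hχT e).2 (hW ((hf0 e).1 h))
    have h2 : e.1 ∉ γ := fun h => by have := hX _ h; omega
    have h3 : e.1 + sh e.2 ∉ γ := fun h => by
      have := hX _ h
      have h4 : (0:ℤ) ≤ (sh e.2).1 := by cases e.2 <;> simp
      simp at this; omega
    simp [χ, h2, h3] at h1
  have hp : ∀ v : Site, f (v, true) + f (v + sh true, false)
      = f (v, false) + f (v + sh false, true) := by
    intro v
    by_cases h : (v, true) ∈ W ∨ (v + sh true, false) ∈ W ∨ (v, false) ∈ W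
        ∨ (v + sh false, true) ∈ W
    · have : ∃ e ∈ W, near e (v, true) ∧ near e (v + sh true, false) ∧ near e (v, false) ∧
          near e (v + sh false, true) := by
        rcases h with h | h | h | h <;> exact ⟨_, h, by simp [near], by simp [near],
          by simp [near], by simp [near]⟩
      obtain ⟨e, he, n1, n2, n3, n4⟩ := this
      rw [hfW e _ he n1, hfW e _ he n2, hfW e _ he n3, hfW e _ he n4]
      simp only
      rw [show v + sh true + sh false = v + sh false + sh true by abel]
      ring
    · push Not at h
      simp only [f, if_neg h.1, if_neg h.2.1, if_neg h.2.2.1, if_neg h.2.2.2]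
  obtain ⟨g, hg0, hg⟩ := poincare f X hfX hp
  have hgc : ∀ u v, adjS u v → (u ∈ γ ↔ v ∈ γ) → g u = g v := by
    have : ∀ u i, (u ∈ γ ↔ u + sh i ∈ γ) → g u = g (u + sh i) := by
      intro u i h
      have h1 : f (u, i) = 0 := by
        by_contra h1
        have := hW ((hf0 _).1 h1)
        rw [mem_bd hE] at this
        exact this h
      have := hg u i
      linarith
    intro u v h h'
    rw [adjS_iff] at h
    obtain ⟨i, rfl | rfl⟩ := h
    · exact this _ _ h'
    · exact (this _ _ h'.symm).symm
  have hout : ∀ u, u ∉ γ → g u = 0 := by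
    intro u hu
    have hXγ : ((X, 0) : Site) ∉ γ := fun h => by simpa using hX _ h
    rw [connectedIn.const hc' g (fun a b hab ha hb => hgc a b hab (by
      simp at ha hb; simp [ha, hb])) (x := u) (y := (X, 0)) (by simpa using hu)
      (by simpa using hXγ)]
    exact hg0 _ le_rfl
  obtain ⟨e0, he0⟩ := hne
  have hin : ∀ u ∈ γ, g u ≠ 0 := by
    have : ∃ u ∈ γ, g u ≠ 0 := by
      have h1 := (hf0 e0).2 he0
      have h2 := hg e0.1 e0.2
      have h3 := (mem_bd hE _).1 (hW he0)
      by_cases h4 : e0.1 ∈ γ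
      · refine ⟨_, h4, fun h5 => h1 ?_⟩
        have h6 : e0.1 + sh e0.2 ∉ γ := by tauto
        rw [h5, hout _ h6] at h2
        simpa using h2.symm
      · have h6 : e0.1 + sh e0.2 ∈ γ := by tauto
        refine ⟨_, h6, fun h5 => h1 ?_⟩
        rw [h5, hout _ h4] at h2
        simpa using h2.symm
    obtain ⟨u, hu, hgu⟩ := this
    intro w hw
    rwa [connectedIn.const hc g (fun a b hab ha hb => hgc a b hab (by
      simp at ha hb; simp [ha, hb])) (x := w) (y := u) (by simpa using hw) (by simpa using hu)]
  refine Finset.Subset.antisymm hW (fun e he => ?_)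
  rw [← hf0]
  have h2 := hg e.1 e.2
  have h3 := (mem_bd hE _).1 he
  change g e.1 - g (e.1 + sh e.2) = f e at h2
  rw [← h2]
  by_cases h4 : e.1 ∈ γ
  · have h6 : e.1 + sh e.2 ∉ γ := by tauto
    rw [hout _ h6]; simpa using hin _ h4
  · have h6 : e.1 + sh e.2 ∈ γ := by tauto
    rw [hout _ h4]; simpa using hin _ h6

lemma bd_inj {E : Finset Edge} {γ γ' : Finset Site} (hE : Good E γ) (hE' : Good E γ')
    (h : bd E γ = bd E γ') : γ = γ' := by
  obtain ⟨X, hX⟩ := exists_right (γ ∪ γ')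
  have main : ∀ n : ℕ, ∀ v : Site, X - v.1 ≤ n → (v ∈ γ ↔ v ∈ γ') := by
    intro n
    induction n with
    | zero =>
      intro v hv
      have : v ∉ γ ∪ γ' := fun h => by have := hX v h; push_cast at hv; omega
      simp at this
      simp [this]
    | succ n ih =>
      intro v hv
      have h1 := ih (v + sh true) (by simp at hv ⊢; omega)
      have h2 : (v, true) ∈ bd E γ ↔ (v, true) ∈ bd E γ' := by rw [h]
      rw [mem_bd hE, mem_bd hE'] at h2
      simp only at h2
      tauto
  ext v
  exact main (X - v.1).toNat v (Int.self_le_toNat _)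

/-- closed neighbourhood of an edge -/
def nb (e : Edge) : Finset Edge :=
  (Finset.Icc (e.1.1 - 1) (e.1.1 + 1) ×ˢ Finset.Icc (e.1.2 - 1) (e.1.2 + 1)) ×ˢ Finset.univ

lemma mem_nb (e e' : Edge) : e' ∈ nb e ↔ near e e' := by
  simp only [nb, Finset.mem_product, Finset.mem_Icc, Finset.mem_univ, and_true, near, abs_le]
  omega

lemma card_nb (e : Edge) : (nb e).card = 18 := by
  simp [nb, Finset.card_product]
  norm_num [show e.1.1 + 1 + 1 - (e.1.1 - 1) = 3 by ring,
    show e.1.2 + 1 + 1 - (e.1.2 - 1) = 3 by ring]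
  rfl

lemma near_symm {e e' : Edge} (h : near e e') : near e' e := by
  simp only [near] at *; rw [abs_sub_comm, abs_sub_comm e'.1.2]; exact h

/-- percolation bound on the number of connected edge sets through `e` -/
lemma perc (E : Finset Edge) (e : Edge) (F : Finset (Finset Edge))
    (hF : ∀ T ∈ F, T ⊆ E ∧ e ∈ T ∧ ConnE T) :
    ∑ T ∈ F, ((1:ℝ) / 2 ^ 18) ^ T.card ≤ 1 := by
  let N : Finset Edge → Finset Edge := fun T => E.filter (fun e' => ∃ a ∈ T, near a e')
  let C : Finset Edge → Finset (Finset Edge) := fun T => E.powerset.filter (fun ω => ω ∩ N T = T)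
  have hTN : ∀ T ∈ F, T ⊆ N T := fun T hT a ha => by
    simp only [N, Finset.mem_filter]
    exact ⟨(hF T hT).1 ha, a, ha, by simp [near]⟩
  have hN : ∀ T ∈ F, (N T).card ≤ 18 * T.card := by
    intro T hT
    have : N T ⊆ T.biUnion nb := by
      intro a ha
      simp only [N, Finset.mem_filter] at ha
      obtain ⟨_, b, hb, hab⟩ := ha
      exact Finset.mem_biUnion.2 ⟨b, hb, (mem_nb _ _).2 hab⟩
    refine (Finset.card_le_card this).trans (Finset.card_biUnion_le.trans ?_)
    simp [card_nb]
    omega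
  have hC : ∀ T ∈ F, 2 ^ (E.card - (N T).card) ≤ (C T).card := by
    intro T hT
    have h1 : (E \ N T).powerset.card = 2 ^ (E.card - (N T).card) := by
      rw [Finset.card_powerset, Finset.card_sdiff_of_subset (Finset.filter_subset _ _)]
    rw [← h1]
    refine Finset.card_le_card_of_injOn (fun ω => ω ∪ T) ?_ ?_
    · intro ω hω
      have hω' : ω ⊆ E \ N T := Finset.mem_powerset.1 (Finset.mem_coe.1 hω)
      simp only [C, Finset.coe_filter, Finset.mem_powerset, Set.mem_ofPred_eq]
      refine ⟨Finset.union_subset (hω'.trans Finset.sdiff_subset) (hF T hT).1, ?_⟩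
      ext a
      simp only [Finset.mem_inter, Finset.mem_union]
      constructor
      · rintro ⟨h | h, h2⟩
        · exact absurd h2 (Finset.mem_sdiff.1 (hω' h)).2
        · exact h
      · intro h; exact ⟨Or.inr h, hTN T hT h⟩
    · intro ω hω ω' hω' h
      have h1 : ω ⊆ E \ N T := Finset.mem_powerset.1 (Finset.mem_coe.1 hω)
      have h2 : ω' ⊆ E \ N T := Finset.mem_powerset.1 (Finset.mem_coe.1 hω')
      have d1 : ∀ a ∈ ω, a ∉ T := fun a ha hT' => (Finset.mem_sdiff.1 (h1 ha)).2 (hTN T hT hT')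
      have d2 : ∀ a ∈ ω', a ∉ T := fun a ha hT' => (Finset.mem_sdiff.1 (h2 ha)).2 (hTN T hT hT')
      ext a
      have h3 : a ∈ ω ∪ T ↔ a ∈ ω' ∪ T := by simp only at h; rw [h]
      simp only [Finset.mem_union] at h3
      have := d1 a
      have := d2 a
      tauto
  have hdisj : (F : Set (Finset Edge)).PairwiseDisjoint C := by
    intro T hT T' hT' hne
    rw [Function.onFun, Finset.disjoint_left]
    intro ω h1 h2
    simp only [C, Finset.mem_filter] at h1 h2
    apply hne
    obtain ⟨_, heT, hcT⟩ := hF T hT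
    obtain ⟨_, heT', hcT'⟩ := hF T' hT'
    have s1 : ∀ a ∈ T, a ∈ ω := fun a ha => (Finset.mem_inter.1 (h1.2.symm ▸ ha)).1
    have s2 : ∀ a ∈ T', a ∈ ω := fun a ha => (Finset.mem_inter.1 (h2.2.symm ▸ ha)).1
    have e1 : T ∩ T' = T := by
      refine hcT _ Finset.inter_subset_left ⟨e, Finset.mem_inter.2 ⟨heT, heT'⟩⟩ ?_
      intro a ha b hb hab
      refine Finset.mem_inter.2 ⟨hb, ?_⟩
      rw [← h2.2]
      refine Finset.mem_inter.2 ⟨s1 b hb, ?_⟩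
      simp only [N, Finset.mem_filter]
      exact ⟨(hF T hT).1 hb, a, (Finset.mem_inter.1 ha).2, hab⟩
    have e2 : T ∩ T' = T' := by
      refine hcT' _ Finset.inter_subset_right ⟨e, Finset.mem_inter.2 ⟨heT, heT'⟩⟩ ?_
      intro a ha b hb hab
      refine Finset.mem_inter.2 ⟨?_, hb⟩
      rw [← h1.2]
      refine Finset.mem_inter.2 ⟨s2 b hb, ?_⟩
      simp only [N, Finset.mem_filter]
      exact ⟨(hF T' hT').1 hb, a, (Finset.mem_inter.1 ha).1, hab⟩
    rw [← e1, e2]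
  have htot : ∑ T ∈ F, (C T).card ≤ 2 ^ E.card := by
    rw [← Finset.card_biUnion (fun a ha b hb hab => hdisj ha hb hab), ← Finset.card_powerset]
    refine Finset.card_le_card (fun ω hω => ?_)
    obtain ⟨T, _, h⟩ := Finset.mem_biUnion.1 hω
    exact (Finset.mem_filter.1 h).1
  have hfin : ∑ T ∈ F, ((1:ℝ) / 2 ^ 18) ^ T.card * 2 ^ E.card ≤ 2 ^ E.card := by
    calc ∑ T ∈ F, ((1:ℝ) / 2 ^ 18) ^ T.card * 2 ^ E.card
        ≤ ∑ T ∈ F, ((C T).card : ℝ) := by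
          refine Finset.sum_le_sum (fun T hT => ?_)
          have h1 : (2:ℝ) ^ (E.card - (N T).card) ≤ ((C T).card : ℝ) := by exact_mod_cast hC T hT
          refine le_trans ?_ h1
          have h2 : (N T).card ≤ E.card := Finset.card_le_card (Finset.filter_subset _ _)
          have h3 := hN T hT
          rw [one_div, inv_pow, ← pow_mul, inv_mul_le_iff₀ (by positivity), ← pow_add]
          exact pow_le_pow_right₀ (by norm_num) (by omega)
      _ ≤ 2 ^ E.card := by exact_mod_cast htot
  rw [← Finset.sum_mul] at hfin
  have : (0:ℝ) < 2 ^ E.card := by positivity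
  exact le_of_mul_le_mul_right (by simpa using hfin) this

end
end SOS


set_option linter.unusedVariables false
set_option linter.unusedSectionVars false
namespace SOS
noncomputable section
open scoped Classical
open Finset

lemma exit_ray (γ : Finset Site) (d : Site) (hd : d ≠ 0) (v : Site) (hv : v ∈ γ) :
    ∃ n : ℕ, (∀ m ≤ n, v + m • d ∈ γ) ∧ v + (n + 1) • d ∉ γ := by
  have hex : ∃ n : ℕ, v + n • d ∉ γ := by
    by_contra h
    push Not at h
    have hinj : Function.Injective (fun n : ℕ => v + n • d) := by
      intro a b hab
      simp only [add_right_inj] at hab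
      obtain ⟨d1, d2⟩ := d
      simp only [Prod.smul_mk, nsmul_eq_mul, Prod.mk.injEq] at hab
      by_contra hne
      apply hd
      have h1 : ((a:ℤ) - b) ≠ 0 := by omega
      have e1 : ((a:ℤ) - b) * d1 = 0 := by rw [sub_mul]; linarith [hab.1]
      have e2 : ((a:ℤ) - b) * d2 = 0 := by rw [sub_mul]; linarith [hab.2]
      simp only [mul_eq_zero, h1, false_or] at e1 e2
      simp [e1, e2]
    exact Set.infinite_of_injective_forall_mem hinj h (γ.finite_toSet)
  have h0 : Nat.find hex ≠ 0 := by
    intro h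
    have := Nat.find_spec hex
    rw [h] at this
    simp at this
    exact this hv
  obtain ⟨n, hn⟩ := Nat.exists_eq_succ_of_ne_zero h0
  refine ⟨n, fun m hm => ?_, ?_⟩
  · have := Nat.find_min hex (m := m) (by omega)
    simpa using this
  · have := Nat.find_spec hex
    rw [hn] at this
    exact this

/-- coordinate transverse to the direction -/
def trv (i : Bool) (v : Site) : ℤ := if i then v.2 else v.1

lemma sh_ne (i : Bool) : sh i ≠ 0 := by cases i <;> simp

lemma trv_add (i : Bool) (v : Site) (n : ℕ) : trv i (v + n • sh i) = trv i v := by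
  cases i <;> simp [trv]

lemma trv_sub (i : Bool) (v : Site) (n : ℕ) : trv i (v + n • (-sh i)) = trv i v := by
  cases i <;> simp [trv]

lemma per_ge {E : Finset Edge} {γ : Finset Site} (hE : Good E γ) :
    2 * ((γ.image (trv true)).card + (γ.image (trv false)).card) ≤ per E γ := by
  have key : ∀ i s : Bool, (γ.image (trv i)).card ≤
      ((bd E γ).filter (fun e => (e.2, decide (e.1 ∈ γ)) = (i, s))).card := by
    intro i s
    refine le_trans (Finset.card_le_card ?_)
      (Finset.card_image_le (s := (bd E γ).filter (fun e => (e.2, decide (e.1 ∈ γ)) = (i, s)))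
        (f := fun e => trv i e.1))
    intro y hy
    obtain ⟨v, hv, rfl⟩ := Finset.mem_image.1 hy
    cases s with
    | true =>
      obtain ⟨n, hn, hn'⟩ := exit_ray γ (sh i) (sh_ne i) v hv
      refine Finset.mem_image.2 ⟨(v + n • sh i, i), ?_, trv_add _ _ _⟩
      have h1 := hn n le_rfl
      rw [Finset.mem_filter, mem_bd hE]
      refine ⟨?_, by simp only [h1]; simp⟩
      rw [add_smul, one_smul, ← add_assoc] at hn'
      simp only [h1, hn']
      simp
    | false =>
      obtain ⟨n, hn, hn'⟩ := exit_ray γ (-sh i) (by simpa using sh_ne i) v hv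
      refine Finset.mem_image.2 ⟨(v + (n+1) • (-sh i), i), ?_, trv_sub _ _ _⟩
      have h1 := hn n le_rfl
      rw [Finset.mem_filter, mem_bd hE]
      refine ⟨?_, by simpa using hn'⟩
      have : v + (n+1) • (-sh i) + sh i = v + n • (-sh i) := by
        rw [add_smul, one_smul]; abel
      simp only [this, hn', h1]
      simp
  have := Finset.card_eq_sum_card_fiberwise (s := bd E γ)
    (f := fun e : Edge => (e.2, decide (e.1 ∈ γ))) (t := Finset.univ) (fun _ _ => by simp)
  rw [per, this, Fintype.sum_prod_type]
  simp only [Fintype.sum_bool]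
  have h1 := key true true
  have h2 := key true false
  have h3 := key false true
  have h4 := key false false
  omega

lemma card_le_prod (γ : Finset Site) :
    γ.card ≤ (γ.image (trv false)).card * (γ.image (trv true)).card := by
  rw [← Finset.card_product]
  refine Finset.card_le_card (fun v hv => ?_)
  rw [Finset.mem_product]
  exact ⟨Finset.mem_image.2 ⟨v, hv, by simp [trv]⟩, Finset.mem_image.2 ⟨v, hv, by simp [trv]⟩⟩

lemma card_le_four_pow {E : Finset Edge} {γ : Finset Site} (hE : Good E γ) :
    γ.card ≤ 4 ^ per E γ := by
  have h1 := per_ge hE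
  have h2 := card_le_prod γ
  have h3 : per E γ < 2 ^ per E γ := Nat.lt_two_pow_self
  calc γ.card ≤ _ := h2
    _ ≤ 2 ^ per E γ * 2 ^ per E γ := Nat.mul_le_mul (by omega) (by omega)
    _ = 4 ^ per E γ := by rw [← mul_pow]; norm_num

lemma per_ge_four {E : Finset Edge} {γ : Finset Site} (hE : Good E γ) (hne : γ.Nonempty) :
    4 ≤ per E γ := by
  have h1 := per_ge hE
  have h2 := (hne.image (trv true)).card_pos
  have h3 := (hne.image (trv false)).card_pos
  omega

lemma per_ge_six {E : Finset Edge} {γ : Finset Site} (hE : Good E γ) (hne : 2 ≤ γ.card) :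
    6 ≤ per E γ := by
  have h1 := per_ge hE
  have h4 := card_le_prod γ
  have hne' : γ.Nonempty := Finset.card_pos.1 (by omega)
  have h2 := (hne'.image (trv true)).card_pos
  have h3 := (hne'.image (trv false)).card_pos
  by_contra h
  have e1 : (γ.image (trv true)).card = 1 := by omega
  have e2 : (γ.image (trv false)).card = 1 := by omega
  rw [e1, e2] at h4
  omega

lemma per_singleton {E : Finset Edge} {v : Site} (hE : Good E {v}) : per E {v} = 4 := by
  refine le_antisymm ?_ (per_ge_four hE (by simp))
  have : bd E {v} ⊆ {(v, true), (v - sh true, true), (v, false), (v - sh false, false)} := by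
    rintro ⟨u, i⟩ he
    rw [mem_bd hE] at he
    simp only [Finset.mem_singleton] at he
    have h2 : ∀ i, u + sh i = v → u = v - sh i := fun i h => by rw [← h]; simp
    simp only [Finset.mem_insert, Finset.mem_singleton, Prod.mk.injEq]
    have := h2 i
    cases i <;> tauto
  exact (Finset.card_le_card this).trans (Finset.card_le_four)

/-- the basic entropy bound -/
lemma entropy {E : Finset Edge} {U : Finset Site} (hE : Good E U) (v : Site) :
    ∑ γ ∈ (Cls U).filter (fun γ => v ∈ γ), ((1:ℝ) / 2 ^ 19) ^ per E γ ≤ 1 := by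
  have hG : ∀ γ ∈ Cls U, Good E γ := fun γ h => hE.mono (mem_Cls.1 h).1
  have hroot : ∀ γ ∈ (Cls U).filter (fun γ => v ∈ γ), ∃ n ∈ Finset.range (E.card),
      (v + n • sh true, true) ∈ bd E γ ∧ n + 1 ≤ per E γ := by
    intro γ hγ
    rw [Finset.mem_filter] at hγ
    obtain ⟨n, hn, hn'⟩ := exit_ray γ (sh true) (sh_ne true) v hγ.2
    have hEγ := hG γ hγ.1
    have h1 : n + 1 ≤ per E γ := by
      refine le_trans ?_ ((by omega : (γ.image (trv false)).card ≤ _).trans (per_ge hEγ))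
      rw [← Finset.card_range (n+1)]
      refine Finset.card_le_card_of_injOn (fun m => v.1 + m) ?_ (fun a _ b _ h => by simpa using h)
      intro m hm
      have hm' := Finset.mem_range.1 (Finset.mem_coe.1 hm)
      refine Finset.mem_coe.2 (Finset.mem_image.2 ⟨_, hn m (by omega), by simp [trv]⟩)
    have h2 : per E γ ≤ E.card := Finset.card_le_card (Finset.filter_subset _ _)
    refine ⟨n, Finset.mem_range.2 (by omega), ?_, h1⟩
    rw [mem_bd hEγ]
    have := hn n le_rfl
    rw [add_smul, one_smul, ← add_assoc] at hn'
    simp only [this, hn']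
    simp
  have hstep : ∀ n : ℕ, ∑ γ ∈ (Cls U).filter (fun γ => (v + n • sh true, true) ∈ bd E γ),
      ((1:ℝ) / 2 ^ 18) ^ per E γ ≤ 1 := by
    intro n
    have hinj : Set.InjOn (bd E)
        ((Cls U).filter (fun γ => (v + n • sh true, true) ∈ bd E γ) : Finset (Finset Site)) := by
      intro a ha b hb hab
      exact bd_inj (hG a (Finset.mem_filter.1 (Finset.mem_coe.1 ha)).1)
        (hG b (Finset.mem_filter.1 (Finset.mem_coe.1 hb)).1) hab
    have h1 := perc E (v + n • sh true, true)
      (((Cls U).filter (fun γ => (v + n • sh true, true) ∈ bd E γ)).image (bd E)) (by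
        intro T hT
        obtain ⟨γ, hγ, rfl⟩ := Finset.mem_image.1 hT
        rw [Finset.mem_filter] at hγ
        have := mem_Cls.1 hγ.1
        exact ⟨Finset.filter_subset _ _, hγ.2, bd_conn (hG γ hγ.1) this.2.2.1 this.2.2.2⟩)
    rw [Finset.sum_image hinj] at h1
    exact h1
  calc ∑ γ ∈ (Cls U).filter (fun γ => v ∈ γ), ((1:ℝ) / 2 ^ 19) ^ per E γ
      ≤ ∑ γ ∈ (Cls U).filter (fun γ => v ∈ γ), ∑ n ∈ Finset.range E.card,
        (if (v + n • sh true, true) ∈ bd E γ then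
          ((1:ℝ) / 2 ^ (n+1)) * ((1:ℝ) / 2 ^ 18) ^ per E γ else 0) := by
        refine Finset.sum_le_sum (fun γ hγ => ?_)
        obtain ⟨n, hn, h1, h2⟩ := hroot γ hγ
        refine le_trans ?_ (Finset.single_le_sum (f := fun n => (if (v + n • sh true, true) ∈ bd E γ then
          ((1:ℝ) / 2 ^ (n+1)) * ((1:ℝ) / 2 ^ 18) ^ per E γ else 0)) (fun m _ => by
            split_ifs <;> positivity) hn)
        simp only [if_pos h1]
        have : ((1:ℝ) / 2 ^ 19) ^ per E γ = (1/2) ^ per E γ * ((1:ℝ) / 2 ^ 18) ^ per E γ := by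
          rw [← mul_pow]; norm_num
        rw [this]
        gcongr
        rw [show (1:ℝ)/2^(n+1) = (1/2)^(n+1) by rw [one_div_pow]]
        exact pow_le_pow_of_le_one (by norm_num) (by norm_num) h2
    _ = ∑ n ∈ Finset.range E.card, ∑ γ ∈ (Cls U).filter (fun γ => v ∈ γ),
        (if (v + n • sh true, true) ∈ bd E γ then
          ((1:ℝ) / 2 ^ (n+1)) * ((1:ℝ) / 2 ^ 18) ^ per E γ else 0) := Finset.sum_comm
    _ ≤ ∑ n ∈ Finset.range E.card, (1:ℝ)/2^(n+1) := by
        refine Finset.sum_le_sum (fun n _ => ?_)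
        rw [← Finset.sum_filter, ← Finset.mul_sum]
        refine mul_le_of_le_one_right (by positivity) (le_trans ?_ (hstep n))
        refine Finset.sum_le_sum_of_subset_of_nonneg ?_ (fun _ _ _ => by positivity)
        intro γ hγ
        simp only [Finset.mem_filter] at hγ ⊢
        exact ⟨hγ.1.1, hγ.2⟩
    _ ≤ 1 := by
        have : ∀ N : ℕ, ∑ n ∈ Finset.range N, (1:ℝ)/2^(n+1) = 1 - 1/2^N := by
          intro N
          induction N with
          | zero => simp
          | succ N ih => rw [Finset.sum_range_succ, ih, pow_succ]; field_simp; ring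
        rw [this]
        have : (0:ℝ) < 1/2^E.card := by positivity
        linarith

/-- weighted sums over contours through a site, `x ^ per` with weight at most `4^per` and
perimeter at least `p` -/
lemma entropy_pow {E : Finset Edge} {U : Finset Site} (hE : Good E U) (v : Site) (x : ℝ)
    (hx0 : 0 ≤ x) (hx : 2 ^ 21 * x ≤ 1) (p : ℕ) (S : Finset (Finset Site))
    (hS : S ⊆ (Cls U).filter (fun γ => v ∈ γ)) (hp : ∀ γ ∈ S, p ≤ per E γ) :
    ∑ γ ∈ S, (γ.card : ℝ) * x ^ per E γ ≤ (2 ^ 21 * x) ^ p := by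
  have hG : ∀ γ ∈ S, Good E γ := fun γ h => hE.mono (mem_Cls.1 (Finset.mem_filter.1 (hS h)).1).1
  calc ∑ γ ∈ S, (γ.card : ℝ) * x ^ per E γ
      ≤ ∑ γ ∈ S, (2 ^ 21 * x) ^ p * ((1:ℝ) / 2 ^ 19) ^ per E γ := by
        refine Finset.sum_le_sum (fun γ hγ => ?_)
        have h1 : (γ.card : ℝ) ≤ 4 ^ per E γ := by exact_mod_cast card_le_four_pow (hG γ hγ)
        have h2 : (2 ^ 21 * x) ^ per E γ ≤ (2 ^ 21 * x) ^ p :=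
          pow_le_pow_of_le_one (by positivity) hx (hp γ hγ)
        calc (γ.card : ℝ) * x ^ per E γ ≤ 4 ^ per E γ * x ^ per E γ := by gcongr
          _ = (2 ^ 21 * x) ^ per E γ * ((1:ℝ) / 2 ^ 19) ^ per E γ := by
            rw [← mul_pow, ← mul_pow]; congr 1; ring
          _ ≤ _ := by gcongr
    _ = (2 ^ 21 * x) ^ p * ∑ γ ∈ S, ((1:ℝ) / 2 ^ 19) ^ per E γ := by rw [Finset.mul_sum]
    _ ≤ (2 ^ 21 * x) ^ p * 1 := by
        gcongr
        exact (Finset.sum_le_sum_of_subset_of_nonneg hS (fun _ _ _ => by positivity)).trans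
          (entropy hE v)
    _ = _ := mul_one _

/-! ### Families of disjoint contours -/

/-- families of pairwise disjoint contours in `B` -/
def Fam (B : Finset Site) : Finset (Finset (Finset Site)) :=
  (Cls B).powerset.filter (fun M => ∀ γ ∈ M, ∀ γ' ∈ M, γ ≠ γ' → Disjoint γ γ')

lemma mem_Fam {B : Finset Site} {M : Finset (Finset Site)} :
    M ∈ Fam B ↔ M ⊆ Cls B ∧ ∀ γ ∈ M, ∀ γ' ∈ M, γ ≠ γ' → Disjoint γ γ' := by
  simp [Fam]

/-- union of a family -/
def Un (M : Finset (Finset Site)) : Finset Site := M.biUnion id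

lemma mem_Un {M : Finset (Finset Site)} {v : Site} : v ∈ Un M ↔ ∃ γ ∈ M, v ∈ γ := by
  simp [Un]

open scoped ENNReal in
lemma family (w : Finset Site → ℝ≥0∞) (c : ℝ≥0∞) (B₀ : Finset Site)
    (hw : ∀ v ∈ B₀, c + ∑ γ ∈ (Cls B₀).filter (fun γ => v ∈ γ), w γ ≤ 1) :
    ∀ n : ℕ, ∀ B : Finset Site, B.card = n → B ⊆ B₀ →
      ∑ M ∈ Fam B, (∏ γ ∈ M, w γ) * c ^ (B \ Un M).card ≤ 1 := by
  intro n
  induction n using Nat.strong_induction_on with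
  | _ n ih =>
  intro B hn hB
  rcases B.eq_empty_or_nonempty with rfl | ⟨v, hv⟩
  · have : Fam ∅ = {∅} := by
      ext M
      rw [mem_Fam, Finset.mem_singleton]
      constructor
      · rintro ⟨h, _⟩
        refine Finset.eq_empty_of_forall_notMem (fun γ hγ => ?_)
        have := mem_Cls.1 (h hγ)
        exact (this.2.1.ne_empty) (Finset.subset_empty.1 this.1)
      · rintro rfl; simp
    rw [this]; simp [Un]
  have hClsmono : ∀ {A B : Finset Site}, A ⊆ B → Cls A ⊆ Cls B := fun h γ hγ => by
    rw [mem_Cls] at *; exact ⟨hγ.1.trans h, hγ.2⟩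
  -- split according to whether v is covered
  rw [← Finset.sum_filter_add_sum_filter_not (Fam B) (fun M => v ∉ Un M)]
  have h1 : ∑ M ∈ (Fam B).filter (fun M => v ∉ Un M), (∏ γ ∈ M, w γ) * c ^ (B \ Un M).card ≤ c := by
    have hih := ih (B.erase v).card (by rw [Finset.card_erase_of_mem hv]; have := Finset.card_pos.2 ⟨v, hv⟩; omega) (B.erase v) rfl
      ((Finset.erase_subset _ _).trans hB)
    calc _ ≤ ∑ M ∈ Fam (B.erase v), c * ((∏ γ ∈ M, w γ) * c ^ (B.erase v \ Un M).card) := by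
            refine (Finset.sum_le_sum (fun M hM => ?_)).trans (Finset.sum_le_sum_of_subset (s := (Fam B).filter (fun M => v ∉ Un M)) ?_)
            · rw [Finset.mem_filter] at hM
              have : (B \ Un M).card = (B.erase v \ Un M).card + 1 := by
                rw [Finset.erase_sdiff_comm, Finset.card_erase_of_mem
                  (Finset.mem_sdiff.2 ⟨hv, hM.2⟩)]
                have := Finset.card_pos.2 ⟨v, Finset.mem_sdiff.2 ⟨hv, hM.2⟩⟩
                omega
              rw [this, pow_succ]
              apply le_of_eq; ring
            · intro M hM
              rw [Finset.mem_filter, mem_Fam] at hM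
              rw [mem_Fam]
              refine ⟨fun γ hγ => ?_, hM.1.2⟩
              have := mem_Cls.1 (hM.1.1 hγ)
              rw [mem_Cls]
              refine ⟨fun u hu => Finset.mem_erase.2 ⟨?_, this.1 hu⟩, this.2⟩
              rintro rfl
              exact hM.2 (mem_Un.2 ⟨γ, hγ, hu⟩)
      _ = c * ∑ M ∈ Fam (B.erase v), ((∏ γ ∈ M, w γ) * c ^ (B.erase v \ Un M).card) := by
            rw [Finset.mul_sum]
      _ ≤ c * 1 := by gcongr
      _ = c := mul_one _
  have h2 : ∑ M ∈ (Fam B).filter (fun M => ¬ v ∉ Un M), (∏ γ ∈ M, w γ) * c ^ (B \ Un M).card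
      ≤ ∑ γ ∈ (Cls B₀).filter (fun γ => v ∈ γ), w γ := by
    calc _ ≤ ∑ M ∈ (Fam B).filter (fun M => ¬ v ∉ Un M), ∑ γ ∈ (Cls B).filter (fun γ => v ∈ γ),
              (if γ ∈ M then (∏ γ ∈ M, w γ) * c ^ (B \ Un M).card else 0) := by
            refine Finset.sum_le_sum (fun M hM => ?_)
            rw [Finset.mem_filter, not_not, mem_Un, mem_Fam] at hM
            obtain ⟨hM1, γ, hγ, hvγ⟩ := hM
            refine le_trans ?_ (Finset.single_le_sum (f := fun γ => (if γ ∈ M then (∏ γ ∈ M, w γ) * c ^ (B \ Un M).card else 0)) (fun _ _ => zero_le) (Finset.mem_filter.2 ⟨hM1.1 hγ, hvγ⟩))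
            simp [hγ]
      _ = ∑ γ ∈ (Cls B).filter (fun γ => v ∈ γ), ∑ M ∈ (Fam B).filter (fun M => ¬ v ∉ Un M),
              (if γ ∈ M then (∏ γ ∈ M, w γ) * c ^ (B \ Un M).card else 0) := Finset.sum_comm
      _ ≤ ∑ γ ∈ (Cls B).filter (fun γ => v ∈ γ), w γ := by
            refine Finset.sum_le_sum (fun γ hγ => ?_)
            rw [Finset.mem_filter] at hγ
            have hγ1 := mem_Cls.1 hγ.1
            have hih := ih (B \ γ).card (by
              rw [← hn]
              refine Finset.card_lt_card (Finset.ssubset_iff_subset_ne.2 ⟨Finset.sdiff_subset, fun h => ?_⟩)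
              rw [← h] at hv
              exact (Finset.mem_sdiff.1 hv).2 hγ.2) (B \ γ) rfl (Finset.sdiff_subset.trans hB)
            rw [← Finset.sum_filter]
            have hmap : ∀ M ∈ ((Fam B).filter (fun M => ¬ v ∉ Un M)).filter (fun M => γ ∈ M),
                M.erase γ ∈ Fam (B \ γ) := by
              intro M hM
              rw [Finset.mem_filter, Finset.mem_filter, mem_Fam] at hM
              rw [mem_Fam]
              refine ⟨fun γ' hγ' => ?_, fun a ha b hb => hM.1.1.2 a (Finset.mem_of_mem_erase ha) b
                (Finset.mem_of_mem_erase hb)⟩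
              have h3 := Finset.mem_erase.1 hγ'
              have h4 := mem_Cls.1 (hM.1.1.1 h3.2)
              rw [mem_Cls]
              refine ⟨fun u hu => Finset.mem_sdiff.2 ⟨h4.1 hu, fun hu' => ?_⟩, h4.2⟩
              exact Finset.disjoint_left.1 (hM.1.1.2 γ' h3.2 γ hM.2 h3.1) hu hu'
            calc _ = ∑ M ∈ ((Fam B).filter (fun M => ¬ v ∉ Un M)).filter (fun M => γ ∈ M),
                    w γ * ((∏ γ' ∈ M.erase γ, w γ') * c ^ ((B \ γ) \ Un (M.erase γ)).card) := by
                  refine Finset.sum_congr rfl (fun M hM => ?_)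
                  have hγM := (Finset.mem_filter.1 hM).2
                  rw [← Finset.mul_prod_erase M w hγM]
                  have : B \ Un M = (B \ γ) \ Un (M.erase γ) := by
                    ext u
                    simp only [Finset.mem_sdiff, mem_Un, Finset.mem_erase]
                    constructor
                    · rintro ⟨a, b⟩
                      exact ⟨⟨a, fun h => b ⟨γ, hγM, h⟩⟩, fun ⟨γ', h, h'⟩ => b ⟨γ', h.2, h'⟩⟩
                    · rintro ⟨⟨a, b⟩, d⟩
                      refine ⟨a, fun ⟨γ', h, h'⟩ => ?_⟩
                      by_cases e : γ' = γ
                      · exact b (e ▸ h')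
                      · exact d ⟨γ', ⟨e, h⟩, h'⟩
                  rw [this, mul_assoc]
              _ = w γ * ∑ M ∈ ((Fam B).filter (fun M => ¬ v ∉ Un M)).filter (fun M => γ ∈ M),
                    ((∏ γ' ∈ M.erase γ, w γ') * c ^ ((B \ γ) \ Un (M.erase γ)).card) := by
                  rw [Finset.mul_sum]
              _ = w γ * ∑ M' ∈ (((Fam B).filter (fun M => ¬ v ∉ Un M)).filter (fun M => γ ∈ M)).image (fun M => M.erase γ),
                    ((∏ γ' ∈ M', w γ') * c ^ ((B \ γ) \ Un M').card) := by
                  rw [Finset.sum_image]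
                  intro a ha b hb hab
                  have ha' := (Finset.mem_filter.1 (Finset.mem_coe.1 ha)).2
                  have hb' := (Finset.mem_filter.1 (Finset.mem_coe.1 hb)).2
                  rw [← Finset.insert_erase ha', ← Finset.insert_erase hb']
                  simp only at hab
                  rw [hab]
              _ ≤ w γ * 1 := by
                  gcongr
                  refine le_trans (Finset.sum_le_sum_of_subset ?_) hih
                  intro M' hM'
                  obtain ⟨M, hM, rfl⟩ := Finset.mem_image.1 hM'
                  exact hmap M hM
              _ = w γ := mul_one _
      _ ≤ _ := Finset.sum_le_sum_of_subset (Finset.filter_subset_filter _ (hClsmono hB))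
  exact (add_le_add h1 h2).trans (hw v (hB hv))

end
end SOS


set_option linter.unusedVariables false
set_option linter.unusedSectionVars false
namespace SOS
noncomputable section
open scoped Classical ENNReal
open Finset

/-! ### Configurations, summation operator, weights -/

/-- height configurations -/
abbrev Conf := Site → ℤ

/-- sum over configurations agreeing with `ξ` off `U` -/
def Iop (U : Finset Site) (ξ : Conf) (G : Conf → ℝ≥0∞) : ℝ≥0∞ :=
  ∑' φ : Conf, if (∀ v, v ∉ U → φ v = ξ v) then G φ else 0

/-- gluing -/
def glue (γ : Finset Site) (φ ξ : Conf) : Conf := fun v => if v ∈ γ then φ v else ξ v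

/-- constant configuration -/
def cst (a : ℤ) : Conf := fun _ => a

lemma glue_in {γ : Finset Site} {φ ξ : Conf} {v : Site} (h : v ∈ γ) : glue γ φ ξ v = φ v := by
  simp [glue, h]

lemma glue_out {γ : Finset Site} {φ ξ : Conf} {v : Site} (h : v ∉ γ) : glue γ φ ξ v = ξ v := by
  simp [glue, h]

/-- energy -/
def HE (E : Finset Edge) (φ : Conf) : ℤ := ∑ e ∈ E, |φ e.1 - φ (e.1 + sh e.2)|

/-- weight -/
def wt (E : Finset Edge) (β lam : ℝ) (U : Finset Site) (φ : Conf) : ℝ≥0∞ :=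
  ENNReal.ofReal (Real.exp (-(β * (HE E φ : ℝ) + lam * sosField U φ)))

/-- exponentials in `ℝ≥0∞` -/
def ex (x : ℝ) : ℝ≥0∞ := ENNReal.ofReal (Real.exp x)

lemma ex_add (x y : ℝ) : ex (x + y) = ex x * ex y := by
  rw [ex, Real.exp_add, ENNReal.ofReal_mul (Real.exp_nonneg _)]; rfl

lemma ex_zero : ex 0 = 1 := by simp [ex]

lemma ex_mono {x y : ℝ} (h : x ≤ y) : ex x ≤ ex y :=
  ENNReal.ofReal_le_ofReal (Real.exp_le_exp.2 h)

lemma ex_le_one {x : ℝ} (h : x ≤ 0) : ex x ≤ 1 := ex_zero ▸ ex_mono h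

lemma ex_ne_top (x : ℝ) : ex x ≠ ⊤ := ENNReal.ofReal_ne_top

lemma ex_ne_zero (x : ℝ) : ex x ≠ 0 := by
  simp [ex, Real.exp_pos]

lemma ex_nat_mul (n : ℕ) (x : ℝ) : ex (n * x) = ex x ^ n := by
  rw [ex, Real.exp_nat_mul, ENNReal.ofReal_pow (Real.exp_nonneg _)]; rfl

/-- indicator -/
def ind (p : Prop) : ℝ≥0∞ := if p then 1 else 0

lemma ind_pos {p : Prop} (h : p) : ind p = 1 := if_pos h
lemma ind_neg {p : Prop} (h : ¬ p) : ind p = 0 := if_neg h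
lemma ind_ne_zero {p : Prop} : ind p ≠ 0 ↔ p := by by_cases h : p <;> simp [ind, h]
lemma ind_le_one (p : Prop) : ind p ≤ 1 := by by_cases h : p <;> simp [ind, h]
lemma ind_mono {p q : Prop} (h : p → q) : ind p ≤ ind q := by
  by_cases hp : p
  · rw [ind_pos hp, ind_pos (h hp)]
  · rw [ind_neg hp]; exact zero_le
lemma ind_and (p q : Prop) : ind (p ∧ q) = ind p * ind q := by
  by_cases hp : p <;> by_cases hq : q <;> simp [ind, hp, hq]

/-- restricted partition function -/
def Zr (E : Finset Edge) (β lam : ℝ) (U : Finset Site) (k : ℤ) (s : Conf → ℝ≥0∞) : ℝ≥0∞ :=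
  Iop U (cst k) (fun φ => s φ * wt E β lam U φ)

lemma Iop_mono {U : Finset Site} {ξ : Conf} {G H : Conf → ℝ≥0∞}
    (h : ∀ φ, (∀ v, v ∉ U → φ v = ξ v) → G φ ≤ H φ) : Iop U ξ G ≤ Iop U ξ H := by
  refine ENNReal.tsum_le_tsum (fun φ => ?_)
  split_ifs with h1
  · exact h φ h1
  · exact le_rfl

lemma Iop_congr {U : Finset Site} {ξ : Conf} {G H : Conf → ℝ≥0∞}
    (h : ∀ φ, (∀ v, v ∉ U → φ v = ξ v) → G φ = H φ) : Iop U ξ G = Iop U ξ H :=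
  le_antisymm (Iop_mono fun φ hφ => (h φ hφ).le) (Iop_mono fun φ hφ => (h φ hφ).ge)

lemma Iop_mul {U : Finset Site} {ξ : Conf} (c : ℝ≥0∞) (G : Conf → ℝ≥0∞) :
    Iop U ξ (fun φ => c * G φ) = c * Iop U ξ G := by
  rw [Iop, Iop, ← ENNReal.tsum_mul_left]
  refine tsum_congr (fun φ => ?_)
  split_ifs <;> simp

lemma Iop_sum {ι : Type*} {U : Finset Site} {ξ : Conf} (s : Finset ι) (G : ι → Conf → ℝ≥0∞) :
    Iop U ξ (fun φ => ∑ i ∈ s, G i φ) = ∑ i ∈ s, Iop U ξ (G i) := by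
  unfold Iop
  rw [← Summable.tsum_finsetSum (fun _ _ => ENNReal.summable)]
  refine tsum_congr (fun φ => ?_)
  split_ifs <;> simp

lemma Iop_shift {U : Finset Site} {ξ ξ' c : Conf} (G : Conf → ℝ≥0∞)
    (h : ∀ v, v ∉ U → ξ v = ξ' v + c v) :
    Iop U ξ G = Iop U ξ' (fun φ => G (φ + c)) := by
  unfold Iop
  rw [← (Equiv.addRight c).tsum_eq]
  refine tsum_congr (fun φ => ?_)
  have : (∀ v, v ∉ U → (φ + c) v = ξ v) ↔ (∀ v, v ∉ U → φ v = ξ' v) := by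
    refine forall_congr' (fun v => forall_congr' (fun hv => ?_))
    rw [h v hv, Pi.add_apply]; omega
  simp only [Equiv.coe_addRight, this]

lemma Iop_glue (γ : Finset Site) (ξ ξ' : Conf) (G : Conf → ℝ≥0∞) :
    Iop γ ξ G = Iop γ ξ' (fun φ => G (glue γ φ ξ)) := by
  rw [Iop_shift (ξ' := ξ') (c := fun v => if v ∈ γ then 0 else ξ v - ξ' v) G
    (fun v hv => by simp [hv])]
  refine Iop_congr (fun φ hφ => ?_)
  congr 1
  funext v
  by_cases hv : v ∈ γ
  · simp [glue, hv]
  · simp [glue, hv, hφ v hv]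

lemma Iop_dlr {γ U : Finset Site} (hγ : γ ⊆ U) (ξ : Conf) (G : Conf → ℝ≥0∞) :
    Iop U ξ G = Iop (U \ γ) ξ (fun ξ' => Iop γ ξ' G) := by
  unfold Iop
  have h1 : ∀ ξ' : Conf, (if (∀ v, v ∉ U \ γ → ξ' v = ξ v) then
      ∑' φ : Conf, (if (∀ v, v ∉ γ → φ v = ξ' v) then G φ else 0) else 0) =
      ∑' φ : Conf, (if (∀ v, v ∉ U \ γ → ξ' v = ξ v) ∧ (∀ v, v ∉ γ → φ v = ξ' v)
        then G φ else 0) := by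
    intro ξ'
    split_ifs with h
    · exact tsum_congr (fun φ => by
        by_cases h2 : ∀ v, v ∉ γ → φ v = ξ' v
        · rw [if_pos h2, if_pos ⟨h, h2⟩]
        · rw [if_neg h2, if_neg (fun h3 => h2 h3.2)])
    · have : ∀ φ : Conf, (if (∀ v, v ∉ U \ γ → ξ' v = ξ v) ∧ (∀ v, v ∉ γ → φ v = ξ' v)
        then G φ else 0) = 0 := fun φ => if_neg (fun h3 => h h3.1)
      simp only [this, tsum_zero]
  simp_rw [h1]
  rw [ENNReal.tsum_comm]
  refine tsum_congr (fun φ => ?_)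
  rw [tsum_eq_single (glue γ ξ φ)]
  · have : (∀ v, v ∉ U → φ v = ξ v) ↔ ((∀ v, v ∉ U \ γ → glue γ ξ φ v = ξ v) ∧
        ∀ v, v ∉ γ → φ v = glue γ ξ φ v) := by
      constructor
      · intro h
        refine ⟨fun v hv => ?_, fun v hv => (glue_out hv).symm⟩
        by_cases hvγ : v ∈ γ
        · exact glue_in hvγ
        · rw [glue_out hvγ]
          exact h v (fun hU => hv (Finset.mem_sdiff.2 ⟨hU, hvγ⟩))
      · rintro ⟨h, -⟩ v hv
        have := h v (fun h' => hv (Finset.mem_sdiff.1 h').1)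
        rwa [glue_out (fun h' => hv (hγ h'))] at this
    simp only [this]
  · intro ξ' hne
    rw [if_neg]
    rintro ⟨h2, h3⟩
    apply hne
    funext v
    by_cases hvγ : v ∈ γ
    · rw [glue_in hvγ]; exact h2 v (fun h => (Finset.mem_sdiff.1 h).2 hvγ)
    · rw [glue_out hvγ]; exact (h3 v hvγ).symm

lemma Zr_mono {E : Finset Edge} {β lam : ℝ} {U : Finset Site} {k : ℤ} {s t : Conf → ℝ≥0∞}
    (h : ∀ φ, (∀ v, v ∉ U → φ v = k) → s φ ≤ t φ) :
    Zr E β lam U k s ≤ Zr E β lam U k t :=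
  Iop_mono (fun φ hφ => by gcongr; exact h φ hφ)

lemma Zr_sum {ι : Type*} {E : Finset Edge} {β lam : ℝ} {U : Finset Site} {k : ℤ} (S : Finset ι)
    (s : ι → Conf → ℝ≥0∞) :
    Zr E β lam U k (fun φ => ∑ i ∈ S, s i φ) = ∑ i ∈ S, Zr E β lam U k (s i) := by
  unfold Zr
  rw [← Iop_sum]
  simp only [Finset.sum_mul]

lemma Zr_mul {E : Finset Edge} {β lam : ℝ} {U : Finset Site} {k : ℤ} (c : ℝ≥0∞)
    (s : Conf → ℝ≥0∞) :
    Zr E β lam U k (fun φ => c * s φ) = c * Zr E β lam U k s := by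
  unfold Zr
  rw [← Iop_mul]
  simp only [mul_assoc]

lemma wt_le {E : Finset Edge} {β lam : ℝ} {U : Finset Site} {φ ψ : Conf} (r : ℝ)
    (h : -(β * (HE E φ : ℝ) + lam * sosField U φ) ≤ r + -(β * (HE E ψ : ℝ) + lam * sosField U ψ)) :
    wt E β lam U φ ≤ ex r * wt E β lam U ψ := by
  have : ex r * wt E β lam U ψ = ex (r + -(β * (HE E ψ : ℝ) + lam * sosField U ψ)) := by
    rw [ex_add]; rfl
  rw [this]
  exact ex_mono h

/-- shifting by a fixed function, with a weight comparison -/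
lemma Zr_shift {E : Finset Edge} {β lam : ℝ} {U : Finset Site} {k k' : ℤ} (c : Conf) (q : ℝ≥0∞)
    (s t : Conf → ℝ≥0∞) (hc : ∀ v, v ∉ U → k + c v = k')
    (h : ∀ φ, (∀ v, v ∉ U → φ v = k) → s φ ≠ 0 →
      s φ ≤ t (φ + c) ∧ wt E β lam U φ ≤ q * wt E β lam U (φ + c)) :
    Zr E β lam U k s ≤ q * Zr E β lam U k' t := by
  unfold Zr
  rw [Iop_shift (ξ := cst k') (ξ' := cst k) (c := c) _ (fun v hv => (hc v hv).symm), ← Iop_mul]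
  refine Iop_mono (fun φ hφ => ?_)
  by_cases h0 : s φ = 0
  · simp [h0]
  · obtain ⟨h1, h2⟩ := h φ hφ h0
    calc s φ * wt E β lam U φ ≤ t (φ + c) * (q * wt E β lam U (φ + c)) := by gcongr
      _ = _ := by ring

/-! ### Energy identities and the replacement lemma -/

lemma HE_split {E : Finset Edge} {γ : Finset Site} {φ : Conf} {a : ℤ}
    (h : ∀ u ∈ γ, ∀ w, w ∉ γ → adjS u w → |φ u - φ w| = |φ u - a| + |a - φ w|) :
    HE E φ = HE E (glue γ φ (cst a)) + HE E (glue γ (cst a) φ) := by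
  unfold HE
  rw [← Finset.sum_add_distrib]
  refine Finset.sum_congr rfl (fun e _ => ?_)
  have hadj := adjS_sh e.1 e.2
  by_cases h1 : e.1 ∈ γ <;> by_cases h2 : e.1 + sh e.2 ∈ γ
  · simp [glue, h1, h2, cst]
  · simp only [glue, h1, h2, if_true, if_false, cst]; exact h _ h1 _ h2 hadj
  · simp only [glue, h1, h2, if_true, if_false, cst]
    rw [abs_sub_comm, h _ h2 _ h1 (adjS_symm hadj), abs_sub_comm a, abs_sub_comm a]
  · simp [glue, h1, h2, cst]

lemma HE_level {E : Finset Edge} {γ : Finset Site} {φ : Conf} {a b : ℤ}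
    (h : ∀ u ∈ γ, ∀ w, w ∉ γ → adjS u w → |φ w - a| = |φ w - b| + |b - a|) :
    HE E (glue γ (cst a) φ) = HE E (glue γ (cst b) φ) + |b - a| * per E γ := by
  have : (per E γ : ℤ) = ∑ e ∈ E, if ¬ (e.1 ∈ γ ↔ e.1 + sh e.2 ∈ γ) then (1:ℤ) else 0 := by
    rw [per, bd, Finset.card_filter]; push_cast; rfl
  unfold HE
  rw [this, Finset.mul_sum, ← Finset.sum_add_distrib]
  refine Finset.sum_congr rfl (fun e _ => ?_)
  have hadj := adjS_sh e.1 e.2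
  by_cases h1 : e.1 ∈ γ <;> by_cases h2 : e.1 + sh e.2 ∈ γ
  · simp [glue, h1, h2, cst]
  · simp only [glue, h1, h2, if_true, if_false, cst]
    rw [abs_sub_comm, h _ h1 _ h2 hadj, abs_sub_comm b (φ _)]; simp
  · simp only [glue, h1, h2, if_true, if_false, cst]
    rw [h _ h2 _ h1 (adjS_symm hadj)]; simp
  · simp [glue, h1, h2]

lemma sosField_split {γ U : Finset Site} (hγ : γ ⊆ U) (φ : Conf) :
    sosField U φ = sosField γ φ + sosField (U \ γ) φ := by
  unfold sosField
  rw [add_comm, Finset.sum_sdiff hγ]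

lemma sosField_congr {U : Finset Site} {φ ψ : Conf} (h : ∀ v ∈ U, φ v = ψ v) :
    sosField U φ = sosField U ψ := Finset.sum_congr rfl (fun v hv => by rw [h v hv])

lemma repl (E : Finset Edge) (β lam : ℝ) {γ U : Finset Site} (hγ : γ ⊆ U) (k a b : ℤ)
    (s t e sin tin : Conf → ℝ≥0∞) (q : ℝ≥0∞)
    (he : ∀ φ ψ : Conf, (∀ v, v ∉ γ → φ v = ψ v) → e φ = e ψ)
    (he' : ∀ φ : Conf, e φ ≠ 0 →
      ∀ u ∈ γ, ∀ w, w ∉ γ → adjS u w → |φ w - a| = |φ w - b| + |b - a|)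
    (hs : ∀ φ : Conf, (∀ v, v ∉ U → φ v = k) → s φ ≤ e φ * sin (glue γ φ (cst a)))
    (hs' : ∀ φ : Conf, e φ ≠ 0 → sin (glue γ φ (cst a)) ≠ 0 →
      ∀ u ∈ γ, ∀ w, w ∉ γ → adjS u w → |φ u - φ w| = |φ u - a| + |a - φ w|)
    (ht : ∀ φ : Conf, (∀ v, v ∉ U → φ v = k) → e φ * tin (glue γ φ (cst b)) ≤ t φ)
    (ht' : ∀ φ : Conf, e φ ≠ 0 → tin (glue γ φ (cst b)) ≠ 0 →
      ∀ u ∈ γ, ∀ w, w ∉ γ → adjS u w → |φ u - φ w| = |φ u - b| + |b - φ w|)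
    (hq : Zr E β lam γ a sin ≤ q * Zr E β lam γ b tin) :
    Zr E β lam U k s ≤ q * ex (-β * |((b - a : ℤ) : ℝ)| * per E γ) * Zr E β lam U k t := by
  conv_lhs => unfold Zr
  conv_rhs => rw [Zr]
  rw [Iop_dlr hγ, Iop_dlr hγ, ← Iop_mul]
  refine Iop_mono (fun ξ hξ => ?_)
  -- exterior factors
  let C : ℤ → ℝ≥0∞ := fun m =>
    ex (-(β * (HE E (glue γ (cst m) ξ) : ℝ) + lam * sosField (U \ γ) ξ))
  have hsplit : ∀ (m : ℤ) (φ : Conf), (∀ v, v ∉ γ → φ v = m) →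
      (∀ u ∈ γ, ∀ w, w ∉ γ → adjS u w → |φ u - ξ w| = |φ u - m| + |m - ξ w|) →
      wt E β lam U (glue γ φ ξ) = C m * wt E β lam γ φ := by
    intro m φ hφ h
    have h1 : HE E (glue γ φ ξ) = HE E φ + HE E (glue γ (cst m) ξ) := by
      rw [HE_split (γ := γ) (a := m)]
      · congr 2
        · funext v
          by_cases hv : v ∈ γ
          · rw [glue_in hv, glue_in hv]
          · rw [glue_out hv, hφ v hv]; rfl
        · funext v
          by_cases hv : v ∈ γ
          · rw [glue_in hv, glue_in hv]
          · rw [glue_out hv, glue_out hv, glue_out hv]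
      · intro u hu w hw huw
        rw [glue_in hu, glue_out hw]
        exact h u hu w hw huw
    have h2 : sosField U (glue γ φ ξ) = sosField γ φ + sosField (U \ γ) ξ := by
      rw [sosField_split hγ]
      congr 1
      · exact sosField_congr (fun v hv => glue_in hv)
      · exact sosField_congr (fun v hv => glue_out (Finset.mem_sdiff.1 hv).2)
    simp only [C]
    change ex _ = ex _ * ex _
    rw [← ex_add, h1, h2]
    congr 1
    push_cast
    ring
  have hξ' : ∀ φ : Conf, ∀ v, v ∉ U → glue γ φ ξ v = k := by
    intro φ v hv
    rw [glue_out (fun h => hv (hγ h)), hξ v (fun h => hv (Finset.mem_sdiff.1 h).1)]; rfl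
  have heξ : ∀ φ, e (glue γ φ ξ) = e ξ := fun φ => he _ _ (fun v hv => glue_out hv)
  have hgg : ∀ (m : ℤ) (φ : Conf), (∀ v, v ∉ γ → φ v = m) →
      glue γ (glue γ φ ξ) (cst m) = φ := by
    intro m φ hφ
    funext v
    by_cases hv : v ∈ γ
    · rw [glue_in hv, glue_in hv]
    · rw [glue_out hv, hφ v hv]; rfl
  have hL : Iop γ ξ (fun φ => s φ * wt E β lam U φ) ≤ e ξ * C a * Zr E β lam γ a sin := by
    rw [Iop_glue γ ξ (cst a), Zr, ← Iop_mul]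
    refine Iop_mono (fun φ hφ => ?_)
    have h1 := hs (glue γ φ ξ) (hξ' φ)
    rw [heξ, hgg a φ hφ] at h1
    by_cases h0 : e ξ * sin φ = 0
    · have : s (glue γ φ ξ) = 0 := le_antisymm (h0 ▸ h1) zero_le
      simp [this]
    · rw [mul_eq_zero, not_or] at h0
      have h2 := hs' (glue γ φ ξ) (by rw [heξ]; exact h0.1) (by rw [hgg a φ hφ]; exact h0.2)
      rw [hsplit a φ hφ (fun u hu w hw huw => by
        have := h2 u hu w hw huw
        rwa [glue_in hu, glue_out hw] at this)]
      calc _ ≤ e ξ * sin φ * (C a * wt E β lam γ φ) := by gcongr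
        _ = _ := by ring
  have hR : e ξ * C b * Zr E β lam γ b tin ≤ Iop γ ξ (fun φ => t φ * wt E β lam U φ) := by
    rw [Iop_glue γ ξ (cst b), Zr, ← Iop_mul]
    refine Iop_mono (fun φ hφ => ?_)
    have h1 := ht (glue γ φ ξ) (hξ' φ)
    rw [heξ, hgg b φ hφ] at h1
    by_cases h0 : e ξ * tin φ = 0
    · have : e ξ * C b * (tin φ * wt E β lam γ φ) = (e ξ * tin φ) * (C b * wt E β lam γ φ) := by ring
      rw [this, h0]; simp
    · rw [mul_eq_zero, not_or] at h0
      have h2 := ht' (glue γ φ ξ) (by rw [heξ]; exact h0.1) (by rw [hgg b φ hφ]; exact h0.2)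
      rw [hsplit b φ hφ (fun u hu w hw huw => by
        have := h2 u hu w hw huw
        rwa [glue_in hu, glue_out hw] at this)]
      calc _ = e ξ * tin φ * (C b * wt E β lam γ φ) := by ring
        _ ≤ _ := by gcongr
  have hC : e ξ * C a = ex (-β * |((b - a : ℤ) : ℝ)| * per E γ) * (e ξ * C b) := by
    by_cases h0 : e ξ = 0
    · simp [h0]
    · have := HE_level (E := E) (he' ξ h0)
      have h2 : C a = ex (-β * |((b - a : ℤ) : ℝ)| * per E γ) * C b := by
        simp only [C]
        rw [← ex_add, this]
        congr 1
        push_cast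
        ring
      rw [h2]; ring
  calc _ ≤ e ξ * C a * Zr E β lam γ a sin := hL
    _ ≤ e ξ * C a * (q * Zr E β lam γ b tin) := by gcongr
    _ = q * ex (-β * |((b - a : ℤ) : ℝ)| * per E γ) * (e ξ * C b * Zr E β lam γ b tin) := by
      rw [hC]; ring
    _ ≤ _ := by gcongr

end
end SOS


set_option linter.unusedVariables false
set_option linter.unusedSectionVars false
namespace SOS
noncomputable section
open scoped Classical ENNReal
open Finset

lemma mem_innerBdry {U : Finset Site} {v : Site} :
    v ∈ innerBdry U ↔ v ∈ U ∧ ∃ w, w ∉ U ∧ adjS v w := by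
  simp only [innerBdry, Finset.mem_filter]
  refine and_congr_right (fun _ => ⟨?_, ?_⟩)
  · rintro ⟨d, hd, h⟩
    exact ⟨v + d, h, by simpa [adjS] using hd⟩
  · rintro ⟨w, h, hd⟩
    exact ⟨w - v, hd, by simpa using h⟩

lemma innerBdry_mono {γ U : Finset Site} (h : γ ⊆ U) {v : Site} (hv : v ∈ innerBdry U)
    (hvγ : v ∈ γ) : v ∈ innerBdry γ := by
  rw [mem_innerBdry] at *
  obtain ⟨_, w, hw, ha⟩ := hv
  exact ⟨hvγ, w, fun hh => hw (h hh), ha⟩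


abbrev mi : Site → BSign := constSign BSign.minus
/-- plus signing -/
abbrev pl : Site → BSign := constSign BSign.plus

lemma glue_mem_mi {γ : Finset Site} {φ : Conf} {a : ℤ} :
    glue γ φ (cst a) ∈ signedConfigs γ mi a ↔
      (∀ v ∈ γ, 0 ≤ φ v) ∧ ∀ v ∈ innerBdry γ, φ v ≤ a := by
  have h : ∀ v ∈ innerBdry γ, v ∈ γ := fun v hv => (mem_innerBdry.1 hv).1
  constructor
  · rintro ⟨_, h1, h2⟩
    refine ⟨fun v hv => ?_, fun v hv => ?_⟩
    · have := h1 v hv; rwa [glue_in hv] at this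
    · have := h2 v hv; rw [glue_in (h v hv)] at this; exact this
  · rintro ⟨h1, h2⟩
    refine ⟨fun v hv => glue_out hv, fun v hv => ?_, fun v hv => ?_⟩
    · rw [glue_in hv]; exact h1 v hv
    · rw [glue_in (h v hv)]; exact h2 v hv

lemma glue_mem_pl {γ : Finset Site} {φ : Conf} {a : ℤ} :
    glue γ φ (cst a) ∈ signedConfigs γ pl a ↔
      (∀ v ∈ γ, 0 ≤ φ v) ∧ ∀ v ∈ innerBdry γ, a ≤ φ v := by
  have h : ∀ v ∈ innerBdry γ, v ∈ γ := fun v hv => (mem_innerBdry.1 hv).1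
  constructor
  · rintro ⟨_, h1, h2⟩
    refine ⟨fun v hv => ?_, fun v hv => ?_⟩
    · have := h1 v hv; rwa [glue_in hv] at this
    · have := h2 v hv; rw [glue_in (h v hv)] at this; exact this
  · rintro ⟨h1, h2⟩
    refine ⟨fun v hv => glue_out hv, fun v hv => ?_, fun v hv => ?_⟩
    · rw [glue_in hv]; exact h1 v hv
    · rw [glue_in (h v hv)]; exact h2 v hv

/-- signed partition function -/
abbrev ZS (E : Finset Edge) (β lam : ℝ) (U : Finset Site) (η : Site → BSign) (k : ℤ) : ℝ≥0∞ :=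
  Zr E β lam U k (fun φ => ind (φ ∈ signedConfigs U η k))

/-- signed partition function with an event at a site -/
abbrev ZA (E : Finset Edge) (β lam : ℝ) (U : Finset Site) (η : Site → BSign) (k : ℤ)
    (x : Site) (A : Set ℤ) : ℝ≥0∞ :=
  Zr E β lam U k (fun φ => ind (φ ∈ signedConfigs U η k ∧ φ x ∈ A))

lemma step_down {E : Finset Edge} {β lam : ℝ} {U : Finset Site}
    (hU : connectedIn ((↑U : Set Site)ᶜ)) {j k : ℤ} (hjk : j ≤ k) (η : Site → BSign) (x : Site)
    (A : Set ℤ) (hA : ∀ a ∈ A, a ≤ j - 1) (q : Finset Site → ℝ≥0∞)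
    (hq : ∀ γ ∈ Cls U, x ∈ γ → ZA E β lam γ mi (j - 1) x A ≤ q γ * ZS E β lam γ mi j) :
    ZA E β lam U η k x A ≤
      (∑ γ ∈ (Cls U).filter (fun γ => x ∈ γ), q γ * ex (-β * per E γ)) * ZS E β lam U η k := by
  let s : Finset Site → Conf → ℝ≥0∞ := fun γ φ =>
    ind ((φ ∈ signedConfigs U η k ∧ φ x ∈ A) ∧
      ∀ u ∈ γ, ∀ w, w ∉ γ → adjS u w → φ u ≤ j - 1 ∧ j ≤ φ w)
  have h1 : ZA E β lam U η k x A ≤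
      Zr E β lam U k (fun φ => ∑ γ ∈ (Cls U).filter (fun γ => x ∈ γ), s γ φ) := by
    refine Zr_mono (fun φ hφ => ?_)
    by_cases h : φ ∈ signedConfigs U η k ∧ φ x ∈ A
    · have hQ : ∀ v, v ∉ U → v ∈ {v | j ≤ φ v} := fun v hv => by
        change j ≤ φ v; rw [hφ v hv]; exact hjk
      obtain ⟨γ, hγ, hxγ⟩ := Gam_cover' (U := U) (Q := {v | j ≤ φ v}) hQ (v := x) (by
        intro hx; have := hA _ h.2; change j ≤ φ x at hx; omega)
      have hγC := Gam_sub_Cls hQ hU hγ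
      refine le_trans ?_ (Finset.single_le_sum (f := fun γ => s γ φ) (fun _ _ => zero_le)
        (Finset.mem_filter.2 ⟨hγC, hxγ⟩))
      refine ind_mono (fun _ => ⟨h, fun u hu w hw huw => ?_⟩)
      obtain ⟨a1, a2, _⟩ := Gam_bdry hQ hγ hu hw huw
      have a1' : ¬ j ≤ φ u := a1
      exact ⟨by omega, a2⟩
    · rw [ind_neg h]; exact zero_le
  refine h1.trans ?_
  rw [Zr_sum, Finset.sum_mul]
  refine Finset.sum_le_sum (fun γ hγ => ?_)
  rw [Finset.mem_filter] at hγ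
  have hγU := (mem_Cls.1 hγ.1).1
  have hin : ∀ v ∈ innerBdry γ, v ∈ γ := fun v hv => (mem_innerBdry.1 hv).1
  have := repl E β lam hγU k (j - 1) j (s γ) (fun φ => ind (φ ∈ signedConfigs U η k))
    (fun φ => ind ((∀ u ∈ γ, ∀ w, w ∉ γ → adjS u w → j ≤ φ w) ∧ (∀ v ∈ U, v ∉ γ → 0 ≤ φ v) ∧
      (∀ v ∈ innerBdry U, v ∉ γ → BSign.ok (η v) k (φ v)) ∧
      (∀ v ∈ innerBdry U, v ∈ γ → η v = .minus ∨ η v = .free)))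
    (fun ψ => ind (ψ ∈ signedConfigs γ mi (j - 1) ∧ ψ x ∈ A))
    (fun ψ => ind (ψ ∈ signedConfigs γ mi j)) (q γ) ?_ ?_ ?_ ?_ ?_ ?_ (hq γ hγ.1 hγ.2)
  · simpa using this
  · intro φ ψ h
    have e1 : (∀ u ∈ γ, ∀ w, w ∉ γ → adjS u w → j ≤ φ w) ↔
        (∀ u ∈ γ, ∀ w, w ∉ γ → adjS u w → j ≤ ψ w) := by
      constructor <;> intro h' u hu w hw huw
      · rw [← h w hw]; exact h' u hu w hw huw
      · rw [h w hw]; exact h' u hu w hw huw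
    have e2 : (∀ v ∈ U, v ∉ γ → 0 ≤ φ v) ↔ (∀ v ∈ U, v ∉ γ → 0 ≤ ψ v) := by
      constructor <;> intro h' v hv hvγ
      · rw [← h v hvγ]; exact h' v hv hvγ
      · rw [h v hvγ]; exact h' v hv hvγ
    have e3 : (∀ v ∈ innerBdry U, v ∉ γ → BSign.ok (η v) k (φ v)) ↔
        (∀ v ∈ innerBdry U, v ∉ γ → BSign.ok (η v) k (ψ v)) := by
      constructor <;> intro h' v hv hvγ
      · rw [← h v hvγ]; exact h' v hv hvγ
      · rw [h v hvγ]; exact h' v hv hvγ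
    simp only [e1, e2, e3]
  · intro φ h u hu w hw huw
    have := (ind_ne_zero.1 h).1 u hu w hw huw
    rw [abs_of_nonneg (by omega), abs_of_nonneg (by omega), abs_of_nonneg (by omega)]; ring
  · intro φ hφ
    rw [← ind_and]
    refine ind_mono ?_
    rintro ⟨⟨⟨_, h2, h3⟩, hx⟩, h4⟩
    refine ⟨⟨fun u hu w hw huw => (h4 u hu w hw huw).2, fun v hv _ => h2 v hv,
      fun v hv _ => h3 v hv, fun v hv hvγ => ?_⟩, ?_, ?_⟩
    · obtain ⟨_, w, hw, hvw⟩ := mem_innerBdry.1 (innerBdry_mono hγU hv hvγ)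
      have h5 := (h4 v hvγ w hw hvw).1
      have h6 := h3 v hv
      cases hη : η v <;> rw [hη] at h6 <;> simp only [BSign.ok] at h6 <;> simp <;> omega
    · rw [glue_mem_mi]
      refine ⟨fun v hv => h2 v (hγU hv), fun v hv => ?_⟩
      obtain ⟨hvγ, w, hw, hvw⟩ := mem_innerBdry.1 hv
      exact (h4 v hvγ w hw hvw).1
    · rw [glue_in hγ.2]; exact hx
  · intro φ h h' u hu w hw huw
    have h1 := (ind_ne_zero.1 h).1 u hu w hw huw
    have h2 := (glue_mem_mi.1 (ind_ne_zero.1 h').1).2 u (mem_innerBdry.2 ⟨hu, w, hw, huw⟩)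
    rw [abs_of_nonpos (by omega), abs_of_nonpos (by omega), abs_of_nonpos (by omega)]; ring
  · intro φ hφ
    rw [← ind_and]
    refine ind_mono ?_
    rintro ⟨⟨h1, h2, h3, h4⟩, h5⟩
    rw [glue_mem_mi] at h5
    refine ⟨fun v hv => hφ v hv, fun v hv => ?_, fun v hv => ?_⟩
    · by_cases hvγ : v ∈ γ
      · exact h5.1 v hvγ
      · exact h2 v hv hvγ
    · by_cases hvγ : v ∈ γ
      · have := h5.2 v (innerBdry_mono hγU hv hvγ)
        rcases h4 v hv hvγ with h6 | h6 <;> rw [h6] <;> simp only [BSign.ok]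
        omega
      · exact h3 v hv hvγ
  · intro φ h h' u hu w hw huw
    have h1 := (ind_ne_zero.1 h).1 u hu w hw huw
    have h2 := (glue_mem_mi.1 (ind_ne_zero.1 h')).2 u (mem_innerBdry.2 ⟨hu, w, hw, huw⟩)
    rw [abs_of_nonpos (by omega), abs_of_nonpos (by omega), abs_of_nonpos (by omega)]; ring

lemma step_up {E : Finset Edge} {β lam : ℝ} {U : Finset Site}
    (hU : connectedIn ((↑U : Set Site)ᶜ)) {k : ℤ} (η : Site → BSign) (x : Site)
    (A : Set ℤ) (hA : ∀ a ∈ A, k + 1 ≤ a) (q : Finset Site → ℝ≥0∞)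
    (hq : ∀ γ ∈ Cls U, x ∈ γ → ZA E β lam γ pl (k + 1) x A ≤ q γ * ZS E β lam γ pl k) :
    ZA E β lam U η k x A ≤
      (∑ γ ∈ (Cls U).filter (fun γ => x ∈ γ), q γ * ex (-β * per E γ)) * ZS E β lam U η k := by
  let s : Finset Site → Conf → ℝ≥0∞ := fun γ φ =>
    ind ((φ ∈ signedConfigs U η k ∧ φ x ∈ A) ∧
      ∀ u ∈ γ, ∀ w, w ∉ γ → adjS u w → k + 1 ≤ φ u ∧ φ w ≤ k)
  have h1 : ZA E β lam U η k x A ≤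
      Zr E β lam U k (fun φ => ∑ γ ∈ (Cls U).filter (fun γ => x ∈ γ), s γ φ) := by
    refine Zr_mono (fun φ hφ => ?_)
    by_cases h : φ ∈ signedConfigs U η k ∧ φ x ∈ A
    · have hQ : ∀ v, v ∉ U → v ∈ {v | φ v ≤ k} := fun v hv => by
        change φ v ≤ k; rw [hφ v hv]
      obtain ⟨γ, hγ, hxγ⟩ := Gam_cover' (U := U) (Q := {v | φ v ≤ k}) hQ (v := x) (by
        intro hx; have := hA _ h.2; change φ x ≤ k at hx; omega)
      have hγC := Gam_sub_Cls hQ hU hγ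
      refine le_trans ?_ (Finset.single_le_sum (f := fun γ => s γ φ) (fun _ _ => zero_le)
        (Finset.mem_filter.2 ⟨hγC, hxγ⟩))
      refine ind_mono (fun _ => ⟨h, fun u hu w hw huw => ?_⟩)
      obtain ⟨a1, a2, _⟩ := Gam_bdry hQ hγ hu hw huw
      have a1' : ¬ φ u ≤ k := a1
      exact ⟨by omega, a2⟩
    · rw [ind_neg h]; exact zero_le
  refine h1.trans ?_
  rw [Zr_sum, Finset.sum_mul]
  refine Finset.sum_le_sum (fun γ hγ => ?_)
  rw [Finset.mem_filter] at hγ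
  have hγU := (mem_Cls.1 hγ.1).1
  have hin : ∀ v ∈ innerBdry γ, v ∈ γ := fun v hv => (mem_innerBdry.1 hv).1
  have := repl E β lam hγU k (k + 1) k (s γ) (fun φ => ind (φ ∈ signedConfigs U η k))
    (fun φ => ind ((∀ u ∈ γ, ∀ w, w ∉ γ → adjS u w → φ w ≤ k) ∧ (∀ v ∈ U, v ∉ γ → 0 ≤ φ v) ∧
      (∀ v ∈ innerBdry U, v ∉ γ → BSign.ok (η v) k (φ v)) ∧
      (∀ v ∈ innerBdry U, v ∈ γ → η v = .plus ∨ η v = .free)))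
    (fun ψ => ind (ψ ∈ signedConfigs γ pl (k + 1) ∧ ψ x ∈ A))
    (fun ψ => ind (ψ ∈ signedConfigs γ pl k)) (q γ) ?_ ?_ ?_ ?_ ?_ ?_ (hq γ hγ.1 hγ.2)
  · simpa using this
  · intro φ ψ h
    have e1 : (∀ u ∈ γ, ∀ w, w ∉ γ → adjS u w → φ w ≤ k) ↔
        (∀ u ∈ γ, ∀ w, w ∉ γ → adjS u w → ψ w ≤ k) := by
      constructor <;> intro h' u hu w hw huw
      · rw [← h w hw]; exact h' u hu w hw huw
      · rw [h w hw]; exact h' u hu w hw huw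
    have e2 : (∀ v ∈ U, v ∉ γ → 0 ≤ φ v) ↔ (∀ v ∈ U, v ∉ γ → 0 ≤ ψ v) := by
      constructor <;> intro h' v hv hvγ
      · rw [← h v hvγ]; exact h' v hv hvγ
      · rw [h v hvγ]; exact h' v hv hvγ
    have e3 : (∀ v ∈ innerBdry U, v ∉ γ → BSign.ok (η v) k (φ v)) ↔
        (∀ v ∈ innerBdry U, v ∉ γ → BSign.ok (η v) k (ψ v)) := by
      constructor <;> intro h' v hv hvγ
      · rw [← h v hvγ]; exact h' v hv hvγ
      · rw [h v hvγ]; exact h' v hv hvγ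
    simp only [e1, e2, e3]
  · intro φ h u hu w hw huw
    have := (ind_ne_zero.1 h).1 u hu w hw huw
    rw [abs_of_nonpos (by omega), abs_of_nonpos (by omega), abs_of_nonpos (by omega)]; ring
  · intro φ hφ
    rw [← ind_and]
    refine ind_mono ?_
    rintro ⟨⟨⟨_, h2, h3⟩, hx⟩, h4⟩
    refine ⟨⟨fun u hu w hw huw => (h4 u hu w hw huw).2, fun v hv _ => h2 v hv,
      fun v hv _ => h3 v hv, fun v hv hvγ => ?_⟩, ?_, ?_⟩
    · obtain ⟨_, w, hw, hvw⟩ := mem_innerBdry.1 (innerBdry_mono hγU hv hvγ)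
      have h5 := (h4 v hvγ w hw hvw).1
      have h6 := h3 v hv
      cases hη : η v <;> rw [hη] at h6 <;> simp only [BSign.ok] at h6 <;> simp <;> omega
    · rw [glue_mem_pl]
      refine ⟨fun v hv => h2 v (hγU hv), fun v hv => ?_⟩
      obtain ⟨hvγ, w, hw, hvw⟩ := mem_innerBdry.1 hv
      exact (h4 v hvγ w hw hvw).1
    · rw [glue_in hγ.2]; exact hx
  · intro φ h h' u hu w hw huw
    have h1 := (ind_ne_zero.1 h).1 u hu w hw huw
    have h2 := (glue_mem_pl.1 (ind_ne_zero.1 h').1).2 u (mem_innerBdry.2 ⟨hu, w, hw, huw⟩)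
    rw [abs_of_nonneg (by omega), abs_of_nonneg (by omega), abs_of_nonneg (by omega)]; ring
  · intro φ hφ
    rw [← ind_and]
    refine ind_mono ?_
    rintro ⟨⟨h1, h2, h3, h4⟩, h5⟩
    rw [glue_mem_pl] at h5
    refine ⟨fun v hv => hφ v hv, fun v hv => ?_, fun v hv => ?_⟩
    · by_cases hvγ : v ∈ γ
      · exact h5.1 v hvγ
      · exact h2 v hv hvγ
    · by_cases hvγ : v ∈ γ
      · have := h5.2 v (innerBdry_mono hγU hv hvγ)
        rcases h4 v hv hvγ with h6 | h6 <;> rw [h6] <;> simp only [BSign.ok]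
        omega
      · exact h3 v hv hvγ
  · intro φ h h' u hu w hw huw
    have h1 := (ind_ne_zero.1 h).1 u hu w hw huw
    have h2 := (glue_mem_pl.1 (ind_ne_zero.1 h')).2 u (mem_innerBdry.2 ⟨hu, w, hw, huw⟩)
    rw [abs_of_nonneg (by omega), abs_of_nonneg (by omega), abs_of_nonneg (by omega)]; ring

end
end SOS


set_option linter.unusedVariables false
set_option linter.unusedSectionVars false
namespace SOS
noncomputable section
open scoped Classical ENNReal
open Finset

lemma sum_per {E : Finset Edge} {M : Finset (Finset Site)}
    (hd : ∀ γ ∈ M, ∀ γ' ∈ M, γ ≠ γ' → Disjoint γ γ')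
    (hn : ∀ γ ∈ M, ∀ u ∈ γ, ∀ w, w ∉ γ → adjS u w → ∀ γ' ∈ M, w ∉ γ') :
    ∑ γ ∈ M, per E γ = per E (Un M) := by
  have huniq : ∀ γ ∈ M, ∀ γ' ∈ M, ∀ v, v ∈ γ → v ∈ γ' → γ = γ' := by
    intro γ hγ γ' hγ' v hv hv'
    by_contra hne
    exact Finset.disjoint_left.1 (hd γ hγ γ' hγ' hne) hv hv'
  have h1 : bd E (Un M) = M.biUnion (bd E) := by
    ext e
    have hadj := adjS_sh e.1 e.2
    simp only [bd, Finset.mem_filter, Finset.mem_biUnion, mem_Un]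
    constructor
    · rintro ⟨he, h⟩
      by_cases ha : ∃ γ ∈ M, e.1 ∈ γ
      · obtain ⟨γ, hγ, h1⟩ := ha
        refine ⟨γ, hγ, he, fun h2 => h ⟨fun _ => ⟨γ, hγ, h2.1 h1⟩, fun _ => ⟨γ, hγ, h1⟩⟩⟩
      · by_cases hb : ∃ γ ∈ M, e.1 + sh e.2 ∈ γ
        · obtain ⟨γ, hγ, h1⟩ := hb
          refine ⟨γ, hγ, he, fun h2 => ha ⟨γ, hγ, h2.2 h1⟩⟩
        · exact absurd ⟨fun h' => absurd h' ha, fun h' => absurd h' hb⟩ h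
    · rintro ⟨γ, hγ, he, h⟩
      refine ⟨he, fun h2 => ?_⟩
      by_cases ha : e.1 ∈ γ
      · have hb : e.1 + sh e.2 ∉ γ := fun hb => h ⟨fun _ => hb, fun _ => ha⟩
        obtain ⟨γ', hγ', h3⟩ := h2.1 ⟨γ, hγ, ha⟩
        exact hn γ hγ _ ha _ hb hadj γ' hγ' h3
      · have hb : e.1 + sh e.2 ∈ γ := by
          by_contra hb; exact h ⟨fun h' => absurd h' ha, fun h' => absurd h' hb⟩
        obtain ⟨γ', hγ', h3⟩ := h2.2 ⟨γ, hγ, hb⟩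
        exact hn γ hγ _ hb _ ha (adjS_symm hadj) γ' hγ' h3
  rw [per, h1, Finset.card_biUnion]
  · rfl
  · intro γ hγ γ' hγ' hne
    refine Finset.disjoint_left.2 ?_
    intro e he he'
    simp only [bd, Finset.mem_filter] at he he'
    have hadj := adjS_sh e.1 e.2
    by_cases ha : e.1 ∈ γ
    · have hb : e.1 + sh e.2 ∉ γ := fun hb => he.2 ⟨fun _ => hb, fun _ => ha⟩
      have h3 := hn γ hγ _ ha _ hb hadj γ' hγ'
      have h4 : e.1 ∈ γ' := by
        by_contra h4; exact he'.2 ⟨fun h' => absurd h' h4, fun h' => absurd h' h3⟩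
      exact hne (huniq γ hγ γ' hγ' _ ha h4)
    · have hb : e.1 + sh e.2 ∈ γ := by
        by_contra hb; exact he.2 ⟨fun h' => absurd h' ha, fun h' => absurd h' hb⟩
      have h3 := hn γ hγ _ hb _ ha (adjS_symm hadj) γ' hγ'
      have h4 : e.1 + sh e.2 ∈ γ' := by
        by_contra h4; exact he'.2 ⟨fun h' => absurd h' h3, fun h' => absurd h' h4⟩
      exact hne (huniq γ hγ γ' hγ' _ hb h4)

lemma per_eq (E : Finset Edge) (γ : Finset Site) :
    (per E γ : ℤ) = ∑ e ∈ E, if ¬ (e.1 ∈ γ ↔ e.1 + sh e.2 ∈ γ) then (1:ℤ) else 0 := by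
  rw [per, bd, Finset.card_filter]; push_cast; rfl

lemma inc_le (E : Finset Edge) (S : Finset Site) :
    ∑ e ∈ E, ((if e.1 ∈ S then (1:ℤ) else 0) + if e.1 + sh e.2 ∈ S then 1 else 0) ≤
      4 * S.card := by
  have h1 : (E.filter (fun e => e.1 ∈ S)).card ≤ 2 * S.card := by
    have : E.filter (fun e => e.1 ∈ S) ⊆ S ×ˢ (Finset.univ : Finset Bool) := by
      intro e he; simp only [Finset.mem_filter] at he
      exact Finset.mem_product.2 ⟨he.2, Finset.mem_univ _⟩
    have := Finset.card_le_card this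
    rw [Finset.card_product] at this; simp at this; omega
  have h2 : (E.filter (fun e => e.1 + sh e.2 ∈ S)).card ≤ 2 * S.card := by
    have := Finset.card_le_card_of_injOn (s := E.filter (fun e => e.1 + sh e.2 ∈ S))
      (t := S ×ˢ (Finset.univ : Finset Bool)) (fun e => (e.1 + sh e.2, e.2)) (by
        intro e he; simp only [Finset.coe_filter, Set.mem_ofPred_eq] at he
        exact Finset.mem_coe.2 (Finset.mem_product.2 ⟨he.2, Finset.mem_univ _⟩)) (by
        rintro ⟨a, i⟩ _ ⟨b, j⟩ _ h
        simp only [Prod.mk.injEq] at h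
        obtain ⟨h, rfl⟩ := h
        rw [add_right_cancel h])
    rw [Finset.card_product] at this; simp at this; omega
  rw [Finset.sum_add_distrib, Finset.sum_boole, Finset.sum_boole]
  omega

lemma one_site {E : Finset Edge} {β lam : ℝ} (hβ : 0 ≤ β) (hlam : 0 ≤ lam) {U : Finset Site}
    {k : ℤ} (m : ℕ) (p : ℝ≥0∞) (hp : ∑ n ∈ range (m + 1), p * ex (4 * β * n) ≤ 1)
    (v : Site) (hv : v ∈ U) (f : Conf → ℝ≥0∞)
    (hf : ∀ φ, (∀ v, v ∉ U → φ v = k) → f φ ≠ 0 →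
      0 ≤ φ v ∧ φ v ≤ m ∧ f φ ≤ f (Function.update φ v 0)) :
    p * Zr E β lam U k f ≤ Zr E β lam U k (fun φ => f φ * ind (φ v = 0)) := by
  have h1 : Zr E β lam U k f ≤
      Zr E β lam U k (fun φ => ∑ n ∈ range (m + 1), f φ * ind (φ v = (n:ℤ))) := by
    refine Zr_mono (fun φ hφ => ?_)
    by_cases h0 : f φ = 0
    · simp [h0]
    · obtain ⟨a1, a2, _⟩ := hf φ hφ h0
      obtain ⟨n, hn⟩ := Int.eq_ofNat_of_zero_le a1
      refine le_trans ?_ (Finset.single_le_sum (f := fun n : ℕ => f φ * ind (φ v = (n:ℤ)))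
        (fun _ _ => zero_le) (Finset.mem_range.2 (show n < m + 1 by omega)))
      simp only [ind_pos hn, mul_one]; exact le_rfl
  have h2 : ∀ n : ℕ, Zr E β lam U k (fun φ => f φ * ind (φ v = (n:ℤ))) ≤
      ex (4 * β * n) * Zr E β lam U k (fun φ => f φ * ind (φ v = 0)) := by
    intro n
    refine Zr_shift (fun w => if w = v then -(n:ℤ) else 0) _ _ _ ?_ ?_
    · intro w hw
      have : w ≠ v := fun h => hw (h ▸ hv)
      simp [this]
    · intro φ hφ hne
      have hi : φ v = n := ind_ne_zero.1 (right_ne_zero_of_mul hne)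
      obtain ⟨a1, a2, a3⟩ := hf φ hφ (left_ne_zero_of_mul hne)
      have hu : φ + (fun w => if w = v then -(n:ℤ) else 0) = Function.update φ v 0 := by
        funext w
        by_cases hw : w = v
        · subst hw; simp [hi]
        · simp [hw]
      rw [hu]
      refine ⟨?_, ?_⟩
      · rw [ind_pos hi, ind_pos (by simp)]; simpa using a3
      · refine wt_le _ ?_
        have e1 : HE E (Function.update φ v 0) ≤ HE E φ + 4 * n := by
          have h3 := inc_le E {v}
          have : HE E (Function.update φ v 0) ≤ HE E φ + n * ∑ e ∈ E,
              ((if e.1 ∈ ({v} : Finset Site) then (1:ℤ) else 0) +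
                if e.1 + sh e.2 ∈ ({v} : Finset Site) then 1 else 0) := by
            unfold HE
            rw [Finset.mul_sum, ← Finset.sum_add_distrib]
            refine Finset.sum_le_sum (fun e _ => ?_)
            simp only [Finset.mem_singleton, Function.update_apply]
            by_cases c1 : e.1 = v <;> by_cases c2 : e.1 + sh e.2 = v
            · exact absurd (c2.trans c1.symm) (by simpa using sh_ne e.2)
            · simp only [c1, c2, if_true, if_false]
              rw [c1] at c2
              simp only [c2, if_false]
              rw [hi]
              have := abs_sub_abs_le_abs_sub (0 - φ (v + sh e.2)) (n - φ (v + sh e.2))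
              have h5 : |(0 - φ (v + sh e.2)) - (n - φ (v + sh e.2))| = n := by
                rw [show (0 - φ (v + sh e.2)) - (n - φ (v + sh e.2)) = -(n:ℤ) by ring, abs_neg]
                simp
              linarith
            · simp only [c1, c2, if_true, if_false]
              rw [hi]
              have := abs_sub_abs_le_abs_sub (φ e.1 - 0) (φ e.1 - n)
              have h5 : |(φ e.1 - 0) - (φ e.1 - n)| = n := by
                rw [show (φ e.1 - 0) - (φ e.1 - n) = (n:ℤ) by ring]
                simp
              linarith
            · simp [c1, c2]
          simp only [Finset.card_singleton] at h3
          have hn : (0:ℤ) ≤ n := by positivity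
          have h6 := mul_le_mul_of_nonneg_left h3 hn
          push_cast at h6
          linarith
        have e2 : sosField U (Function.update φ v 0) ≤ sosField U φ := by
          unfold sosField
          refine Finset.sum_le_sum (fun w _ => ?_)
          by_cases hw : w = v
          · subst hw; simp; exact_mod_cast a1
          · simp [hw]
        have e1' : (HE E (Function.update φ v 0) : ℝ) ≤ HE E φ + 4 * n := by exact_mod_cast e1
        have := mul_le_mul_of_nonneg_left e1' hβ
        have := mul_le_mul_of_nonneg_left e2 hlam
        nlinarith
  calc p * Zr E β lam U k f
      ≤ p * ∑ n ∈ range (m + 1), Zr E β lam U k (fun φ => f φ * ind (φ v = (n:ℤ))) := by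
        rw [← Zr_sum]; gcongr
    _ ≤ p * ∑ n ∈ range (m + 1),
        ex (4 * β * n) * Zr E β lam U k (fun φ => f φ * ind (φ v = 0)) := by
        gcongr with n hn; exact h2 n
    _ = (∑ n ∈ range (m + 1), p * ex (4 * β * n)) *
          Zr E β lam U k (fun φ => f φ * ind (φ v = 0)) := by
        rw [Finset.mul_sum, Finset.sum_mul]
        exact Finset.sum_congr rfl (fun n _ => by ring)
    _ ≤ 1 * _ := by gcongr
    _ = _ := one_mul _

lemma gain {E : Finset Edge} {β lam : ℝ} (hβ : 0 ≤ β) (hlam : 0 ≤ lam) {U : Finset Site}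
    {k : ℤ} (m : ℕ) (p ε : ℝ≥0∞) (hp : ∑ n ∈ range (m + 1), p * ex (4 * β * n) ≤ 1)
    (g : Conf → ℝ≥0∞) (A : Conf → Finset Site)
    (hg : ∀ φ, (∀ v, v ∉ U → φ v = k) → g φ ≠ 0 → A φ ⊆ U ∧ ∀ v ∈ A φ,
      0 ≤ φ v ∧ φ v ≤ m ∧ g φ ≤ g (Function.update φ v 0) ∧ A (Function.update φ v 0) = A φ) :
    Zr E β lam U k (fun φ => g φ * (1 + ε * p) ^ (A φ).card) ≤
      Zr E β lam U k (fun φ => g φ * ∏ v ∈ A φ, (1 + ε * ind (φ v = 0))) := by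
  let F : Finset Site → Conf → Site → ℝ≥0∞ := fun W φ v =>
    if v ∈ W then 1 + ε * ind (φ v = 0) else 1 + ε * p
  have key : ∀ W : Finset Site, W ⊆ U →
      Zr E β lam U k (fun φ => g φ * (1 + ε * p) ^ (A φ).card) ≤
        Zr E β lam U k (fun φ => g φ * ∏ v ∈ A φ, F W φ v) := by
    intro W
    induction W using Finset.induction_on with
    | empty =>
      intro _
      refine Zr_mono (fun φ _ => ?_)
      simp [F]
    | insert x W hx ih =>
      intro hW
      rw [Finset.insert_subset_iff] at hW
      refine (ih hW.2).trans ?_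
      let f : Conf → ℝ≥0∞ := fun φ => ind (x ∈ A φ) * (g φ * ∏ v ∈ (A φ).erase x, F W φ v)
      let f' : Conf → ℝ≥0∞ := fun φ => ind (x ∉ A φ) * (g φ * ∏ v ∈ A φ, F W φ v)
      have hL : ∀ φ, g φ * ∏ v ∈ A φ, F W φ v = f' φ + (f φ + ε * p * f φ) := by
        intro φ
        by_cases hxA : x ∈ A φ
        · simp only [f, f', ind_pos hxA, ind_neg (not_not.2 hxA)]
          rw [← Finset.mul_prod_erase _ _ hxA]
          simp only [F, hx, if_false]
          ring
        · simp only [f, f', ind_neg hxA, ind_pos hxA]; ring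
      have hR : ∀ φ, g φ * ∏ v ∈ A φ, F (insert x W) φ v =
          f' φ + (f φ + ε * (f φ * ind (φ x = 0))) := by
        intro φ
        by_cases hxA : x ∈ A φ
        · simp only [f, f', ind_pos hxA, ind_neg (not_not.2 hxA)]
          rw [← Finset.mul_prod_erase _ _ hxA]
          have : ∏ v ∈ (A φ).erase x, F (insert x W) φ v = ∏ v ∈ (A φ).erase x, F W φ v := by
            refine Finset.prod_congr rfl (fun v hv => ?_)
            have : v ≠ x := Finset.ne_of_mem_erase hv
            simp [F, this]
          rw [this]
          simp only [F, Finset.mem_insert_self, if_true]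
          ring
        · simp only [f, f', ind_neg hxA, ind_pos hxA]
          have : ∏ v ∈ A φ, F (insert x W) φ v = ∏ v ∈ A φ, F W φ v := by
            refine Finset.prod_congr rfl (fun v hv => ?_)
            have : v ≠ x := fun h => hxA (h ▸ hv)
            simp [F, this]
          rw [this]; ring
      have hadd : ∀ s t : Conf → ℝ≥0∞, Zr E β lam U k (fun φ => s φ + t φ) =
          Zr E β lam U k s + Zr E β lam U k t := by
        intro s t
        have := Zr_sum (E := E) (β := β) (lam := lam) (U := U) (k := k) (Finset.univ : Finset Bool)
          (fun b => if b then s else t)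
        simpa using this
      simp only [hL, hR, hadd, Zr_mul]
      rw [mul_assoc]
      gcongr
      refine one_site hβ hlam m p hp x hW.1 f (fun φ hφ hne => ?_)
      have hxA : x ∈ A φ := ind_ne_zero.1 (left_ne_zero_of_mul hne)
      have hgne := left_ne_zero_of_mul (right_ne_zero_of_mul hne)
      obtain ⟨_, h⟩ := hg φ hφ hgne
      obtain ⟨a1, a2, a3, a4⟩ := h x hxA
      refine ⟨a1, a2, ?_⟩
      simp only [f, a4]
      have : ∏ v ∈ (A φ).erase x, F W φ v =
          ∏ v ∈ (A φ).erase x, F W (Function.update φ x 0) v := by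
        refine Finset.prod_congr rfl (fun v hv => ?_)
        have : v ≠ x := Finset.ne_of_mem_erase hv
        simp [F, this]
      rw [this]
      gcongr
  refine (key U subset_rfl).trans (Zr_mono (fun φ hφ => ?_))
  by_cases h0 : g φ = 0
  · simp [h0]
  · gcongr with v hv
    simp only [F, (hg φ hφ h0).1 hv, if_true]; exact le_rfl

end
end SOS


set_option linter.unusedVariables false
set_option linter.unusedSectionVars false
namespace SOS
noncomputable section
open scoped Classical ENNReal
open Finset

lemma card_Un {M : Finset (Finset Site)} (hd : ∀ γ ∈ M, ∀ γ' ∈ M, γ ≠ γ' → Disjoint γ γ') :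
    (Un M).card = ∑ γ ∈ M, γ.card := by
  have := Finset.card_biUnion (s := M) (t := id) (fun γ hγ γ' hγ' hne => hd γ hγ γ' hγ' hne)
  exact this

lemma ex_sum {ι : Type*} (s : Finset ι) (f : ι → ℝ) : ex (∑ i ∈ s, f i) = ∏ i ∈ s, ex (f i) := by
  induction s using Finset.induction_on with
  | empty => simp [ex_zero]
  | insert a s ha ih => rw [Finset.prod_insert ha, Finset.sum_insert ha, ex_add, ih]

lemma Gam_disjoint {U : Finset Site} {Q : Set Site} :
    ∀ γ ∈ Gam U Q, ∀ γ' ∈ Gam U Q, γ ≠ γ' → Disjoint γ γ' := by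
  intro γ hγ γ' hγ' hne
  rw [Finset.disjoint_left]
  intro v hv hv'
  exact hne (Gam_disj hγ hγ' hv hv')

lemma sub_Gam_Fam {U : Finset Site} {Q : Set Site} (hQ : ∀ v, v ∉ U → v ∈ Q)
    (hU : connectedIn ((↑U : Set Site)ᶜ)) {M : Finset (Finset Site)} (hM : M ⊆ Gam U Q) :
    M ∈ Fam U :=
  mem_Fam.2 ⟨hM.trans (Gam_sub_Cls hQ hU), fun γ hγ γ' hγ' =>
    Gam_disjoint γ (hM hγ) γ' (hM hγ')⟩


lemma shift_up_DS {E : Finset Edge} {β lam : ℝ} (hβ : 0 ≤ β) (hlam : 0 ≤ lam) {U : Finset Site}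
    (hU : connectedIn ((↑U : Set Site)ᶜ)) (m : ℕ)
    (M : Finset (Finset Site)) (hM : M ∈ Fam U) (S : Finset Site) (hS : S ⊆ U \ Un M) :
    Zr E β lam U m (fun φ => ind ((φ ∈ signedConfigs U mi m ∧ M ⊆ Gam U {v | φ v ≤ m}) ∧
        ∀ v ∈ S, φ v = 0)) ≤
      ((∏ γ ∈ M, ex (-β * per E γ)) * ex (4 * β) ^ S.card * ex lam ^ (U \ Un M).card) *
      Zr E β lam U ((m + 1 : ℕ) : ℤ) (fun ψ => ind (ψ ∈ signedConfigs U mi ((m + 1 : ℕ) : ℤ)) *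
        ind ((U \ Un M).filter (fun v => ψ v = 0) = S)) := by
  have hUnU : Un M ⊆ U := by
    intro v hv
    obtain ⟨γ, hγ, h⟩ := mem_Un.1 hv
    exact (mem_Cls.1 ((mem_Fam.1 hM).1 hγ)).1 h
  let c : Conf := fun v => if v ∈ Un M ∨ v ∈ S then 0 else 1
  refine Zr_shift c _ _ _ ?_ ?_
  · intro v hv
    have h1 : v ∉ Un M := fun h => hv (hUnU h)
    have h2 : v ∉ S := fun h => hv (Finset.mem_sdiff.1 (hS h)).1
    simp [c, h1, h2]
  · intro φ hφ hne
    obtain ⟨⟨⟨h1, h2, h3⟩, hMG⟩, hS0⟩ := ind_ne_zero.1 hne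
    have hQ : ∀ v, v ∉ U → v ∈ {v | φ v ≤ (m:ℤ)} := fun v hv => (hφ v hv).le
    have hc0 : ∀ v, 0 ≤ c v := fun v => by simp only [c]; split_ifs <;> omega
    have hc1 : ∀ v, c v ≤ 1 := fun v => by simp only [c]; split_ifs <;> omega
    refine ⟨?_, ?_⟩
    · refine (ind_le_one _).trans ?_
      rw [← ind_and, ind_pos]
      refine ⟨?_, ?_⟩
      rotate_left
      · ext v
        simp only [Finset.mem_filter, Pi.add_apply]
        constructor
        · rintro ⟨hv, h0⟩
          by_contra hvS
          have : c v = 1 := by simp [c, hvS, (Finset.mem_sdiff.1 hv).2]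
          have := h2 v (Finset.mem_sdiff.1 hv).1
          omega
        · intro hv
          refine ⟨hS hv, ?_⟩
          have : c v = 0 := by simp [c, hv]
          rw [hS0 v hv, this]; rfl
      · refine ⟨fun v hv => ?_, fun v hv => ?_, fun v hv => ?_⟩
        · have h1 : v ∉ Un M := fun h => hv (hUnU h)
          have h2 : v ∉ S := fun h => hv (Finset.mem_sdiff.1 (hS h)).1
          simp [c, h1, h2, hφ v hv]
        · have := h2 v hv; have := hc0 v; simp only [Pi.add_apply]; omega
        · have : φ v ≤ m := h3 v hv
          have := hc1 v
          change φ v + c v ≤ ((m + 1 : ℕ):ℤ)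
          push_cast; omega
    · have hn : ∀ γ ∈ M, ∀ u ∈ γ, ∀ w, w ∉ γ → adjS u w →
          (m:ℤ) + 1 ≤ φ u ∧ φ w ≤ m ∧ ∀ γ' ∈ M, w ∉ γ' := by
        intro γ hγ u hu w hw huw
        obtain ⟨a1, a2, a3⟩ := Gam_bdry hQ (hMG hγ) hu hw huw
        have a1' : ¬ φ u ≤ m := a1
        exact ⟨by omega, a2, fun γ' hγ' => a3 γ' (hMG hγ')⟩
      have hper := sum_per (E := E) (M := M) (mem_Fam.1 hM).2
        (fun γ hγ u hu w hw huw => (hn γ hγ u hu w hw huw).2.2)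
      have hcross : ∀ u w, adjS u w → u ∈ Un M → w ∉ Un M → (m:ℤ) + 1 ≤ φ u ∧ φ w ≤ m := by
        intro u w huw hu hw
        obtain ⟨γ, hγ, h⟩ := mem_Un.1 hu
        have := hn γ hγ u h w (fun h' => hw (mem_Un.2 ⟨γ, hγ, h'⟩)) huw
        exact ⟨this.1, this.2.1⟩
      have hdisj : ∀ v ∈ Un M, v ∉ S := fun v hv hvS => (Finset.mem_sdiff.1 (hS hvS)).2 hv
      have eH : HE E (φ + c) + per E (Un M) ≤ HE E φ + 4 * S.card := by
        refine le_trans ?_ (add_le_add_right (inc_le E S) _)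
        rw [per_eq]
        unfold HE
        rw [← Finset.sum_add_distrib, ← Finset.sum_add_distrib]
        refine Finset.sum_le_sum (fun e _ => ?_)
        have hadj := adjS_sh e.1 e.2
        generalize e.1 + sh e.2 = w at *
        generalize e.1 = u at *
        have q1 := hcross u w hadj
        have q2 := hcross w u (adjS_symm hadj)
        have q3 := hdisj u
        have q4 := hdisj w
        have t1 : ∀ a b : ℤ, |a - (b + 1)| ≤ |a - b| + 1 := fun a b => by
          have := abs_sub_abs_le_abs_sub (a - (b+1)) (a - b)
          have h5 : |a - (b+1) - (a - b)| = 1 := by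
            rw [show a - (b+1) - (a - b) = -1 by ring]; rfl
          linarith
        have t2 : ∀ a b : ℤ, |a + 1 - b| ≤ |a - b| + 1 := fun a b => by
          rw [abs_sub_comm, abs_sub_comm a]; exact t1 b a
        have t3 : ∀ a b : ℤ, (m:ℤ) + 1 ≤ a → b ≤ m → |a - (b + 1)| + 1 = |a - b| := fun a b ha hb => by
          rw [abs_of_nonneg (by omega), abs_of_nonneg (by omega)]; ring
        have t4 : ∀ a b : ℤ, (m:ℤ) + 1 ≤ a → b ≤ m → |b + 1 - a| + 1 = |b - a| := fun a b ha hb => by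
          rw [abs_sub_comm, abs_sub_comm b]; exact t3 a b ha hb
        have t5 : ∀ a b : ℤ, a + 1 - (b + 1) = a - b := fun a b => by ring
        simp only [Pi.add_apply, c]
        by_cases m1 : u ∈ Un M <;> by_cases m2 : w ∈ Un M <;> by_cases s1 : u ∈ S <;>
          by_cases s2 : w ∈ S <;> simp only [m1, m2, s1, s2, true_or, or_true, or_self, if_true,
            if_false, iff_self, not_true, not_false_eq_true, iff_false, false_iff, iff_true,
            true_iff, not_not, add_zero, t5] <;>
          first
          | (exact absurd s1 (q3 m1))
          | (exact absurd s2 (q4 m2))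
          | (have := t1 (φ u) (φ w); linarith)
          | (have := t2 (φ u) (φ w); linarith)
          | (have := q1 m1 m2; have := t3 _ _ this.1 this.2; linarith)
          | (have := q2 m2 m1; have := t4 _ _ this.1 this.2; linarith)
          | linarith
      have eF : sosField U (φ + c) ≤ sosField U φ + (U \ Un M).card := by
        have e1 := sosField_split hUnU (φ + c)
        have e2 := sosField_split hUnU φ
        have e3 : sosField (Un M) (φ + c) = sosField (Un M) φ :=
          sosField_congr (fun v hv => by simp [c, hv])
        have e4 : sosField (U \ Un M) (φ + c) ≤ sosField (U \ Un M) φ + (U \ Un M).card := by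
          unfold sosField
          rw [Finset.card_eq_sum_ones]
          push_cast
          rw [← Finset.sum_add_distrib]
          refine Finset.sum_le_sum (fun v _ => ?_)
          have := hc1 v
          simp only [Pi.add_apply]
          push_cast
          have h' : (c v : ℝ) ≤ 1 := by exact_mod_cast this
          linarith
        rw [e1, e2, e3]; linarith
      have hprod : (∏ γ ∈ M, ex (-β * per E γ)) * ex (4 * β) ^ S.card * ex lam ^ (U \ Un M).card =
          ex (-β * per E (Un M) + S.card * (4 * β) + (U \ Un M).card * lam) := by
        rw [ex_add, ex_add, ex_nat_mul, ex_nat_mul, ← hper]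
        congr 2
        push_cast
        rw [Finset.mul_sum, ex_sum]
      rw [hprod]
      refine wt_le _ ?_
      have eH' : (HE E (φ + c) : ℝ) + per E (Un M) ≤ HE E φ + 4 * S.card := by exact_mod_cast eH
      have := mul_le_mul_of_nonneg_left eH' hβ
      have := mul_le_mul_of_nonneg_left eF hlam
      nlinarith

end
end SOS


set_option linter.unusedVariables false
set_option linter.unusedSectionVars false
namespace SOS
noncomputable section
open scoped Classical ENNReal
open Finset

lemma Dstep {E : Finset Edge} {β lam : ℝ} (hβ : 0 ≤ β) (hlam : 0 ≤ lam) {U : Finset Site}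
    (hU : connectedIn ((↑U : Set Site)ᶜ)) (m : ℕ) (κ p c : ℝ≥0∞)
    (hp : ∑ n ∈ range (m + 1), p * ex (4 * β * n) ≤ 1) (hκ1 : κ ≤ 1)
    (hκ : 1 ≤ κ * (1 + ex (-(4 * β)) * p)) (hc : κ * ex lam = c)
    (hw : ∀ v ∈ U, c + ∑ γ ∈ (Cls U).filter (fun γ => v ∈ γ),
      (1 - κ ^ γ.card) * ex (-β * per E γ) ≤ 1) :
    ZS E β lam U mi (m : ℤ) ≤ ZS E β lam U mi ((m + 1 : ℕ) : ℤ) := by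
  set ε : ℝ≥0∞ := ex (-(4 * β)) with hε
  let Γ : Conf → Finset (Finset Site) := fun φ => Gam U {v | φ v ≤ (m:ℤ)}
  let A : Conf → Finset Site := fun φ => U \ Un (Γ φ)
  let g : Finset (Finset Site) → Conf → ℝ≥0∞ := fun M φ =>
    ind (φ ∈ signedConfigs U mi m ∧ M ⊆ Γ φ)
  have hQ : ∀ φ : Conf, (∀ v, v ∉ U → φ v = (m:ℤ)) → ∀ v, v ∉ U → v ∈ {v | φ v ≤ (m:ℤ)} :=
    fun φ hφ v hv => (hφ v hv).le
  -- step 1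
  have s1 : ZS E β lam U mi (m : ℤ) ≤ Zr E β lam U m (fun φ => ∑ M ∈ Fam U,
      ((∏ γ ∈ M, (1 - κ ^ γ.card)) * κ ^ (U \ Un M).card) *
        (g M φ * (1 + ε * p) ^ (A φ).card)) := by
    refine Zr_mono (fun φ hφ => ?_)
    by_cases hΩ : φ ∈ signedConfigs U mi m
    swap
    · rw [ind_neg hΩ]; exact zero_le
    rw [ind_pos hΩ]
    have hΓU : ∀ γ ∈ Γ φ, γ ⊆ U := fun γ hγ => (mem_Cls.1 (Gam_sub_Cls (hQ φ hφ) hU hγ)).1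
    have h1 : (1 : ℝ≥0∞) = ∏ γ ∈ Γ φ, ((1 - κ ^ γ.card) + κ ^ γ.card) := by
      rw [Finset.prod_congr rfl (fun γ _ => tsub_add_cancel_of_le (pow_le_one' hκ1 _))]
      simp
    rw [Finset.prod_add] at h1
    refine h1.le.trans ?_
    have hsub : (Γ φ).powerset ⊆ Fam U := fun M hM =>
      sub_Gam_Fam (hQ φ hφ) hU (Finset.mem_powerset.1 hM)
    refine le_trans (Finset.sum_le_sum (fun M hM => ?_))
      (Finset.sum_le_sum_of_subset hsub)
    rw [Finset.mem_powerset] at hM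
    have hg : g M φ = 1 := ind_pos ⟨hΩ, hM⟩
    rw [hg, one_mul, mul_assoc]
    gcongr
    have hcard : (U \ Un M).card = (A φ).card + ∑ γ ∈ Γ φ \ M, γ.card := by
      have e1 : (Un (Γ φ)).card = _ := card_Un (Gam_disjoint (U := U) (Q := {v | φ v ≤ (m:ℤ)}))
      have e2 := card_Un (M := M) (fun γ hγ γ' hγ' => Gam_disjoint γ (hM hγ) γ' (hM hγ'))
      have u1 : Un (Γ φ) ⊆ U := by
        intro v hv; obtain ⟨γ, hγ, h⟩ := mem_Un.1 hv; exact hΓU γ hγ h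
      have u2 : Un M ⊆ U := by
        intro v hv; obtain ⟨γ, hγ, h⟩ := mem_Un.1 hv; exact hΓU γ (hM hγ) h
      have e3 := Finset.sum_sdiff (f := fun γ : Finset Site => γ.card) hM
      have c1 := Finset.card_le_card u1
      have c2 := Finset.card_le_card u2
      simp only [A]
      rw [Finset.card_sdiff_of_subset u1, Finset.card_sdiff_of_subset u2]
      change _ = ∑ γ ∈ Γ φ, γ.card at e1
      omega
    rw [Finset.prod_pow_eq_pow_sum, hcard, pow_add]
    calc κ ^ ∑ γ ∈ Γ φ \ M, γ.card = 1 ^ (A φ).card * κ ^ ∑ γ ∈ Γ φ \ M, γ.card := by simp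
      _ ≤ (κ * (1 + ε * p)) ^ (A φ).card * κ ^ ∑ γ ∈ Γ φ \ M, γ.card := by gcongr
      _ = _ := by rw [mul_pow]; ring
  -- step 2
  have s2 : ∀ M, Zr E β lam U m (fun φ => g M φ * (1 + ε * p) ^ (A φ).card) ≤
      Zr E β lam U m (fun φ => g M φ * ∏ v ∈ A φ, (1 + ε * ind (φ v = 0))) := by
    intro M
    refine gain hβ hlam m p ε hp (g M) A (fun φ hφ hne => ⟨Finset.sdiff_subset, fun v hv => ?_⟩)
    obtain ⟨⟨h1, h2, h3⟩, hM⟩ := ind_ne_zero.1 hne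
    rw [Finset.mem_sdiff] at hv
    have hvE : v ∈ Ext U {v | φ v ≤ (m:ℤ)} := by
      by_contra h
      obtain ⟨γ, hγ, h'⟩ := Gam_cover h
      exact hv.2 (mem_Un.2 ⟨γ, hγ, h'⟩)
    have hvm : φ v ≤ m := Ext_sub (hQ φ hφ) hvE
    have hset : {w | Function.update φ v 0 w ≤ (m:ℤ)} = {w | φ w ≤ (m:ℤ)} := by
      ext w
      by_cases hw : w = v
      · subst hw
        simp only [Set.mem_ofPred_eq, Function.update_self]
        exact ⟨fun _ => hvm, fun _ => by positivity⟩
      · simp [hw]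
    have hΓ : Γ (Function.update φ v 0) = Γ φ := by simp only [Γ, hset]
    refine ⟨h2 v hv.1, hvm, ?_, ?_⟩
    · refine ind_mono (fun _ => ⟨⟨fun w hw => ?_, fun w hw => ?_, fun w hw => ?_⟩, ?_⟩)
      · have : w ≠ v := fun h => hw (h ▸ hv.1)
        simp [this, hφ w hw]
      · by_cases hwv : w = v
        · subst hwv; simp
        · simp [hwv, h2 w hw]
      · change Function.update φ v 0 w ≤ (m:ℤ)
        by_cases hwv : w = v
        · subst hwv; simp
        · have : φ w ≤ m := h3 w hw
          simp [hwv, this]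
      · rw [hΓ]; exact hM
    · simp only [A, hΓ]
  -- step 3
  have s3 : ∀ M ∈ Fam U, Zr E β lam U m (fun φ => g M φ * ∏ v ∈ A φ, (1 + ε * ind (φ v = 0))) ≤
      ((∏ γ ∈ M, ex (-β * per E γ)) * ex lam ^ (U \ Un M).card) *
        ZS E β lam U mi ((m + 1 : ℕ) : ℤ) := by
    intro M hM
    have a1 : Zr E β lam U m (fun φ => g M φ * ∏ v ∈ A φ, (1 + ε * ind (φ v = 0))) ≤
        Zr E β lam U m (fun φ => ∑ S ∈ (U \ Un M).powerset, ε ^ S.card *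
          ind ((φ ∈ signedConfigs U mi m ∧ M ⊆ Γ φ) ∧ ∀ v ∈ S, φ v = 0)) := by
      refine Zr_mono (fun φ hφ => ?_)
      by_cases hg : φ ∈ signedConfigs U mi m ∧ M ⊆ Γ φ
      swap
      · simp [g, ind_neg hg]
      simp only [g, ind_pos hg, one_mul]
      rw [Finset.prod_one_add]
      have hsub : A φ ⊆ U \ Un M := by
        refine Finset.sdiff_subset_sdiff subset_rfl ?_
        intro v hv
        obtain ⟨γ, hγ, h⟩ := mem_Un.1 hv
        exact mem_Un.2 ⟨γ, hg.2 hγ, h⟩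
      refine le_trans (Finset.sum_le_sum (fun S hS => ?_))
        (Finset.sum_le_sum_of_subset (Finset.powerset_mono.2 hsub))
      rw [Finset.prod_mul_distrib, Finset.prod_const]
      gcongr
      by_cases h0 : ∀ v ∈ S, φ v = 0
      · rw [ind_pos ⟨hg, h0⟩]
        exact Finset.prod_le_one' (fun v _ => ind_le_one _)
      · push Not at h0
        obtain ⟨v, hv, h⟩ := h0
        rw [Finset.prod_eq_zero hv (ind_neg h)]; exact zero_le
    refine a1.trans ?_
    rw [Zr_sum]
    have a2 : ∀ S ∈ (U \ Un M).powerset, Zr E β lam U m (fun φ => ε ^ S.card *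
          ind ((φ ∈ signedConfigs U mi m ∧ M ⊆ Γ φ) ∧ ∀ v ∈ S, φ v = 0)) ≤
        ((∏ γ ∈ M, ex (-β * per E γ)) * ex lam ^ (U \ Un M).card) *
          Zr E β lam U ((m + 1 : ℕ) : ℤ) (fun ψ => ind (ψ ∈ signedConfigs U mi ((m + 1 : ℕ) : ℤ)) *
            ind ((U \ Un M).filter (fun v => ψ v = 0) = S)) := by
      intro S hS
      rw [Zr_mul]
      have := shift_up_DS (E := E) hβ hlam hU m M hM S (Finset.mem_powerset.1 hS)
      refine (mul_le_mul_right this _).trans (le_of_eq ?_)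
      have hεe : ε * ex (4 * β) = 1 := by rw [hε, ← ex_add]; simp [ex_zero]
      calc _ = (ε * ex (4 * β)) ^ S.card * (((∏ γ ∈ M, ex (-β * per E γ)) *
            ex lam ^ (U \ Un M).card) * Zr E β lam U ((m + 1 : ℕ) : ℤ)
              (fun ψ => ind (ψ ∈ signedConfigs U mi ((m + 1 : ℕ) : ℤ)) *
            ind ((U \ Un M).filter (fun v => ψ v = 0) = S))) := by rw [mul_pow]; ring
        _ = _ := by rw [hεe]; simp
    refine (Finset.sum_le_sum a2).trans ?_
    rw [← Finset.mul_sum, ← Zr_sum]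
    gcongr
    refine Zr_mono (fun ψ _ => ?_)
    rw [← Finset.mul_sum]
    refine (mul_le_mul_right (?_ : _ ≤ (1:ℝ≥0∞)) _).trans (mul_one _).le
    rw [Finset.sum_eq_single ((U \ Un M).filter (fun v => ψ v = 0))]
    · exact ind_le_one _
    · intro S _ hne
      exact ind_neg (fun h => hne h.symm)
    · intro h
      exact absurd (Finset.mem_powerset.2 (Finset.filter_subset _ _)) h
  -- conclusion
  calc ZS E β lam U mi (m : ℤ) ≤ _ := s1
    _ = ∑ M ∈ Fam U, ((∏ γ ∈ M, (1 - κ ^ γ.card)) * κ ^ (U \ Un M).card) *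
        Zr E β lam U m (fun φ => g M φ * (1 + ε * p) ^ (A φ).card) := by
        rw [Zr_sum]; exact Finset.sum_congr rfl (fun M _ => Zr_mul _ _)
    _ ≤ ∑ M ∈ Fam U, ((∏ γ ∈ M, (1 - κ ^ γ.card)) * κ ^ (U \ Un M).card) *
        (((∏ γ ∈ M, ex (-β * per E γ)) * ex lam ^ (U \ Un M).card) *
        ZS E β lam U mi ((m + 1 : ℕ) : ℤ)) :=
        Finset.sum_le_sum (fun M hM => mul_le_mul_right ((s2 M).trans (s3 M hM)) _)
    _ = (∑ M ∈ Fam U, (∏ γ ∈ M, (1 - κ ^ γ.card) * ex (-β * per E γ)) * c ^ (U \ Un M).card) *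
        ZS E β lam U mi ((m + 1 : ℕ) : ℤ) := by
        rw [Finset.sum_mul]
        refine Finset.sum_congr rfl (fun M _ => ?_)
        rw [Finset.prod_mul_distrib, ← hc, mul_pow]; ring
    _ ≤ 1 * ZS E β lam U mi ((m + 1 : ℕ) : ℤ) := by
        gcongr
        exact family _ c U hw _ U rfl subset_rfl
    _ = _ := one_mul _

end
end SOS


set_option linter.unusedVariables false
set_option linter.unusedSectionVars false
namespace SOS
noncomputable section
open scoped Classical ENNReal
open Finset

lemma t_small {β : ℝ} (hβ : 1000 ≤ β) : 2 ^ 200 * Real.exp (-β) ≤ 1 := by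
  have h1 : (2:ℝ) ≤ Real.exp 1 := by have := Real.add_one_le_exp (1:ℝ); linarith
  have h2 : (2:ℝ) ^ 200 ≤ Real.exp β := by
    calc (2:ℝ) ^ 200 ≤ Real.exp 1 ^ 200 := pow_le_pow_left₀ (by norm_num) h1 _
      _ = Real.exp 200 := by rw [← Real.exp_nat_mul]; norm_num
      _ ≤ _ := Real.exp_le_exp.2 (by linarith)
  calc 2 ^ 200 * Real.exp (-β) ≤ Real.exp β * Real.exp (-β) := by gcongr
    _ = 1 := by rw [← Real.exp_add]; simp

lemma t_le {β : ℝ} (hβ : 1000 ≤ β) : Real.exp (-β) ≤ 1 / 2 ^ 200 := by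
  rw [le_div_iff₀ (by positivity)]; linarith [t_small hβ]

lemma ex_per (β : ℝ) (n : ℕ) : ex (-β * n) = ENNReal.ofReal (Real.exp (-β) ^ n) := by
  rw [ex, ← Real.exp_nat_mul, mul_comm]

lemma sum_toENN {ι : Type*} (S : Finset ι) (f : ι → ℕ) (g : ι → ℕ) {β : ℝ} :
    ∑ γ ∈ S, (f γ : ℝ≥0∞) * ex (-β * g γ) =
      ENNReal.ofReal (∑ γ ∈ S, (f γ : ℝ) * Real.exp (-β) ^ g γ) := by
  rw [ENNReal.ofReal_sum_of_nonneg (fun i _ => by positivity)]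
  refine Finset.sum_congr rfl (fun γ _ => ?_)
  rw [ENNReal.ofReal_mul (by positivity), ex_per, ENNReal.ofReal_natCast]

lemma sumA {E : Finset Edge} {U : Finset Site} (hE : Good E U) {β : ℝ} (hβ : 1000 ≤ β) (v : Site) :
    ∑ γ ∈ (Cls U).filter (fun γ => v ∈ γ), (γ.card : ℝ≥0∞) * ex (-β * per E γ) ≤
      ENNReal.ofReal (2 ^ 84 * Real.exp (-β) ^ 4) := by
  rw [sum_toENN]
  refine ENNReal.ofReal_le_ofReal ?_
  have := entropy_pow hE v (Real.exp (-β)) (by positivity) (by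
    have := t_le hβ
    have h2 : (2:ℝ) ^ 21 * (1 / 2 ^ 200) ≤ 1 := by norm_num
    nlinarith) 4 _ subset_rfl (fun γ hγ => by
      rw [Finset.mem_filter, mem_Cls] at hγ
      exact per_ge_four (hE.mono hγ.1.1) hγ.1.2.1)
  refine this.trans (le_of_eq ?_)
  ring

lemma sumB {E : Finset Edge} {U : Finset Site} (hE : Good E U) {β : ℝ} (hβ : 1000 ≤ β) (v : Site) :
    ∑ γ ∈ (Cls U).filter (fun γ => v ∈ γ ∧ 2 ≤ γ.card), ex (-β * per E γ) ≤
      ENNReal.ofReal (2 ^ 126 * Real.exp (-β) ^ 6) := by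
  have h1 : ∑ γ ∈ (Cls U).filter (fun γ => v ∈ γ ∧ 2 ≤ γ.card), ex (-β * per E γ) ≤
      ∑ γ ∈ (Cls U).filter (fun γ => v ∈ γ ∧ 2 ≤ γ.card), (γ.card : ℝ≥0∞) * ex (-β * per E γ) := by
    refine Finset.sum_le_sum (fun γ hγ => ?_)
    rw [Finset.mem_filter] at hγ
    refine le_mul_of_one_le_left' ?_
    have : 1 ≤ γ.card := by omega
    exact_mod_cast this
  refine h1.trans ?_
  rw [sum_toENN]
  refine ENNReal.ofReal_le_ofReal ?_
  have := entropy_pow hE v (Real.exp (-β)) (by positivity) (by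
    have := t_le hβ
    have h2 : (2:ℝ) ^ 21 * (1 / 2 ^ 200) ≤ 1 := by norm_num
    nlinarith) 6 ((Cls U).filter (fun γ => v ∈ γ ∧ 2 ≤ γ.card)) (fun γ hγ => by
      rw [Finset.mem_filter] at hγ ⊢; exact ⟨hγ.1, hγ.2.1⟩) (fun γ hγ => by
      rw [Finset.mem_filter, mem_Cls] at hγ
      exact per_ge_six (hE.mono hγ.1.1) hγ.2.2)
  refine this.trans (le_of_eq ?_)
  ring

/-- splitting off the singleton -/
lemma sum_split {E : Finset Edge} {U : Finset Site} (hE : Good E U) {β : ℝ} (hβ : 1000 ≤ β)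
    (v : Site) (q₁ q₂ : ℝ≥0∞) (q : Finset Site → ℝ≥0∞) (h1 : q {v} ≤ q₁)
    (h2 : ∀ γ ∈ Cls U, v ∈ γ → 2 ≤ γ.card → q γ ≤ q₂) (hv : v ∈ U) :
    ∑ γ ∈ (Cls U).filter (fun γ => v ∈ γ), q γ * ex (-β * per E γ) ≤
      q₁ * ENNReal.ofReal (Real.exp (-β) ^ 4) +
        q₂ * ENNReal.ofReal (2 ^ 126 * Real.exp (-β) ^ 6) := by
  have hsub : (Cls U).filter (fun γ => v ∈ γ) ⊆
      insert {v} ((Cls U).filter (fun γ => v ∈ γ ∧ 2 ≤ γ.card)) := by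
    intro γ hγ
    rw [Finset.mem_filter] at hγ
    rw [Finset.mem_insert, Finset.mem_filter]
    by_cases h : 2 ≤ γ.card
    · exact Or.inr ⟨hγ.1, hγ.2, h⟩
    · left
      have : γ.card ≤ 1 := by omega
      exact (Finset.eq_of_subset_of_card_le (Finset.singleton_subset_iff.2 hγ.2) (by simpa)).symm
  refine (Finset.sum_le_sum_of_subset hsub).trans ?_
  rw [Finset.sum_insert (by simp)]
  have hEv : Good E {v} := hE.mono (by simpa using hv)
  gcongr ?_ + ?_
  · rw [per_singleton hEv, ex_per]; gcongr
  · calc _ ≤ ∑ γ ∈ (Cls U).filter (fun γ => v ∈ γ ∧ 2 ≤ γ.card), q₂ * ex (-β * per E γ) := by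
          refine Finset.sum_le_sum (fun γ hγ => ?_)
          rw [Finset.mem_filter] at hγ
          have := h2 γ hγ.1 hγ.2.1 hγ.2.2
          gcongr
      _ ≤ _ := by
        rw [← Finset.mul_sum]; gcongr; exact sumB hE hβ v

lemma geo_le (y : ℝ) (hy : 2 ≤ y) (m : ℕ) : ∑ n ∈ range (m + 1), y ^ n ≤ 2 * y ^ m := by
  induction m with
  | zero => simp
  | succ m ih =>
    rw [Finset.sum_range_succ, pow_succ]
    have : 0 ≤ y ^ m := by positivity
    nlinarith

lemma exp_neg_le {g : ℝ} (h0 : 0 ≤ g) (h1 : g ≤ 1) : Real.exp (-g) ≤ 1 - g / 2 := by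
  have h := Real.add_one_le_exp g
  have hp := Real.exp_pos g
  rw [Real.exp_neg, inv_le_iff_one_le_mul₀ hp]
  nlinarith

lemma Dlem {E : Finset Edge} {β lam : ℝ} {h : ℕ} (hβ : 1000 ≤ β) (hlam : 0 < lam)
    (hl : lam ≤ Real.exp (-β) ^ (4 * h + 1)) {U : Finset Site} (hE : Good E U)
    (hU : connectedIn ((↑U : Set Site)ᶜ)) (m : ℕ) (hm : m + 1 ≤ h) :
    ZS E β lam U mi (m : ℤ) ≤ ZS E β lam U mi ((m + 1 : ℕ) : ℤ) := by
  set t := Real.exp (-β) with ht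
  have t0 : 0 < t := Real.exp_pos _
  have tle : t ≤ 1 / 2 ^ 200 := t_le hβ
  have t8 : t ≤ 1 / 8 := tle.trans (by norm_num)
  set θ := t ^ (4 * (m + 1)) with hθ
  have θ0 : 0 < θ := by positivity
  have θ1 : θ ≤ 1 := pow_le_one₀ t0.le (by linarith)
  have lθ : lam ≤ θ / 8 := by
    calc lam ≤ _ := hl
      _ ≤ t ^ (4 * (m + 1) + 1) := pow_le_pow_of_le_one t0.le (by linarith) (by omega)
      _ = θ * t := pow_succ _ _
      _ ≤ _ := by nlinarith
  have hy : Real.exp (4 * β) = (t ^ 4)⁻¹ := by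
    rw [ht, ← Real.exp_nat_mul, ← Real.exp_neg]; congr 1; push_cast; ring
  have hy2 : (2:ℝ) ≤ Real.exp (4 * β) := by
    have := Real.add_one_le_exp (4 * β); linarith
  have ht4 : Real.exp (-(4 * β)) = t ^ 4 := by
    rw [ht, ← Real.exp_nat_mul]; congr 1; push_cast; ring
  set x := θ / 8 + lam with hx
  have x0 : 0 < x := by positivity
  have x2 : x ≤ θ / 4 := by linarith
  refine Dstep (by linarith) hlam.le hU m (ex (-x)) (ENNReal.ofReal (t ^ (4 * m) / 2)) (ex (-(θ/8)))
    ?_ (ex_le_one (by linarith)) ?_ (by rw [← ex_add]; congr 1; rw [hx]; ring) ?_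
  · have : ∀ n ∈ range (m + 1), ENNReal.ofReal (t ^ (4 * m) / 2) * ex (4 * β * n) =
        ENNReal.ofReal (t ^ (4 * m) / 2 * Real.exp (4 * β) ^ n) := by
      intro n _
      rw [ex, ← Real.exp_nat_mul (4 * β), ← ENNReal.ofReal_mul (by positivity), mul_comm (n:ℝ)]
    rw [Finset.sum_congr rfl this, ← ENNReal.ofReal_sum_of_nonneg (fun i _ => by positivity),
      ← Finset.mul_sum]
    have hg := geo_le _ hy2 m
    refine ENNReal.ofReal_le_one.2 ?_
    calc t ^ (4 * m) / 2 * ∑ n ∈ range (m + 1), Real.exp (4 * β) ^ n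
        ≤ t ^ (4 * m) / 2 * (2 * Real.exp (4 * β) ^ m) := by gcongr
      _ = 1 := by rw [hy, pow_mul, inv_pow]; field_simp
  · rw [ex, ex, ht4, ← ENNReal.ofReal_mul (by positivity), ← ENNReal.ofReal_one,
      ← ENNReal.ofReal_add (by positivity) (by positivity),
      ← ENNReal.ofReal_mul (by positivity)]
    refine ENNReal.ofReal_le_ofReal ?_
    have e : t ^ 4 * (t ^ (4 * m) / 2) = θ / 2 := by rw [hθ]; ring
    rw [e]
    have h1 := Real.add_one_le_exp (-x)
    have h2 : 1 - θ / 4 ≤ Real.exp (-x) := by linarith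
    calc (1:ℝ) ≤ (1 - θ / 4) * (1 + θ / 2) := by nlinarith
      _ ≤ _ := by gcongr
  · intro v hv
    have h1 : ∑ γ ∈ (Cls U).filter (fun γ => v ∈ γ), (1 - ex (-x) ^ γ.card) * ex (-β * per E γ) ≤
        ENNReal.ofReal (x * (2 ^ 84 * t ^ 4)) := by
      rw [ENNReal.ofReal_mul x0.le]
      refine le_trans ?_ (mul_le_mul_right (sumA hE hβ v) _)
      rw [Finset.mul_sum]
      refine Finset.sum_le_sum (fun γ _ => ?_)
      rw [← mul_assoc]
      gcongr
      rw [tsub_le_iff_right, ← ex_nat_mul, ← ENNReal.ofReal_natCast, ex,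
        ← ENNReal.ofReal_mul x0.le, ← ENNReal.ofReal_add (by positivity) (by positivity),
        ← ENNReal.ofReal_one]
      refine ENNReal.ofReal_le_ofReal ?_
      have := Real.add_one_le_exp ((γ.card:ℝ) * (-x))
      linarith
    refine (add_le_add_right h1 _).trans ?_
    rw [ex, ← ENNReal.ofReal_add (by positivity) (by positivity), ENNReal.ofReal_le_one]
    have h2 := exp_neg_le (g := θ / 8) (by positivity) (by linarith)
    have h3 : 2 ^ 84 * t ^ 4 ≤ 1 / 4 := by
      calc 2 ^ 84 * t ^ 4 ≤ 2 ^ 84 * (1 / 2 ^ 200) ^ 4 := by gcongr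
        _ ≤ _ := by norm_num
    have : x * (2 ^ 84 * t ^ 4) ≤ (θ / 4) * (1 / 4) := by gcongr
    linarith

end
end SOS


set_option linter.unusedVariables false
set_option linter.unusedSectionVars false
namespace SOS
noncomputable section
open scoped Classical ENNReal
open Finset

lemma HE_cst (E : Finset Edge) (a : ℤ) : HE E (cst a) = 0 := by simp [HE, cst]

lemma exp_half {x : ℝ} (hx : x ≤ 1 / 2) : Real.exp x ≤ 2 := by
  have h := Real.add_one_le_exp (-x)
  rw [Real.exp_neg] at h
  have hp := Real.exp_pos x
  have h2 : (1/2 : ℝ) ≤ (Real.exp x)⁻¹ := by linarith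
  have h3 : (1/2 : ℝ) * Real.exp x ≤ 1 := by
    calc (1/2 : ℝ) * Real.exp x ≤ (Real.exp x)⁻¹ * Real.exp x := by gcongr
      _ = 1 := inv_mul_cancel₀ hp.ne'
  linarith

lemma lam_h {β lam : ℝ} {h : ℕ} (hβ : 1000 ≤ β) 
    (hl : lam ≤ Real.exp (-β) ^ (4 * h + 1)) : lam * h ≤ 1 / 2 := by
  set t := Real.exp (-β) with ht
  have t0 : 0 < t := Real.exp_pos _
  have tle : t ≤ 1 / 2 := (t_le hβ).trans (by norm_num)
  have hh : (h:ℝ) ≤ 2 ^ h := by exact_mod_cast (Nat.lt_two_pow_self (n := h)).le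
  have h1 : lam ≤ t ^ (h + 1) := hl.trans (pow_le_pow_of_le_one t0.le (by linarith) (by omega))
  calc lam * h ≤ t ^ (h + 1) * 2 ^ h := by gcongr
    _ = (t * 2) ^ h * t := by rw [mul_pow, pow_succ]; ring
    _ ≤ 1 * t := by gcongr; exact pow_le_one₀ (by positivity) (by linarith)
    _ ≤ _ := by linarith

lemma zero_single {E : Finset Edge} {β lam : ℝ} {h : ℕ} (hβ : 1000 ≤ β) (hlam : 0 < lam)
    (hl : lam ≤ Real.exp (-β) ^ (4 * h + 1)) {v : Site} (hE : Good E {v}) (j : ℕ) (hj : j + 1 ≤ h) :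
    ZA E β lam {v} mi (j:ℤ) v {0} ≤
      ENNReal.ofReal (2 * Real.exp (-β) ^ (4 * j)) * ZS E β lam {v} mi ((j:ℤ) + 1) := by
  refine Zr_shift (fun w => if w = v then (j:ℤ) + 1 else 1) _ _ _ ?_ ?_
  · intro w hw
    have : w ≠ v := by simpa using hw
    simp [this]
  · intro φ hφ hne
    obtain ⟨-, h0⟩ := ind_ne_zero.1 hne
    have h0 : φ v = 0 := h0
    have e1 : φ = glue {v} (cst 0) (cst j) := by
      funext w
      by_cases hw : w = v
      · subst hw; simp [glue, cst, h0]
      · simp [glue, cst, hw, hφ w (by simpa using hw)]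
    have e2 : (φ + fun w => if w = v then (j:ℤ) + 1 else 1) = cst ((j:ℤ) + 1) := by
      funext w
      by_cases hw : w = v
      · subst hw; simp [cst, h0]
      · simp [cst, hw, hφ w (by simpa using hw)]
    rw [e2]
    constructor
    · refine (ind_le_one _).trans ?_
      rw [ind_pos]
      refine ⟨fun _ _ => rfl, fun _ _ => ?_, fun _ _ => ?_⟩
      · simp only [cst]; positivity
      · change cst ((j:ℤ)+1) _ ≤ (j:ℤ) + 1
        exact le_rfl
    · have hH : HE E φ = 4 * j := by
        have := HE_level (E := E) (γ := {v}) (φ := cst j) (a := 0) (b := j) (by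
          intro u _ w _ _; simp [cst])
        rw [← e1] at this
        have e3 : glue {v} (cst j) (cst (j:ℤ)) = cst (j:ℤ) := by
          funext w; simp [glue]
        rw [e3, HE_cst, per_singleton hE] at this
        rw [this]; simp; ring
      have hle : ex (-(4 * β * j) + lam * (j + 1)) ≤ ENNReal.ofReal (2 * Real.exp (-β) ^ (4 * j)) := by
        refine ENNReal.ofReal_le_ofReal ?_
        rw [Real.exp_add, mul_comm]
        gcongr
        · refine exp_half ?_
          have := lam_h hβ hl
          have h2 : ((j:ℝ) + 1) ≤ h := by exact_mod_cast hj
          nlinarith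
        · rw [← Real.exp_nat_mul]
          refine Real.exp_le_exp.2 (le_of_eq ?_)
          push_cast; ring
      refine (wt_le (-(4 * β * j) + lam * (j + 1)) (le_of_eq ?_)).trans (mul_le_mul_left hle _)
      rw [hH, HE_cst]
      simp only [sosField, Finset.sum_singleton, h0, cst]
      push_cast; ring

lemma zero_lem {E : Finset Edge} {β lam : ℝ} {h : ℕ} (hβ : 1000 ≤ β) (hlam : 0 < lam)
    (hl : lam ≤ Real.exp (-β) ^ (4 * h + 1)) (j : ℕ) : j ≤ h → ∀ {U : Finset Site}, Good E U →
    connectedIn ((↑U : Set Site)ᶜ) → ∀ (k : ℤ), (j:ℤ) ≤ k → ∀ (η : Site → BSign) (v : Site), v ∈ U →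
    ZA E β lam U η k v {0} ≤
      ENNReal.ofReal (3 * Real.exp (-β) ^ (4 * j)) * ZS E β lam U η k := by
  set t := Real.exp (-β) with ht
  have t0 : 0 < t := Real.exp_pos _
  induction j with
  | zero =>
    intro _ U hE hU k _ η v _
    have h1 : ZA E β lam U η k v {0} ≤ ZS E β lam U η k :=
      Zr_mono (fun φ _ => ind_mono (fun h => h.1))
    refine h1.trans (le_mul_of_one_le_left' ?_)
    simp
  | succ j ih =>
    intro hj U hE hU k hk η v hv
    have h1 := step_down (E := E) (β := β) (lam := lam) hU hk η v {0} (by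
      intro a ha; rw [ha]; push_cast; simp)
      (fun γ => if γ = {v} then ENNReal.ofReal (2 * t ^ (4 * j)) else
        ENNReal.ofReal (3 * t ^ (4 * j))) (by
      intro γ hγ hvγ
      have e : ((j + 1 : ℕ) : ℤ) - 1 = j := by push_cast; ring
      rw [e]
      obtain ⟨c1, c2, c3, c4⟩ := mem_Cls.1 hγ
      split_ifs with hs
      · subst hs
        have := zero_single hβ hlam hl (hE.mono c1) j hj
        push_cast; exact this
      · refine (ih (by omega) (hE.mono c1) c4 j le_rfl mi v hvγ).trans ?_
        gcongr
        exact Dlem hβ hlam hl (hE.mono c1) c4 j hj)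
    refine h1.trans ?_
    gcongr
    refine (sum_split hE hβ v _ (ENNReal.ofReal (3 * t ^ (4 * j))) _ (by rw [if_pos rfl]) ?_ hv).trans ?_
    · intro γ _ _ hc
      rw [if_neg]
      rintro rfl
      simp at hc
    · rw [← ENNReal.ofReal_mul (by positivity), ← ENNReal.ofReal_mul (by positivity),
        ← ENNReal.ofReal_add (by positivity) (by positivity)]
      refine ENNReal.ofReal_le_ofReal ?_
      have h3 : 3 * 2 ^ 126 * t ^ 2 ≤ 1 := by
        calc 3 * 2 ^ 126 * t ^ 2 ≤ 3 * 2 ^ 126 * (1 / 2 ^ 200) ^ 2 := by gcongr; exact t_le hβ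
          _ ≤ 1 := by norm_num
      have e : t ^ (4 * (j + 1)) = t ^ (4 * j) * t ^ 4 := by ring
      rw [e]
      have h4 : 0 ≤ t ^ (4 * j) * t ^ 4 := by positivity
      calc _ = t ^ (4 * j) * t ^ 4 * (2 + 3 * 2 ^ 126 * t ^ 2) := by ring
        _ ≤ t ^ (4 * j) * t ^ 4 * 3 := by gcongr; linarith
        _ = _ := by ring

end
end SOS


set_option linter.unusedVariables false
set_option linter.unusedSectionVars false
namespace SOS
noncomputable section
open scoped Classical ENNReal
open Finset

/-- contours of level `k` with a zero inside -/
def PM (k : ℤ) (M : Finset (Finset Site)) (ψ : Conf) : Prop :=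
  ∀ γ ∈ M, (∀ v ∈ innerBdry γ, ψ v ≤ k) ∧ (∃ v ∈ γ, ψ v = 0) ∧
    ∀ u ∈ γ, ∀ w, w ∉ γ → adjS u w → k ≤ ψ w

/-- non adjacency -/
def NA (M : Finset (Finset Site)) : Prop :=
  ∀ γ ∈ M, ∀ u ∈ γ, ∀ w, w ∉ γ → adjS u w → ∀ γ' ∈ M, w ∉ γ'

lemma NA.mono {M M' : Finset (Finset Site)} (h : NA M') (hs : M ⊆ M') : NA M :=
  fun γ hγ u hu w hw ha γ' hγ' => h γ (hs hγ) u hu w hw ha γ' (hs hγ')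

lemma PM_congr {k : ℤ} {M : Finset (Finset Site)} {γ : Finset Site} (hγ : γ ∉ M)
    (hd : ∀ γ₁ ∈ insert γ M, ∀ γ₂ ∈ insert γ M, γ₁ ≠ γ₂ → Disjoint γ₁ γ₂)
    (hN : NA (insert γ M)) {φ ψ : Conf} (h : ∀ v, v ∉ γ → φ v = ψ v) (hφ : PM k M φ) :
    PM k M ψ := by
  intro γ' hγ'
  obtain ⟨h1, ⟨z, hz, hz0⟩, h3⟩ := hφ γ' hγ'
  have hne : γ' ≠ γ := fun e => hγ (e ▸ hγ')
  have hdis : ∀ v ∈ γ', v ∉ γ := fun v hv hv' =>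
    (Finset.disjoint_left.1 (hd γ' (mem_insert_of_mem hγ') γ (mem_insert_self _ _) hne)) hv hv'
  refine ⟨fun v hv => ?_, ⟨z, hz, ?_⟩, fun u hu w hw ha => ?_⟩
  · rw [← h v (hdis v (mem_innerBdry.1 hv).1)]; exact h1 v hv
  · rw [← h z (hdis z hz)]; exact hz0
  · rw [← h w (hN γ' (mem_insert_of_mem hγ') u hu w hw ha γ (mem_insert_self _ _))]
    exact h3 u hu w hw ha

lemma abs_split {a b k : ℤ} (h1 : a ≤ k) (h2 : k ≤ b) : |a - b| = |a - k| + |k - b| := by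
  rw [abs_of_nonpos (by omega : a - b ≤ 0), abs_of_nonpos (by omega : a - k ≤ 0),
    abs_of_nonpos (by omega : k - b ≤ 0)]; ring

/-- removing zeros from contours one by one -/
lemma remove_all {E : Finset Edge} {β lam : ℝ} {U : Finset Site} (k : ℤ) (q : Finset Site → ℝ≥0∞)
    (hq : ∀ γ ∈ Cls U, Zr E β lam γ k (fun ξ => ind (ξ ∈ signedConfigs γ mi k ∧ ∃ v ∈ γ, ξ v = 0)) ≤
      q γ * ZS E β lam γ mi k) (M : Finset (Finset Site)) :
    (∀ γ₁ ∈ M, ∀ γ₂ ∈ M, γ₁ ≠ γ₂ → Disjoint γ₁ γ₂) → NA M → (∀ γ ∈ M, γ ∈ Cls U) →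
    (∀ γ ∈ M, ∀ v ∈ innerBdry U, v ∉ γ) →
    Zr E β lam U k (fun φ => ind (φ ∈ signedConfigs U pl k ∧ PM k M φ)) ≤
      (∏ γ ∈ M, q γ) * ZS E β lam U pl k := by
  induction M using Finset.induction with
  | empty =>
    intro _ _ _ _
    rw [Finset.prod_empty, one_mul]
    exact Zr_mono (fun φ _ => ind_mono (fun h => h.1))
  | insert γ M hγM ih =>
    intro hd hN hC hB
    have hsub : M ⊆ insert γ M := Finset.subset_insert _ _
    have ih' := ih (fun γ₁ h₁ γ₂ h₂ => hd γ₁ (hsub h₁) γ₂ (hsub h₂)) (hN.mono hsub)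
      (fun γ' h => hC γ' (hsub h)) (fun γ' h => hB γ' (hsub h))
    have hγC := hC γ (mem_insert_self _ _)
    have hγU : γ ⊆ U := (mem_Cls.1 hγC).1
    have hγB := hB γ (mem_insert_self _ _)
    let eP : Conf → Prop := fun φ => ((∀ v ∈ U, v ∉ γ → 0 ≤ φ v) ∧
      (∀ v ∈ innerBdry U, k ≤ φ v)) ∧ (∀ u ∈ γ, ∀ w, w ∉ γ → adjS u w → k ≤ φ w) ∧ PM k M φ
    have heP : ∀ φ ψ : Conf, (∀ v, v ∉ γ → φ v = ψ v) → eP φ → eP ψ := by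
      rintro φ ψ h ⟨⟨h1, h2⟩, h3, h4⟩
      refine ⟨⟨fun v hv hv' => ?_, fun v hv => ?_⟩, fun u hu w hw ha => ?_, PM_congr hγM hd hN h h4⟩
      · rw [← h v hv']; exact h1 v hv hv'
      · rw [← h v (hγB v hv)]; exact h2 v hv
      · rw [← h w hw]; exact h3 u hu w hw ha
    have hout : ∀ φ : Conf, eP φ → (∀ v ∈ innerBdry γ, φ v ≤ k) → 
        ∀ u ∈ γ, ∀ w, w ∉ γ → adjS u w → |φ u - φ w| = |φ u - k| + |k - φ w| := by
      intro φ hφ hi u hu w hw ha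
      exact abs_split (hi u (mem_innerBdry.2 ⟨hu, w, hw, ha⟩)) (hφ.2.1 u hu w hw ha)
    have key := repl E β lam hγU k k k
      (fun φ => ind (φ ∈ signedConfigs U pl k ∧ PM k (insert γ M) φ))
      (fun φ => ind (φ ∈ signedConfigs U pl k ∧ PM k M φ))
      (fun φ => ind (eP φ))
      (fun ξ => ind (ξ ∈ signedConfigs γ mi k ∧ ∃ v ∈ γ, ξ v = 0))
      (fun ξ => ind (ξ ∈ signedConfigs γ mi k)) (q γ)
      (fun φ ψ h => le_antisymm (ind_mono (heP φ ψ h)) (ind_mono (heP ψ φ (fun v hv => (h v hv).symm))))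
      (fun φ _ u _ w _ _ => by simp)
      (fun φ hφ => by
        rw [← ind_and]
        refine ind_mono ?_
        rintro ⟨⟨h1, h2, h3⟩, h4⟩
        obtain ⟨p1, ⟨z, hz, hz0⟩, p3⟩ := h4 γ (mem_insert_self _ _)
        refine ⟨⟨⟨fun v hv _ => h2 v hv, fun v hv => h3 v hv⟩, p3, fun γ' h => h4 γ' (hsub h)⟩,
          glue_mem_mi.2 ⟨fun v hv => h2 v (hγU hv), p1⟩, z, hz, ?_⟩
        rw [glue_in hz, hz0])
      (fun φ he hs => by
        obtain ⟨h1, -⟩ := ind_ne_zero.1 hs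
        exact hout φ (ind_ne_zero.1 he) (glue_mem_mi.1 h1).2)
      (fun φ hφ => by
        rw [← ind_and]
        refine ind_mono ?_
        rintro ⟨⟨⟨h1, h2⟩, h3, h4⟩, h5⟩
        have h5 := glue_mem_mi.1 h5
        refine ⟨⟨hφ, fun v hv => ?_, fun v hv => h2 v hv⟩, h4⟩
        by_cases hvγ : v ∈ γ
        · exact h5.1 v hvγ
        · exact h1 v hv hvγ)
      (fun φ he hs => by
        have h1 := ind_ne_zero.1 hs
        exact hout φ (ind_ne_zero.1 he) (glue_mem_mi.1 h1).2)
      (hq γ hγC)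
    have e1 : ex (-β * |((k - k : ℤ) : ℝ)| * per E γ) = 1 := by simp [ex_zero]
    rw [e1, mul_one] at key
    refine key.trans ?_
    rw [Finset.prod_insert hγM, mul_assoc]
    gcongr

lemma shift_down_U {E : Finset Edge} {β lam : ℝ} (hβ : 0 ≤ β) (hlam : 0 ≤ lam) {U : Finset Site}
    (hU : connectedIn ((↑U : Set Site)ᶜ)) (k : ℤ) (hk : 0 ≤ k) (M : Finset (Finset Site)) 
    (hM : M ∈ Fam (U \ innerBdry U)) :
    Zr E β lam U (k + 1) (fun φ => ind (φ ∈ signedConfigs U pl (k + 1) ∧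
        (Gam U {v | k + 1 ≤ φ v}).filter (fun γ => ∃ v ∈ γ, φ v = 0) = M)) ≤
      ((∏ γ ∈ M, ex (-β * per E γ)) * ex (-lam) ^ ((U \ innerBdry U) \ Un M).card) *
      Zr E β lam U k (fun ψ => ind (ψ ∈ signedConfigs U pl k ∧ PM k M ψ) * ind (NA M)) := by
  have hUnB : Un M ⊆ U \ innerBdry U := by
    intro v hv
    obtain ⟨γ, hγ, h⟩ := mem_Un.1 hv
    exact (mem_Cls.1 ((mem_Fam.1 hM).1 hγ)).1 h
  have hUnU : Un M ⊆ U := hUnB.trans Finset.sdiff_subset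
  let c : Conf := fun v => if v ∈ Un M then 0 else -1
  have c0 : ∀ v, v ∈ Un M → c v = 0 := fun v hv => by simp [c, hv]
  have c1 : ∀ v, v ∉ Un M → c v = -1 := fun v hv => by simp [c, hv]
  refine Zr_shift c _ _ _ ?_ ?_
  · intro v hv
    rw [c1 v (fun h => hv (hUnU h))]; ring
  · intro φ hφ hne
    obtain ⟨⟨h1, h2, h3⟩, hMG⟩ := ind_ne_zero.1 hne
    have hQ : ∀ v, v ∉ U → v ∈ {v | k + 1 ≤ φ v} := fun v hv => (hφ v hv).ge
    have hMs : ∀ γ ∈ M, γ ∈ Gam U {v | k + 1 ≤ φ v} ∧ ∃ v ∈ γ, φ v = 0 := by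
      intro γ hγ; rw [← hMG, Finset.mem_filter] at hγ; exact hγ
    have hzero : ∀ v, φ v = 0 → v ∈ Un M := by
      intro v hv
      obtain ⟨γ, hγ, h⟩ := Gam_cover' hQ (v := v) (by
        intro h; have h : k + 1 ≤ φ v := h; omega)
      refine mem_Un.2 ⟨γ, ?_, h⟩
      rw [← hMG, Finset.mem_filter]; exact ⟨hγ, v, h, hv⟩
    have hn : ∀ γ ∈ M, ∀ u ∈ γ, ∀ w, w ∉ γ → adjS u w →
        φ u ≤ k ∧ k + 1 ≤ φ w ∧ ∀ γ' ∈ M, w ∉ γ' := by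
      intro γ hγ u hu w hw huw
      obtain ⟨a1, a2, a3⟩ := Gam_bdry hQ (hMs γ hγ).1 hu hw huw
      have a1' : ¬ k + 1 ≤ φ u := a1
      exact ⟨by omega, a2, fun γ' hγ' => a3 γ' (hMs γ' hγ').1⟩
    refine ⟨?_, ?_⟩
    · refine (ind_le_one _).trans ?_
      rw [← ind_and, ind_pos]
      refine ⟨⟨⟨fun v hv => ?_, fun v hv => ?_, fun v hv => ?_⟩, fun γ hγ => ⟨fun v hv => ?_, ?_,
        fun u hu w hw ha => ?_⟩⟩, fun γ hγ u hu w hw ha => (hn γ hγ u hu w hw ha).2.2⟩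
      · rw [Pi.add_apply, c1 v (fun h => hv (hUnU h)), hφ v hv]; ring
      · have := h2 v hv
        rw [Pi.add_apply]
        by_cases hvM : v ∈ Un M
        · rw [c0 v hvM]; omega
        · rw [c1 v hvM]
          have : φ v ≠ 0 := fun h => hvM (hzero v h)
          omega
      · have : k + 1 ≤ φ v := h3 v hv
        change k ≤ φ v + c v
        rw [c1 v (fun h => (Finset.mem_sdiff.1 (hUnB h)).2 hv)]; omega
      · obtain ⟨hvγ, w, hw, ha⟩ := mem_innerBdry.1 hv
        rw [Pi.add_apply, c0 v (mem_Un.2 ⟨γ, hγ, hvγ⟩)]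
        have := (hn γ hγ v hvγ w hw ha).1
        omega
      · obtain ⟨z, hz, hz0⟩ := (hMs γ hγ).2
        refine ⟨z, hz, ?_⟩
        rw [Pi.add_apply, c0 z (mem_Un.2 ⟨γ, hγ, hz⟩), hz0]; rfl
      · have := hn γ hγ u hu w hw ha
        rw [Pi.add_apply, c1 w (fun h => by
          obtain ⟨γ', hγ', h'⟩ := mem_Un.1 h; exact this.2.2 γ' hγ' h')]
        omega
    · have hper := sum_per (E := E) (M := M) (mem_Fam.1 hM).2
        (fun γ hγ u hu w hw huw => (hn γ hγ u hu w hw huw).2.2)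
      have hcross : ∀ u w, adjS u w → u ∈ Un M → w ∉ Un M → φ u ≤ k ∧ k + 1 ≤ φ w := by
        intro u w huw hu hw
        obtain ⟨γ, hγ, h⟩ := mem_Un.1 hu
        have := hn γ hγ u h w (fun h' => hw (mem_Un.2 ⟨γ, hγ, h'⟩)) huw
        exact ⟨this.1, this.2.1⟩
      have eH : HE E (φ + c) + per E (Un M) = HE E φ := by
        rw [per_eq]
        unfold HE
        rw [← Finset.sum_add_distrib]
        refine Finset.sum_congr rfl (fun e _ => ?_)
        have hadj := adjS_sh e.1 e.2
        generalize e.1 + sh e.2 = w at *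
        generalize e.1 = u at *
        have q1 := hcross u w hadj
        have q2 := hcross w u (adjS_symm hadj)
        simp only [Pi.add_apply]
        by_cases hu : u ∈ Un M <;> by_cases hw : w ∈ Un M
        · rw [c0 u hu, c0 w hw]; simp [hu, hw]
        · obtain ⟨p1, p2⟩ := q1 hu hw
          rw [c0 u hu, c1 w hw, if_pos (by simp [hu, hw]), abs_of_nonpos (by omega),
            abs_of_nonpos (by omega)]
          ring
        · obtain ⟨p1, p2⟩ := q2 hw hu
          rw [c1 u hu, c0 w hw, if_pos (by simp [hu, hw]), abs_of_nonneg (by omega),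
            abs_of_nonneg (by omega)]
          ring
        · rw [c1 u hu, c1 w hw]; simp [hu, hw]
      have eF : sosField U φ = sosField U (φ + c) + (U \ Un M).card := by
        have : sosField U (φ + c) = sosField U φ + ∑ v ∈ U, (c v : ℝ) := by
          simp only [sosField, Pi.add_apply]; push_cast; rw [Finset.sum_add_distrib]
        rw [this]
        have e2 : ∑ v ∈ U, (c v : ℝ) = - (U \ Un M).card := by
          rw [← Finset.sum_sdiff hUnU, Finset.sum_congr rfl (fun v hv => by
            rw [c1 v (Finset.mem_sdiff.1 hv).2]), Finset.sum_congr (s₁ := Un M) rfl (fun v hv => by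
            rw [c0 v hv])]
          simp
        rw [e2]; ring
      have ecard : ((((U \ innerBdry U) \ Un M).card : ℕ) : ℝ) ≤ (U \ Un M).card := by
        exact_mod_cast Finset.card_le_card (Finset.sdiff_subset_sdiff Finset.sdiff_subset subset_rfl)
      have eP : (∏ γ ∈ M, ex (-β * per E γ)) * ex (-lam) ^ ((U \ innerBdry U) \ Un M).card =
          ex (-β * per E (Un M) + (((U \ innerBdry U) \ Un M).card : ℝ) * (-lam)) := by
        rw [ex_add, ex_nat_mul, ← ex_sum, ← Finset.mul_sum, ← hper]
        push_cast; rfl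
      rw [eP]
      refine wt_le _ ?_
      rw [← eH, eF]
      push_cast
      nlinarith

end
end SOS


set_option linter.unusedVariables false
set_option linter.unusedSectionVars false
namespace SOS
noncomputable section
open scoped Classical ENNReal
open Finset

lemma Cls_mono {B U : Finset Site} (h : B ⊆ U) {γ : Finset Site} (hγ : γ ∈ Cls B) : γ ∈ Cls U := by
  rw [mem_Cls] at *
  exact ⟨hγ.1.trans h, hγ.2⟩

lemma zero_union {E : Finset Edge} {β lam : ℝ} {h : ℕ} (hβ : 1000 ≤ β) (hlam : 0 < lam)
    (hl : lam ≤ Real.exp (-β) ^ (4 * h + 1)) {γ : Finset Site} (hE : Good E γ)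
    (hU : connectedIn ((↑γ : Set Site)ᶜ)) (k : ℤ) (hk : (h:ℤ) ≤ k) :
    Zr E β lam γ k (fun ξ => ind (ξ ∈ signedConfigs γ mi k ∧ ∃ v ∈ γ, ξ v = 0)) ≤
      (ENNReal.ofReal (3 * Real.exp (-β) ^ (4 * h)) * γ.card) * ZS E β lam γ mi k := by
  calc _ ≤ Zr E β lam γ k (fun ξ => ∑ v ∈ γ, ind (ξ ∈ signedConfigs γ mi k ∧ ξ v ∈ ({0} : Set ℤ))) := by
        refine Zr_mono (fun ξ _ => ?_)
        by_cases hh : ξ ∈ signedConfigs γ mi k ∧ ∃ v ∈ γ, ξ v = 0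
        · obtain ⟨h1, v, hv, h0⟩ := hh
          refine (ind_le_one _).trans ?_
          rw [← ind_pos (p := ξ ∈ signedConfigs γ mi k ∧ ξ v ∈ ({0} : Set ℤ)) ⟨h1, h0⟩]
          exact Finset.single_le_sum
            (f := fun v => ind (ξ ∈ signedConfigs γ mi k ∧ ξ v ∈ ({0} : Set ℤ)))
            (fun _ _ => zero_le) hv
        · rw [ind_neg hh]; exact zero_le
    _ = ∑ v ∈ γ, ZA E β lam γ mi k v {0} := Zr_sum _ _
    _ ≤ ∑ v ∈ γ, ENNReal.ofReal (3 * Real.exp (-β) ^ (4 * h)) * ZS E β lam γ mi k :=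
        Finset.sum_le_sum (fun v hv => zero_lem hβ hlam hl h le_rfl hE hU k hk mi v hv)
    _ = _ := by rw [Finset.sum_const, nsmul_eq_mul]; ring

lemma Ulem {E : Finset Edge} {β lam : ℝ} {h : ℕ} (hβ : 1000 ≤ β) (hlam : 0 < lam) (hlam1 : lam ≤ 1)
    (hl : lam ≤ Real.exp (-β) ^ (4 * h + 1)) (hl' : Real.exp (-β) ^ (4 * h + 2) ≤ lam)
    {U : Finset Site} (hE : Good E U)
    (hU : connectedIn ((↑U : Set Site)ᶜ)) (k : ℤ) (hk : (h:ℤ) ≤ k) :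
    ZS E β lam U pl (k + 1) ≤ ZS E β lam U pl k := by
  have hk0 : 0 ≤ k := by omega
  set t := Real.exp (-β) with ht
  have t0 : 0 < t := Real.exp_pos _
  let B := U \ innerBdry U
  have hBU : B ⊆ U := Finset.sdiff_subset
  let q : Finset Site → ℝ≥0∞ := fun γ => ENNReal.ofReal (3 * t ^ (4 * h)) * γ.card
  have s1 : ZS E β lam U pl (k + 1) ≤ Zr E β lam U (k + 1) (fun φ => ∑ M ∈ Fam B,
      ind (φ ∈ signedConfigs U pl (k + 1) ∧
        (Gam U {v | k + 1 ≤ φ v}).filter (fun γ => ∃ v ∈ γ, φ v = 0) = M)) := by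
    refine Zr_mono (fun φ hφ => ?_)
    by_cases hΩ : φ ∈ signedConfigs U pl (k + 1)
    swap
    · rw [ind_neg hΩ]; exact zero_le
    have hQ : ∀ v, v ∉ U → v ∈ {v | k + 1 ≤ φ v} := fun v hv => (hφ v hv).ge
    have hmem : (Gam U {v | k + 1 ≤ φ v}).filter (fun γ => ∃ v ∈ γ, φ v = 0) ∈ Fam B := by
      rw [mem_Fam]
      refine ⟨fun γ hγ => ?_, fun γ hγ γ' hγ' => ?_⟩
      · have hγ := (Finset.mem_filter.1 hγ).1
        have h1 := mem_Cls.1 (Gam_sub_Cls hQ hU hγ)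
        refine mem_Cls.2 ⟨fun v hv => ?_, h1.2⟩
        refine Finset.mem_sdiff.2 ⟨h1.1 hv, fun hb => ?_⟩
        exact Gam_innerBdry hQ hb (hΩ.2.2 v hb) hγ hv
      · exact Gam_disjoint γ (Finset.mem_filter.1 hγ).1 γ' (Finset.mem_filter.1 hγ').1
    refine (ind_le_one _).trans ?_
    refine le_trans (ind_pos ⟨hΩ, rfl⟩).ge (Finset.single_le_sum
      (f := fun M => ind (φ ∈ signedConfigs U pl (k + 1) ∧
        (Gam U {v | k + 1 ≤ φ v}).filter (fun γ => ∃ v ∈ γ, φ v = 0) = M))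
      (fun _ _ => zero_le) hmem)
  have s2 : ∀ M ∈ Fam B, Zr E β lam U (k + 1) (fun φ => ind (φ ∈ signedConfigs U pl (k + 1) ∧
        (Gam U {v | k + 1 ≤ φ v}).filter (fun γ => ∃ v ∈ γ, φ v = 0) = M)) ≤
      ((∏ γ ∈ M, q γ * ex (-β * per E γ)) * ex (-lam) ^ (B \ Un M).card) * ZS E β lam U pl k := by
    intro M hM
    refine (shift_down_U (by linarith) hlam.le hU k hk0 M hM).trans ?_
    obtain ⟨hM1, hM2⟩ := mem_Fam.1 hM
    have : Zr E β lam U k (fun ψ => ind (ψ ∈ signedConfigs U pl k ∧ PM k M ψ) * ind (NA M)) ≤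
        (∏ γ ∈ M, q γ) * ZS E β lam U pl k := by
      by_cases hN : NA M
      · simp only [ind_pos hN, mul_one]
        refine remove_all k q (fun γ hγ => ?_) M hM2 hN (fun γ hγ => Cls_mono hBU (hM1 hγ)) ?_
        · obtain ⟨c1, c2, c3, c4⟩ := mem_Cls.1 hγ
          exact zero_union hβ hlam hl (hE.mono c1) c4 k hk
        · intro γ hγ v hv hvγ
          exact (Finset.mem_sdiff.1 ((mem_Cls.1 (hM1 hγ)).1 hvγ)).2 hv
      · have e : (fun ψ : Conf => ind (ψ ∈ signedConfigs U pl k ∧ PM k M ψ) * ind (NA M)) =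
            fun ψ => 0 * ind (ψ ∈ signedConfigs U pl k) := by
          funext ψ; rw [ind_neg hN]; simp
        rw [e, Zr_mul, zero_mul]; exact zero_le
    refine (mul_le_mul_right this _).trans (le_of_eq ?_)
    have e : ∏ γ ∈ M, q γ * ex (-β * per E γ) = (∏ γ ∈ M, q γ) * ∏ γ ∈ M, ex (-β * per E γ) :=
      Finset.prod_mul_distrib
    rw [e]
    generalize ∏ γ ∈ M, q γ = X
    ring
  calc ZS E β lam U pl (k + 1) ≤ _ := s1
    _ = ∑ M ∈ Fam B, _ := Zr_sum _ _
    _ ≤ ∑ M ∈ Fam B, _ := Finset.sum_le_sum s2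
    _ = (∑ M ∈ Fam B, (∏ γ ∈ M, q γ * ex (-β * per E γ)) * ex (-lam) ^ (B \ Un M).card) *
        ZS E β lam U pl k := by rw [Finset.sum_mul]
    _ ≤ 1 * ZS E β lam U pl k := by
        gcongr
        refine family (fun γ => q γ * ex (-β * per E γ)) _ B (fun v hv => ?_) _ B rfl subset_rfl
        have h1 : ∑ γ ∈ (Cls B).filter (fun γ => v ∈ γ), q γ * ex (-β * per E γ) ≤
            ENNReal.ofReal (3 * t ^ (4 * h) * (2 ^ 84 * t ^ 4)) := by
          rw [ENNReal.ofReal_mul (by positivity)]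
          refine le_trans ?_ (mul_le_mul_right (sumA (hE.mono hBU) hβ v) _)
          rw [Finset.mul_sum]
          exact Finset.sum_le_sum (fun γ _ => by simp only [q]; rw [mul_assoc])
        refine (add_le_add_right h1 _).trans ?_
        rw [ex, ← ENNReal.ofReal_add (by positivity) (by positivity), ENNReal.ofReal_le_one]
        have h2 := exp_neg_le hlam.le hlam1
        have h3 : 3 * 2 ^ 84 * t ^ 2 ≤ 1 / 2 := by
          calc 3 * 2 ^ 84 * t ^ 2 ≤ 3 * 2 ^ 84 * (1 / 2 ^ 200) ^ 2 := by gcongr; exact t_le hβ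
            _ ≤ _ := by norm_num
        have h4 : 3 * t ^ (4 * h) * (2 ^ 84 * t ^ 4) ≤ lam / 2 := by
          calc 3 * t ^ (4 * h) * (2 ^ 84 * t ^ 4) = t ^ (4 * h + 2) * (3 * 2 ^ 84 * t ^ 2) := by ring
            _ ≤ lam * (1 / 2) := by gcongr
            _ = _ := by ring
        linarith
    _ = _ := one_mul _

/-- contour sum -/
lemma sumC {E : Finset Edge} {U : Finset Site} (hE : Good E U) {β : ℝ} (hβ : 1000 ≤ β) (v : Site)
    (hv : v ∈ U) (c : ℝ≥0∞) :
    ∑ γ ∈ (Cls U).filter (fun γ => v ∈ γ), c * ex (-β * per E γ) ≤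
      c * ENNReal.ofReal (2 * Real.exp (-β) ^ 4) := by
  set t := Real.exp (-β) with ht
  have t0 : 0 < t := Real.exp_pos _
  refine (sum_split hE hβ v c c _ le_rfl (fun _ _ _ _ => le_rfl) hv).trans ?_
  rw [← mul_add, ← ENNReal.ofReal_add (by positivity) (by positivity)]
  gcongr
  have h3 : 2 ^ 126 * t ^ 2 ≤ 1 := by
    calc 2 ^ 126 * t ^ 2 ≤ 2 ^ 126 * (1 / 2 ^ 200) ^ 2 := by gcongr; exact t_le hβ
      _ ≤ 1 := by norm_num
  calc t ^ 4 + 2 ^ 126 * t ^ 6 = t ^ 4 + t ^ 4 * (2 ^ 126 * t ^ 2) := by ring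
    _ ≤ t ^ 4 + t ^ 4 * 1 := by gcongr
    _ = _ := by ring

lemma tail_down {E : Finset Edge} {β lam : ℝ} {h : ℕ} (hβ : 1000 ≤ β) (hlam : 0 < lam)
    (hl : lam ≤ Real.exp (-β) ^ (4 * h + 1)) (r : ℕ) : ∀ (j : ℕ), j ≤ h → ∀ {U : Finset Site},
    Good E U → connectedIn ((↑U : Set Site)ᶜ) → ∀ (η : Site → BSign) (x : Site), x ∈ U →
    ZA E β lam U η j x {a | a ≤ (j:ℤ) - r} ≤
      ENNReal.ofReal (2 * Real.exp (-β) ^ 4) ^ r * ZS E β lam U η j := by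
  induction r with
  | zero =>
    intro j _ U _ _ η x _
    rw [pow_zero, one_mul]
    exact Zr_mono (fun φ _ => ind_mono (fun h => h.1))
  | succ r ih =>
    intro j hj U hE hU η x hx
    rcases j with _ | j
    · refine le_trans ?_ (zero_le)
      have : ∀ φ : Conf, ¬ (φ ∈ signedConfigs U η ((0:ℕ):ℤ) ∧
          φ x ∈ {a : ℤ | a ≤ ((0:ℕ):ℤ) - ((r + 1 : ℕ):ℤ)}) := by
        rintro φ ⟨⟨-, h1, -⟩, h2⟩
        have h2 : φ x ≤ ((0:ℕ):ℤ) - ((r + 1 : ℕ):ℤ) := h2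
        have := h1 x hx
        push_cast at h2
        omega
      have e : (fun φ : Conf => ind (φ ∈ signedConfigs U η ((0:ℕ):ℤ) ∧
          φ x ∈ {a : ℤ | a ≤ ((0:ℕ):ℤ) - ((r + 1 : ℕ):ℤ)})) = fun φ => 0 * 0 := by
        funext φ; rw [ind_neg (this φ)]; simp
      change Zr E β lam U _ _ ≤ 0
      rw [e, Zr_mul, zero_mul]
    · have h1 := step_down (E := E) (β := β) (lam := lam) hU (le_refl ((j + 1 : ℕ):ℤ)) η x
        {a | a ≤ ((j + 1 : ℕ):ℤ) - ((r + 1 : ℕ):ℤ)} (by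
          intro a ha
          have ha : a ≤ ((j + 1 : ℕ):ℤ) - ((r + 1 : ℕ):ℤ) := ha
          push_cast at ha ⊢; omega)
        (fun γ => ENNReal.ofReal (2 * Real.exp (-β) ^ 4) ^ r) (by
          intro γ hγ hxγ
          obtain ⟨c1, c2, c3, c4⟩ := mem_Cls.1 hγ
          have e : ((j + 1 : ℕ) : ℤ) - 1 = j := by push_cast; ring
          have e2 : ((j + 1 : ℕ):ℤ) - ((r + 1 : ℕ):ℤ) = j - r := by push_cast; ring
          rw [e, e2]
          refine (ih j (by omega) (hE.mono c1) c4 mi x hxγ).trans ?_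
          gcongr
          exact Dlem hβ hlam hl (hE.mono c1) c4 j hj)
      refine h1.trans ?_
      gcongr
      rw [pow_succ]
      exact sumC hE hβ x hx _

lemma tail_up {E : Finset Edge} {β lam : ℝ} {h : ℕ} (hβ : 1000 ≤ β) (hlam : 0 < lam)
    (hlam1 : lam ≤ 1)
    (hl : lam ≤ Real.exp (-β) ^ (4 * h + 1)) (hl' : Real.exp (-β) ^ (4 * h + 2) ≤ lam)
    (r : ℕ) : ∀ (k : ℤ), (h:ℤ) ≤ k → ∀ {U : Finset Site},
    Good E U → connectedIn ((↑U : Set Site)ᶜ) → ∀ (η : Site → BSign) (x : Site), x ∈ U →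
    ZA E β lam U η k x {a | k + r ≤ a} ≤
      ENNReal.ofReal (2 * Real.exp (-β) ^ 4) ^ r * ZS E β lam U η k := by
  induction r with
  | zero =>
    intro k _ U _ _ η x _
    rw [pow_zero, one_mul]
    exact Zr_mono (fun φ _ => ind_mono (fun h => h.1))
  | succ r ih =>
    intro k hk U hE hU η x hx
    have h1 := step_up (E := E) (β := β) (lam := lam) hU (k := k) η x
        {a | k + ((r + 1 : ℕ):ℤ) ≤ a} (by
          intro a ha
          have ha : k + ((r + 1 : ℕ):ℤ) ≤ a := ha
          push_cast at ha ⊢; omega)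
        (fun γ => ENNReal.ofReal (2 * Real.exp (-β) ^ 4) ^ r) (by
          intro γ hγ hxγ
          obtain ⟨c1, c2, c3, c4⟩ := mem_Cls.1 hγ
          have e2 : k + ((r + 1 : ℕ):ℤ) = k + 1 + r := by push_cast; ring
          rw [e2]
          refine (ih (k + 1) (by omega) (hE.mono c1) c4 pl x hxγ).trans ?_
          gcongr
          exact Ulem hβ hlam hlam1 hl hl' (hE.mono c1) c4 k hk)
    refine h1.trans ?_
    gcongr
    rw [pow_succ]
    exact sumC hE hβ x hx _

end
end SOS


set_option linter.unusedVariables false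
set_option linter.unusedSectionVars false
namespace SOS
noncomputable section
open scoped Classical ENNReal
open Finset

/-- edges touching `V` -/
def EV (V : Finset Site) : Finset Edge :=
  (V ×ˢ (univ : Finset Bool)) ∪ (V ×ˢ (univ : Finset Bool)).image (fun e => (e.1 - sh e.2, e.2))

lemma EV_good (V : Finset Site) : Good (EV V) V := by
  intro v hv i
  refine ⟨Finset.mem_union_left _ (by simp [hv]), Finset.mem_union_right _ ?_⟩
  rw [Finset.mem_image]
  exact ⟨(v, i), by simp [hv], rfl⟩

lemma mem_F2 {V : Finset Site} {e : Edge} :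
    e ∈ (V ×ˢ (univ : Finset Bool)).image (fun e => (e.1 - sh e.2, e.2)) ↔ e.1 + sh e.2 ∈ V := by
  rw [Finset.mem_image]
  constructor
  · rintro ⟨a, ha, rfl⟩
    rw [Finset.mem_product] at ha
    simpa only [sub_add_cancel] using ha.1
  · intro h
    refine ⟨(e.1 + sh e.2, e.2), by simp [h], ?_⟩
    simp only [add_sub_cancel_right]

lemma energy_eq (V : Finset Site) (ψ : Conf) : sosEnergy V ψ = (HE (EV V) ψ : ℝ) := by
  let g : Edge → ℝ := fun e => |(ψ e.1 : ℝ) - (ψ (e.1 + sh e.2) : ℝ)|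
  have hd : ∀ f : Site → ℝ, ∑ d ∈ dirs, f d = ∑ i : Bool, (f (sh i) + f (-sh i)) := by
    intro f
    have : dirs = {(1, 0), (-1, 0), (0, 1), (0, -1)} := rfl
    rw [this, Finset.sum_insert (by decide), Finset.sum_insert (by decide),
      Finset.sum_insert (by decide), Finset.sum_singleton, Fintype.sum_bool]
    simp [sh]
    ring
  have h1 : sosEnergy V ψ = ∑ e ∈ V ×ˢ (univ : Finset Bool),
        (if e.1 + sh e.2 ∈ V then (1:ℝ)/2 else 1) * g e +
      ∑ e ∈ (V ×ˢ (univ : Finset Bool)).image (fun e => (e.1 - sh e.2, e.2)),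
        (if e.1 ∈ V then (1:ℝ)/2 else 1) * g e := by
    rw [Finset.sum_image (by
      rintro ⟨a, i⟩ _ ⟨b, j⟩ _ hab
      simp only [Prod.mk.injEq] at hab
      obtain ⟨h1, h2⟩ := hab
      subst h2
      rw [sub_left_inj] at h1
      rw [h1]), ← Finset.sum_add_distrib, Finset.sum_product]
    unfold sosEnergy
    refine Finset.sum_congr rfl (fun v _ => ?_)
    rw [hd]
    refine Finset.sum_congr rfl (fun i _ => ?_)
    simp only [g, sub_add_cancel, ← sub_eq_add_neg]
    rw [abs_sub_comm (ψ (v - sh i) : ℝ)]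
  have h2 : ∀ (F : Finset Edge) (a : Edge → ℝ), F ⊆ EV V →
      ∑ e ∈ F, a e = ∑ e ∈ EV V, if e ∈ F then a e else 0 := by
    intro F a hF
    rw [← Finset.sum_filter, Finset.filter_mem_eq_inter, Finset.inter_eq_right.2 hF]
  rw [h1, h2 _ _ Finset.subset_union_left, h2 _ _ Finset.subset_union_right,
    ← Finset.sum_add_distrib, HE]
  push_cast
  refine Finset.sum_congr rfl (fun e he => ?_)
  have he' : e.1 ∈ V ∨ e.1 + sh e.2 ∈ V := by
    rcases Finset.mem_union.1 he with h | h
    · left; exact (Finset.mem_product.1 h).1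
    · right; exact mem_F2.1 h
  have m1 : e ∈ V ×ˢ (univ : Finset Bool) ↔ e.1 ∈ V := by simp [Finset.mem_product]
  simp only [mem_F2, m1]
  change _ = g e
  by_cases c1 : e.1 ∈ V <;> by_cases c2 : e.1 + sh e.2 ∈ V
  · simp only [c1, c2, if_true]; ring
  · simp only [c1, c2, if_true, if_false]; ring
  · simp only [c1, c2, if_true, if_false]; ring
  · exact absurd he' (by simp only [c1, c2, or_self, not_false_eq_true])

lemma Zr_eq_tsum {β lam : ℝ} (V : Finset Site) (k : ℤ) (S : Set Conf)
    (hS : ∀ φ ∈ S, ∀ v, v ∉ V → φ v = k) :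
    Zr (EV V) β lam V k (fun φ => ind (φ ∈ S)) =
      ∑' φ : Conf, ENNReal.ofReal (S.indicator (sosWt β lam V) φ) := by
  unfold Zr Iop
  refine tsum_congr (fun φ => ?_)
  by_cases h : φ ∈ S
  · rw [if_pos (show ∀ v, v ∉ V → φ v = cst k v from hS φ h)]
    beta_reduce
    rw [ind_pos h, one_mul, Set.indicator_of_mem h, wt, sosWt, energy_eq]
  · beta_reduce
    rw [ind_neg h, zero_mul, Set.indicator_of_notMem h]; simp

lemma final_bound {β lam : ℝ} {h : ℕ} (hβ : 1000 ≤ β) (hlam : 0 < lam) (hlam1 : lam ≤ 1)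
    (hl : lam ≤ Real.exp (-β) ^ (4 * h + 1)) (hl' : Real.exp (-β) ^ (4 * h + 2) ≤ lam)
    {V : Finset Site} (hV : SimplyConn V) (η : Site → BSign) (x : Site) (hx : x ∈ V) (n : ℕ) :
    Zr (EV V) β lam V h (fun φ => ind (φ ∈ signedConfigs V η h ∩ {ψ | (n:ℤ) ≤ |ψ x - (h:ℤ)|})) ≤
      ENNReal.ofReal (2 * (2 * Real.exp (-β) ^ 4) ^ n) *
        Zr (EV V) β lam V h (fun φ => ind (φ ∈ signedConfigs V η h)) := by
  have h1 := tail_down (E := EV V) hβ hlam hl n h le_rfl (EV_good V) hV.2 η x hx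
  have h2 := tail_up (E := EV V) hβ hlam hlam1 hl hl' n h le_rfl (EV_good V) hV.2 η x hx
  have h3 : Zr (EV V) β lam V h
      (fun φ => ind (φ ∈ signedConfigs V η h ∩ {ψ | (n:ℤ) ≤ |ψ x - (h:ℤ)|})) ≤
      ZA (EV V) β lam V η h x {a | a ≤ (h:ℤ) - n} + ZA (EV V) β lam V η h x {a | (h:ℤ) + n ≤ a} := by
    have e := Zr_sum (E := EV V) (β := β) (lam := lam) (U := V) (k := (h:ℤ)) (univ : Finset Bool)
      (fun b φ => if b then ind (φ ∈ signedConfigs V η h ∧ φ x ∈ {a : ℤ | a ≤ (h:ℤ) - n}) else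
        ind (φ ∈ signedConfigs V η h ∧ φ x ∈ {a : ℤ | (h:ℤ) + n ≤ a}))
    simp only [Fintype.sum_bool, if_true, Bool.false_eq_true, if_false] at e
    refine le_trans (Zr_mono (fun φ _ => ?_)) e.le
    by_cases hφ : φ ∈ signedConfigs V η h ∩ {ψ | (n:ℤ) ≤ |ψ x - (h:ℤ)|}
    · rw [ind_pos hφ]
      obtain ⟨p1, p2⟩ := hφ
      have p2 : (n:ℤ) ≤ |φ x - (h:ℤ)| := p2
      rcases le_abs.1 p2 with p | p
      · rw [ind_pos (p := φ ∈ signedConfigs V η h ∧ φ x ∈ {a : ℤ | (h:ℤ) + n ≤ a})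
          ⟨p1, by change (h:ℤ) + n ≤ φ x; omega⟩]
        exact le_add_self
      · rw [ind_pos (p := φ ∈ signedConfigs V η h ∧ φ x ∈ {a : ℤ | a ≤ (h:ℤ) - n})
          ⟨p1, by change φ x ≤ (h:ℤ) - n; omega⟩]
        exact le_self_add
    · rw [ind_neg hφ]; exact zero_le
  refine h3.trans ((add_le_add h1 h2).trans (le_of_eq ?_))
  have e : ENNReal.ofReal (2 * (2 * Real.exp (-β) ^ 4) ^ n) =
      2 * ENNReal.ofReal (2 * Real.exp (-β) ^ 4) ^ n := by
    rw [← ENNReal.ofReal_pow (by positivity), ENNReal.ofReal_mul (by norm_num), ENNReal.ofReal_ofNat]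
  rw [e]
  ring

lemma num_bound {β : ℝ} (n : ℕ) (hn : 1 ≤ n) :
    2 * (2 * Real.exp (-β) ^ 4) ^ n ≤ Real.exp (-4 * (β - 5) * n) := by
  have e : Real.exp (-4 * (β - 5) * n) = (Real.exp 20 * Real.exp (-β) ^ 4) ^ n := by
    rw [← Real.exp_nat_mul, ← Real.exp_add, ← Real.exp_nat_mul]; congr 1; push_cast; ring
  rw [e, mul_pow, mul_pow, ← mul_assoc]
  gcongr
  have h1 : (4:ℝ) ≤ Real.exp 20 := by have := Real.add_one_le_exp (20:ℝ); linarith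
  have h2 : (2:ℝ) ≤ 2 ^ n := by
    calc (2:ℝ) = 2 ^ 1 := by norm_num
      _ ≤ 2 ^ n := pow_le_pow_right₀ (by norm_num) hn
  calc (2:ℝ) * 2 ^ n ≤ 2 ^ n * 2 ^ n := by gcongr
    _ = 4 ^ n := by rw [← mul_pow]; norm_num
    _ ≤ _ := by gcongr

lemma main_bound {β lam : ℝ} {h : ℕ} (hβ : 1000 ≤ β) (hlam : 0 < lam) (hlam1 : lam ≤ 1)
    (hl : lam ≤ Real.exp (-β) ^ (4 * h + 1)) (hl' : Real.exp (-β) ^ (4 * h + 2) ≤ lam)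
    {V : Finset Site} (hV : SimplyConn V) (η : Site → BSign) (x : Site) (hx : x ∈ V) (n : ℕ)
    (hn : 1 ≤ n) :
    Psos β lam η (h : ℤ) V {ψ : Site → ℤ | (n:ℤ) ≤ |ψ x - (h : ℤ)|} ≤
      Real.exp (-4 * (β - 5) * n) := by
  set S := signedConfigs V η (h:ℤ) with hS
  set A : Set Conf := {ψ : Site → ℤ | (n:ℤ) ≤ |ψ x - (h : ℤ)|} with hA
  have f0 : ∀ (T : Set Conf) φ, 0 ≤ T.indicator (sosWt β lam V) φ := fun T φ =>
    Set.indicator_nonneg (fun _ _ => (Real.exp_pos _).le) _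
  have key := final_bound hβ hlam hlam1 hl hl' hV η x hx n
  rw [Zr_eq_tsum V h _ (fun φ hφ => hφ.1.1), Zr_eq_tsum V h _ (fun φ hφ => hφ.1)] at key
  unfold Psos Zsos
  by_cases hs : Summable (fun ψ => S.indicator (sosWt β lam V) ψ)
  · have hs' : Summable (fun ψ => (S ∩ A).indicator (sosWt β lam V) ψ) :=
      Summable.of_nonneg_of_le (f0 _) (fun φ => Set.indicator_le_indicator_of_subset
        Set.inter_subset_left (fun _ => (Real.exp_pos _).le) _) hs
    rw [← ENNReal.ofReal_tsum_of_nonneg (f0 _) hs', ← ENNReal.ofReal_tsum_of_nonneg (f0 _) hs,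
      ← ENNReal.ofReal_mul (by positivity)] at key
    have hZ : 0 ≤ ∑' ψ, S.indicator (sosWt β lam V) ψ := tsum_nonneg (f0 _)
    rw [ENNReal.ofReal_le_ofReal_iff (by positivity)] at key
    refine div_le_of_le_mul₀ hZ (Real.exp_pos _).le ?_
    refine key.trans ?_
    gcongr
    exact num_bound n hn
  · have e : ∑' ψ, S.indicator (sosWt β lam V) ψ = 0 := tsum_eq_zero_of_not_summable hs
    rw [e, div_zero]
    exact (Real.exp_pos _).le

end
end SOS


/-- rigidity at height `h` for `λ ∈ I_h`. There is an absolute `β₀`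
such that for `β > β₀` and `0 < λ ≤ 1`: if `λ ∈ I_h = [e^{-4βh-2β}, e^{-4βh-β}]`, then
for every finite simply-connected `V`, every boundary signing `η`, every `x ∈ V` and
every integer `r ≥ 1`, `μ_{η,h,V}(|φ_x - h| ≥ r) ≤ e^{-4(β-5)r}`. -/
theorem statement11 :
    ∃ β₀ : ℝ, ∀ β : ℝ, β₀ < β → ∀ lam : ℝ, 0 < lam → lam ≤ 1 → ∀ h : ℕ,
      Real.exp (-4 * β * (h : ℝ) - 2 * β) ≤ lam →
      lam ≤ Real.exp (-4 * β * (h : ℝ) - β) →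
      ∀ V : Finset Site, SimplyConn V → ∀ η : Site → BSign, ∀ x ∈ V, ∀ r : ℤ, 1 ≤ r →
        Psos β lam η (h : ℤ) V {ψ : Site → ℤ | r ≤ |ψ x - (h : ℤ)|} ≤
          Real.exp (-4 * (β - 5) * (r : ℝ)) := by
  refine ⟨1000, fun β hβ lam hlam hlam1 h hl' hl V hV η x hx r hr => ?_⟩
  obtain ⟨n, rfl⟩ := Int.eq_ofNat_of_zero_le (by omega : 0 ≤ r)
  have hn : 1 ≤ n := by exact_mod_cast hr
  have e1 : Real.exp (-β) ^ (4 * h + 1) = Real.exp (-4 * β * (h : ℝ) - β) := by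
    rw [← Real.exp_nat_mul]; congr 1; push_cast; ring
  have e2 : Real.exp (-β) ^ (4 * h + 2) = Real.exp (-4 * β * (h : ℝ) - 2 * β) := by
    rw [← Real.exp_nat_mul]; congr 1; push_cast; ring
  have := SOS.main_bound hβ.le hlam hlam1 (hl.trans e1.ge) (e2.le.trans hl') hV η x hx n hn
  push_cast at this ⊢
  exact this
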